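/- arXiv:2110.14359 — 6 statements merged into one kernel-verified Lean document; each statement's English description precedes it below -/
import Mathlib

section
/- Each of the inclusions Y⁺ ↪ Y, Y⁻ ↪ Y, and Y* ↪ Y (all carrying the operator-norm topology) is a homotopy equivalence. -/
/-- A continuous map is a homotopy equivalence if it admits a continuous homotopy inverse. -/
def IsHomotopyEquiv {X Y : Type*} [TopologicalSpace X] [TopologicalSpace Y] (f : C(X, Y)) : Prop :=
  ∃ g : C(Y, X), (f.comp g).Homotopic (ContinuousMap.id Y) ∧
    (g.comp f).Homotopic (ContinuousMap.id X)
/-- The span of the eigenspaces of `u` corresponding to eigenvalues with positive imaginary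
part. -/
noncomputable def posEigenSpan {H : Type*} [NormedAddCommGroup H] [InnerProductSpace ℂ H]
    (u : H →L[ℂ] H) : Submodule ℂ H :=
  ⨆ μ ∈ {μ : ℂ | 0 < μ.im}, Module.End.eigenspace (u : H →ₗ[ℂ] H) μ

/-- The span of the eigenspaces of `u` corresponding to eigenvalues with negative imaginary
part. -/
noncomputable def negEigenSpan {H : Type*} [NormedAddCommGroup H] [InnerProductSpace ℂ H]
    (u : H →L[ℂ] H) : Submodule ℂ H :=
  ⨆ μ ∈ {μ : ℂ | μ.im < 0}, Module.End.eigenspace (u : H →ₗ[ℂ] H) μ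

open scoped InnerProductSpace ComplexConjugate
open InnerProductSpace Filter Topology

section HilbertBasisOperators

variable {H : Type*} [NormedAddCommGroup H] [InnerProductSpace ℂ H] [CompleteSpace H]

lemma inner_star_right (T : H →L[ℂ] H) (x y : H) : ⟪x, star T y⟫_ℂ = ⟪T x, y⟫_ℂ := by
  rw [ContinuousLinearMap.star_eq_adjoint, ContinuousLinearMap.adjoint_inner_right]

lemma inner_star_left (T : H →L[ℂ] H) (x y : H) : ⟪star T x, y⟫_ℂ = ⟪x, T y⟫_ℂ := by
  rw [ContinuousLinearMap.star_eq_adjoint, ContinuousLinearMap.adjoint_inner_left]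

/-- An infinite-dimensional separable Hilbert space has a Hilbert basis indexed by `ℕ`. -/
lemma exists_nat_hilbertBasis [TopologicalSpace.SeparableSpace H]
    (hinf : ¬ FiniteDimensional ℂ H) : Nonempty (HilbertBasis ℕ ℂ H) := by
  obtain ⟨w, b, hb⟩ := exists_hilbertBasis ℂ H
  have hdist : ∀ i j : w, i ≠ j → 1 ≤ ‖b i - b j‖ := by
    intro i j hij
    have h1 : ‖b i - b j‖ ^ 2 = 2 := by
      rw [@norm_sub_sq ℂ]
      simp [b.orthonormal.inner_eq_zero hij, b.orthonormal.norm_eq_one]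
      norm_num
    nlinarith [norm_nonneg (b i - b j)]
  have hcount : Countable w := by
    rw [← Set.countable_univ_iff]
    refine Set.PairwiseDisjoint.countable_of_isOpen (s := fun i : w => Metric.ball (b i) (1 / 2))
      ?_ (fun _ _ => Metric.isOpen_ball) (fun i _ => ⟨b i, by simp⟩)
    intro i _ j _ hij
    refine Metric.ball_disjoint_ball ?_
    rw [dist_eq_norm]
    linarith [hdist i j hij]
  have hinfw : Infinite w := by
    by_contra hfin
    rw [not_infinite_iff_finite] at hfin
    have := Fintype.ofFinite w
    exact hinf (b.toOrthonormalBasis.toBasis.finiteDimensional_of_finite)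
  obtain ⟨e⟩ := nonempty_equiv_of_countable (α := ℕ) (β := w)
  refine ⟨HilbertBasis.mkOfOrthogonalEqBot (v := b ∘ e) (b.orthonormal.comp _ e.injective) ?_⟩
  rw [e.surjective.range_comp, ← Submodule.topologicalClosure_eq_top_iff, b.dense_span]

variable (b : HilbertBasis ℕ ℂ H)

omit [CompleteSpace H] in
lemma HilbertBasis.ext_inner {x y : H} (h : ∀ n, ⟪b n, x⟫_ℂ = ⟪b n, y⟫_ℂ) : x = y := by
  refine b.repr.injective (lp.ext (funext fun n => ?_))
  simpa [b.repr_apply_apply] using h n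

/-- The operator `x ↦ ∑ a m ⟨b (π m), x⟩ b m`. -/
noncomputable def weightedOp (a : ℕ → ℂ) (π : ℕ → ℕ) : H →L[ℂ] H :=
  ∑' m, a m • rankOne ℂ (b m) (b (π m))

variable {a : ℕ → ℂ} (π : ℕ → ℕ)

lemma hasSum_weightedOp (ha : Summable fun n => ‖a n‖) :
    HasSum (fun m => a m • rankOne ℂ (b m) (b (π m))) (weightedOp b a π) := by
  refine Summable.hasSum (Summable.of_norm ?_)
  refine ha.congr fun m => ?_
  rw [norm_smul, norm_rankOne, b.orthonormal.norm_eq_one, b.orthonormal.norm_eq_one]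
  simp

lemma isCompactOperator_weightedOp (ha : Summable fun n => ‖a n‖) :
    IsCompactOperator (weightedOp b a π) := by
  classical
  refine isCompactOperator_of_tendsto (hasSum_weightedOp b π ha) (Eventually.of_forall fun s => ?_)
  induction s using Finset.induction_on with
  | empty => exact isCompactOperator_zero
  | insert m s hm ih =>
    rw [Finset.sum_insert hm]
    refine IsCompactOperator.add (IsCompactOperator.smul ?_ (a m)) ih
    exact (isCompactOperator_of_locallyCompactSpace_rng
      (ContinuousLinearMap.toSpanSingleton ℂ (b m))).comp_clm (innerSL ℂ (b (π m)))

lemma inner_weightedOp (ha : Summable fun n => ‖a n‖) (m : ℕ) (x : H) :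
    ⟪b m, weightedOp b a π x⟫_ℂ = a m * ⟪b (π m), x⟫_ℂ := by
  have h := (hasSum_weightedOp b π ha).mapL
    ((innerSL ℂ (b m)).comp (ContinuousLinearMap.apply ℂ H x))
  refine h.unique ?_
  convert hasSum_single m ?_ using 1
  · simp [b.orthonormal.norm_eq_one, inner_self_eq_norm_sq_to_K]
  · intro k hk
    simp [b.orthonormal.inner_eq_zero hk.symm]

lemma weightedOp_id_apply (ha : Summable fun n => ‖a n‖) (n : ℕ) :
    weightedOp b a id (b n) = a n • b n := by
  refine HilbertBasis.ext_inner b fun m => ?_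
  rw [inner_weightedOp b _ ha, inner_smul_right, id]
  rcases eq_or_ne m n with rfl | h
  · rfl
  · rw [b.orthonormal.inner_eq_zero h, mul_zero, mul_zero]

lemma star_weightedOp (ha : Summable fun n => ‖a n‖) (hr : ∀ n, conj (a n) = a n) :
    star (weightedOp b a id) = weightedOp b a id := by
  ext x
  refine HilbertBasis.ext_inner b fun m => ?_
  rw [ContinuousLinearMap.star_eq_adjoint, ContinuousLinearMap.adjoint_inner_right,
    weightedOp_id_apply b ha, inner_weightedOp b _ ha, inner_smul_left, hr, id]

/-- An injection of indices induces an isometry. -/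
lemma exists_isometry_of_injective {τ : ℕ → ℕ} (hτ : Function.Injective τ) :
    ∃ S : H →L[ℂ] H, star S * S = 1 ∧ ∀ n, S (b n) = b (τ n) := by
  classical
  have ho : Orthonormal ℂ (b ∘ τ) := b.orthonormal.comp _ hτ
  let L : H →ₗᵢ[ℂ] H := ho.orthogonalFamily.linearIsometry.comp b.repr.toLinearIsometry
  refine ⟨L.toContinuousLinearMap, ?_, fun n => ?_⟩
  · rw [ContinuousLinearMap.star_eq_adjoint]
    exact (ContinuousLinearMap.norm_map_iff_adjoint_comp_self _).1 L.norm_map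
  · change ho.orthogonalFamily.linearIsometry (b.repr (b n)) = b (τ n)
    rw [b.repr_self, OrthogonalFamily.linearIsometry_apply_single]
    simp

/-- A pair of isometries with complementary ranges, the first having no co-invariant vector. -/
lemma exists_isometry_pair (b : HilbertBasis ℕ ℂ H) :
    ∃ S W : H →L[ℂ] H, star S * S = 1 ∧ star W * W = 1 ∧
    S * star S + W * star W = 1 ∧ ∀ x, star S x = x → x = 0 := by
  obtain ⟨S, hS, hSb⟩ := exists_isometry_of_injective b (τ := fun n => 2 * n + 1)
    (fun m n h => by simpa using h)
  obtain ⟨W, hW, hWb⟩ := exists_isometry_of_injective b (τ := fun n => 2 * n)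
    (fun m n h => by simpa using h)
  have hadj := inner_star_right (H := H)
  have hSS : ∀ n, star S (b (2 * n + 1)) = b n := fun n => by
    rw [← hSb n]; exact congrArg (fun T : H →L[ℂ] H => T (b n)) hS
  have hWW : ∀ n, star W (b (2 * n)) = b n := fun n => by
    rw [← hWb n]; exact congrArg (fun T : H →L[ℂ] H => T (b n)) hW
  have hSW : ∀ n, star S (b (2 * n)) = 0 := fun n => by
    refine HilbertBasis.ext_inner b fun k => ?_
    rw [hadj, hSb, b.orthonormal.inner_eq_zero (by omega), inner_zero_right]
  have hWS : ∀ n, star W (b (2 * n + 1)) = 0 := fun n => by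
    refine HilbertBasis.ext_inner b fun k => ?_
    rw [hadj, hWb, b.orthonormal.inner_eq_zero (by omega), inner_zero_right]
  refine ⟨S, W, hS, hW, ?_, fun x hx => ?_⟩
  · ext x
    refine HilbertBasis.ext_inner b fun m => ?_
    have hSx := inner_star_left S (b m) (star S x)
    have hWx := inner_star_left W (b m) (star W x)
    simp only [add_apply, mul_apply_eq_comp, inner_add_right, ← hSx, ← hWx, one_apply_eq_self]
    obtain ⟨k, rfl | rfl⟩ := Nat.even_or_odd' m
    · rw [hSW, hWW, inner_zero_left, hadj, hWb, zero_add]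
    · rw [hSS, hWS, hadj, hSb, inner_zero_left, add_zero]
  · have hstep : ∀ n, ⟪b (2 * n + 1), x⟫_ℂ = ⟪b n, x⟫_ℂ := fun n => by
      rw [← hSb, ← hadj, hx]
    have hlim : Tendsto (fun n => ⟪b n, x⟫_ℂ) atTop (𝓝 0) := by
      have h := (b.summable_inner_mul_inner x x).tendsto_atTop_zero
      rw [tendsto_zero_iff_norm_tendsto_zero] at h ⊢
      have h2 : Tendsto (fun n => ‖⟪b n, x⟫_ℂ‖ ^ 2) atTop (𝓝 0) := by
        refine h.congr fun n => ?_
        rw [norm_mul, norm_inner_symm x, sq]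
      simpa using h2.sqrt
    refine HilbertBasis.ext_inner b fun n => ?_
    rw [inner_zero_right]
    let f : ℕ → ℕ := fun k => (fun n => 2 * n + 1)^[k] n
    have hf : ∀ k, f (k + 1) = 2 * f k + 1 := fun k => Function.iterate_succ_apply' _ _ _
    have hfk : ∀ k, k ≤ f k := fun k => by
      induction k with
      | zero => exact Nat.zero_le _
      | succ k ih => rw [hf]; omega
    have hconst : ∀ k, ⟪b (f k), x⟫_ℂ = ⟪b n, x⟫_ℂ := fun k => by
      induction k with
      | zero => rfl
      | succ k ih => rw [hf, hstep, ih]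
    have := hlim.comp (tendsto_atTop_mono hfk tendsto_id)
    exact tendsto_nhds_unique (tendsto_const_nhds.congr fun k => (hconst k).symm) this

/-- Two compact operators with trivial kernels and transverse ranges, the second of which is
self-adjoint. -/
lemma exists_transverse_pair (b : HilbertBasis ℕ ℂ H) :
    ∃ C D : H →L[ℂ] H, IsCompactOperator C ∧ IsCompactOperator D ∧
    star D = D ∧ (∀ x, D x = 0 → x = 0) ∧ ∀ x y, C x + D y = 0 → x = 0 ∧ y = 0 := by
  have ha : Summable fun n : ℕ => ‖((1 / 2 : ℂ)) ^ n‖ := by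
    simpa using summable_geometric_two
  have hd : Summable fun n : ℕ => ‖((1 / 4 : ℂ)) ^ n‖ := by
    simpa using summable_geometric_of_lt_one (r := (1 / 4 : ℝ)) (by norm_num) (by norm_num)
  have hker : ∀ x, weightedOp b (fun n => (1 / 4 : ℂ) ^ n) id x = 0 → x = 0 := fun x hx => by
    refine HilbertBasis.ext_inner b fun n => ?_
    have := inner_weightedOp b id hd n x
    rw [hx, inner_zero_right] at this
    simpa using this.symm
  refine ⟨weightedOp b (fun n => (1 / 2 : ℂ) ^ n) (fun n => n.unpair.1),
    weightedOp b (fun n => (1 / 4 : ℂ) ^ n) id, isCompactOperator_weightedOp b _ ha,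
    isCompactOperator_weightedOp b _ hd, ?_, hker, fun x y hxy => ?_⟩
  · refine star_weightedOp b hd fun n => ?_
    simp [map_ofNat]
  · have hm : ∀ m : ℕ, ‖⟪b m.unpair.1, x⟫_ℂ‖ ≤ (1 / 2) ^ m * ‖y‖ := fun m => by
      have h := congrArg (fun z => ⟪b m, z⟫_ℂ) hxy
      simp only [inner_add_right, inner_weightedOp b _ ha, inner_weightedOp b _ hd,
        inner_zero_right, id] at h
      have h1 : ⟪b m.unpair.1, x⟫_ℂ = - ((1 / 2 : ℂ) ^ m * ⟪b m, y⟫_ℂ) := by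
        have : (1 / 4 : ℂ) ^ m = (1 / 2) ^ m * (1 / 2) ^ m := by
          rw [← mul_pow]; norm_num
        rw [this, mul_assoc, ← mul_add] at h
        have := (mul_eq_zero.1 h).resolve_left (by simp)
        linear_combination this
      rw [h1, norm_neg, norm_mul, norm_pow]
      have h2 : ‖⟪b m, y⟫_ℂ‖ ≤ ‖y‖ := by
        simpa [b.orthonormal.norm_eq_one] using norm_inner_le_norm (𝕜 := ℂ) (b m) y
      have h3 : ‖(1 / 2 : ℂ)‖ = 1 / 2 := by norm_num
      rw [h3]
      gcongr
    have hx : x = 0 := by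
      refine HilbertBasis.ext_inner b fun n => ?_
      rw [inner_zero_right, ← norm_le_zero_iff]
      have hl : Tendsto (fun i => (1 / 2 : ℝ) ^ (Nat.pair n i) * ‖y‖) atTop (𝓝 0) := by
        have := ((tendsto_pow_atTop_nhds_zero_of_lt_one (r := (1 / 2 : ℝ)) (by norm_num)
          (by norm_num)).comp (tendsto_atTop_mono (Nat.right_le_pair n) tendsto_id)).mul_const ‖y‖
        simpa using this
      refine ge_of_tendsto' hl fun i => ?_
      simpa using hm (Nat.pair n i)
    refine ⟨hx, hker y ?_⟩
    simpa [hx] using hxy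

end HilbertBasisOperators

section IsometryPairs

/-- Two isometries with complementary ranges. -/
structure IsIsometryPair {A : Type*} [Ring A] [StarRing A] (V W : A) : Prop where
  left : star V * V = 1
  right : star W * W = 1
  sum : V * star V + W * star W = 1

variable {A : Type*} [Ring A] [StarRing A] {V W : A}

lemma IsIsometryPair.star_left_mul_right (h : IsIsometryPair V W) : star V * W = 0 := by
  have h1 : star V * ((V * star V + W * star W) * W) = star V * W := by rw [h.sum, one_mul]
  have h2 : star V * ((V * star V + W * star W) * W) =
      (star V * V) * (star V * W) + star V * W * (star W * W) := by noncomm_ring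
  rw [h2, h.left, h.right, one_mul, mul_one] at h1
  simpa using h1

lemma IsIsometryPair.star_right_mul_left (h : IsIsometryPair V W) : star W * V = 0 := by
  simpa using congrArg star h.star_left_mul_right

/-- The Blaschke transform of a pair of isometries with complementary ranges. -/
lemma IsIsometryPair.blaschke [Algebra ℂ A] [StarModule ℂ A] {S T : A} (h : IsIsometryPair S T)
    {r c : ℂ} (hr : star r = r) (hc : star c = c) (hrc : c ^ 2 = 1 - r ^ 2) {Q : A}
    (hQ : (1 - r • S) * Q = 1) (hQ' : Q * (1 - r • S) = 1) :
    IsIsometryPair ((r • 1 - S) * Q) (c • (Q * T)) := by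
  have hQs : star Q * (1 - r • star S) = 1 := by simpa [hr] using congrArg star hQ
  have hQs' : (1 - r • star S) * star Q = 1 := by simpa [hr] using congrArg star hQ'
  have hcomm : (r • 1 - S) * Q = Q * (r • 1 - S) := by
    have h1 : (1 - r • S) * (r • 1 - S) = (r • 1 - S) * (1 - r • S) := by
      simp only [mul_sub, sub_mul, smul_mul_assoc, mul_smul_comm, one_mul, mul_one]
      module
    calc (r • 1 - S) * Q = Q * ((1 - r • S) * (r • 1 - S)) * Q := by
          rw [← mul_assoc, hQ', one_mul]
      _ = Q * (r • 1 - S) * ((1 - r • S) * Q) := by rw [h1]; noncomm_ring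
      _ = _ := by rw [hQ, mul_one]
  refine ⟨?_, ?_, ?_⟩
  · have h1 : (r • 1 - star S) * (r • 1 - S) = (1 - r • star S) * (1 - r • S) := by
      simp only [mul_sub, sub_mul, smul_mul_assoc, mul_smul_comm, one_mul, mul_one, h.left]
      module
    calc star ((r • 1 - S) * Q) * ((r • 1 - S) * Q)
        = star Q * ((r • 1 - star S) * (r • 1 - S)) * Q := by
          simp only [star_mul, star_sub, star_smul, star_one, hr, mul_assoc]
      _ = (star Q * (1 - r • star S)) * ((1 - r • S) * Q) := by rw [h1]; noncomm_ring
      _ = 1 := by rw [hQ, hQs, one_mul]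
  · have hX : Q * T = T + r • (S * (Q * T)) := by
      have : (1 - r • S) * (Q * T) = T := by rw [← mul_assoc, hQ, one_mul]
      rwa [sub_mul, one_mul, smul_mul_assoc, sub_eq_iff_eq_add] at this
    have hXX : star (Q * T) * (Q * T) = 1 + r ^ 2 • (star (Q * T) * (Q * T)) := by
      nth_rewrite 1 2 [hX]
      simp only [star_add, star_smul, hr, star_mul S, add_mul, mul_add, smul_mul_assoc,
        mul_smul_comm, h.right]
      rw [show star (Q * T) * star S * T = 0 by rw [mul_assoc, h.star_left_mul_right, mul_zero],
        show star T * (S * (Q * T)) = 0 by rw [← mul_assoc, h.star_right_mul_left, zero_mul],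
        show star (Q * T) * star S * (S * (Q * T)) = star (Q * T) * (star S * S) * (Q * T) by
          noncomm_ring, h.left, mul_one]
      module
    rw [star_smul, hc, smul_mul_smul_comm, ← sq, hrc, sub_smul, one_smul]
    nth_rewrite 1 [hXX]
    abel
  · have h1 : (r • 1 - S) * (r • 1 - star S) + c ^ 2 • (T * star T) =
        (1 - r • S) * (1 - r • star S) := by
      rw [hrc, show T * star T = 1 - S * star S by rw [← h.sum]; abel]
      simp only [mul_sub, sub_mul, smul_mul_assoc, mul_smul_comm, one_mul, mul_one]
      module
    calc (r • 1 - S) * Q * star ((r • 1 - S) * Q) + c • (Q * T) * star (c • (Q * T))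
        = Q * ((r • 1 - S) * (r • 1 - star S) + c ^ 2 • (T * star T)) * star Q := by
          rw [hcomm]
          simp only [star_mul, star_sub, star_smul, star_one, hr, hc, mul_add, add_mul,
            sq, mul_smul, mul_smul_comm, smul_mul_assoc, mul_assoc]
      _ = (Q * (1 - r • S)) * ((1 - r • star S) * star Q) := by rw [h1]; noncomm_ring
      _ = 1 := by rw [hQ', hQs', one_mul]

end IsometryPairs

section IsometryPath

variable {H : Type*} [NormedAddCommGroup H] [InnerProductSpace ℂ H] [CompleteSpace H]

lemma norm_apply_of_star_mul_self {V : H →L[ℂ] H} (h : star V * V = 1) (x : H) :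
    ‖V x‖ = ‖x‖ := by
  rw [ContinuousLinearMap.star_eq_adjoint] at h
  exact (ContinuousLinearMap.norm_map_iff_adjoint_comp_self V).2 h x

lemma norm_le_one_of_star_mul_self {V : H →L[ℂ] H} (h : star V * V = 1) : ‖V‖ ≤ 1 :=
  V.opNorm_le_bound zero_le_one fun x => by rw [norm_apply_of_star_mul_self h, one_mul]

lemma denseRange_one_sub {S : H →L[ℂ] H} (h : ∀ x, star S x = x → x = 0) :
    DenseRange (1 - S : H →L[ℂ] H) := by
  have h1 : (1 - S : H →L[ℂ] H).range.topologicalClosure = ⊤ := by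
    rw [Submodule.topologicalClosure_eq_top_iff, ContinuousLinearMap.orthogonal_range]
    refine (Submodule.eq_bot_iff _).2 fun x hx => h x ?_
    have hx' : star (1 - S) x = 0 := hx
    rw [star_sub, star_one, sub_apply, one_apply_eq_self, sub_eq_zero] at hx'
    exact hx'.symm
  have h2 := Submodule.dense_iff_topologicalClosure_eq_top.2 h1
  exact h2

lemma isUnit_one_sub_smul {S : H →L[ℂ] H} (hS : ‖S‖ ≤ 1) {r : ℝ} (h0 : 0 ≤ r) (h1 : r < 1) :
    IsUnit (1 - (r : ℂ) • S) := by
  refine isUnit_one_sub_of_norm_lt_one ?_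
  rw [norm_smul, Complex.norm_real, Real.norm_of_nonneg h0]
  nlinarith [norm_nonneg S]

/-- The operator-valued Blaschke factor `(r - S)(1 - rS)⁻¹`. -/
noncomputable def blaschkeFactor (S : H →L[ℂ] H) (r : ℝ) : H →L[ℂ] H :=
  ((r : ℂ) • 1 - S) * Ring.inverse (1 - (r : ℂ) • S)

/-- The isometry `√(1 - r²) (1 - rS)⁻¹ T` onto the cokernel of the Blaschke factor. -/
noncomputable def blaschkeDefect (S T : H →L[ℂ] H) (r : ℝ) : H →L[ℂ] H :=
  ((√(1 - r ^ 2) : ℝ) : ℂ) • (Ring.inverse (1 - (r : ℂ) • S) * T)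

lemma isIsometryPair_blaschke {S T : H →L[ℂ] H} (h : IsIsometryPair S T) {r : ℝ} (h0 : 0 ≤ r)
    (h1 : r < 1) : IsIsometryPair (blaschkeFactor S r) (blaschkeDefect S T r) := by
  have hu := isUnit_one_sub_smul (norm_le_one_of_star_mul_self h.left) h0 h1
  refine h.blaschke (Complex.conj_ofReal _) (Complex.conj_ofReal _) ?_
    (Ring.mul_inverse_cancel _ hu) (Ring.inverse_mul_cancel _ hu)
  rw [← Complex.ofReal_pow, Real.sq_sqrt (by nlinarith)]
  push_cast
  rfl

lemma continuousOn_inverse_one_sub_smul {S : H →L[ℂ] H} (hS : ‖S‖ ≤ 1) :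
    ContinuousOn (fun r : ℝ => Ring.inverse (1 - (r : ℂ) • S)) (Set.Ico 0 1) := by
  intro r hr
  obtain ⟨w, hw⟩ := isUnit_one_sub_smul hS hr.1 hr.2
  have h1 := NormedRing.inverse_continuousAt w
  rw [hw] at h1
  refine (ContinuousAt.comp (f := fun r : ℝ => 1 - (r : ℂ) • S) h1 ?_).continuousWithinAt
  fun_prop

lemma continuousOn_blaschkeFactor {S : H →L[ℂ] H} (hS : ‖S‖ ≤ 1) :
    ContinuousOn (blaschkeFactor S) (Set.Ico 0 1) :=
  ContinuousOn.mul (f := fun r : ℝ => (r : ℂ) • (1 : H →L[ℂ] H) - S) (by fun_prop)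
    (continuousOn_inverse_one_sub_smul hS)

lemma continuousOn_blaschkeDefect {S : H →L[ℂ] H} (hS : ‖S‖ ≤ 1) (T : H →L[ℂ] H) :
    ContinuousOn (blaschkeDefect S T) (Set.Ico 0 1) :=
  ContinuousOn.smul (f := fun r : ℝ => ((√(1 - r ^ 2) : ℝ) : ℂ)) (by fun_prop)
    ((continuousOn_inverse_one_sub_smul hS).mul continuousOn_const)

lemma norm_blaschkeFactor_apply_sub_le {S : H →L[ℂ] H} (hS : ‖S‖ ≤ 1) {r : ℝ} (h0 : 0 ≤ r)
    (h1 : r < 1) (y : H) :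
    ‖blaschkeFactor S r ((1 - S) y) - (1 - S) y‖ ≤ 4 * (1 - r) * ‖y‖ := by
  have hu := isUnit_one_sub_smul hS h0 h1
  set Q := Ring.inverse (1 - (r : ℂ) • S) with hQ
  have hPQ : (1 - (r : ℂ) • S) * Q = 1 := Ring.mul_inverse_cancel _ hu
  have hQP : Q * (1 - (r : ℂ) • S) = 1 := Ring.inverse_mul_cancel _ hu
  have hQn : ∀ x, (1 - r) * ‖Q x‖ ≤ ‖x‖ := fun x => by
    have h2 : Q x - (r : ℂ) • S (Q x) = x := congrArg (fun T : H →L[ℂ] H => T x) hPQ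
    have h3 := norm_sub_norm_le (Q x) ((r : ℂ) • S (Q x))
    rw [h2, norm_smul, Complex.norm_real, Real.norm_of_nonneg h0] at h3
    have h4 : ‖S (Q x)‖ ≤ ‖Q x‖ := by simpa using S.le_of_opNorm_le hS (Q x)
    nlinarith
  have hrc : ((1 - r : ℝ) : ℂ) = 1 - (r : ℂ) := by push_cast; rfl
  have hQS : Q * (1 - S) = 1 - ((1 - r : ℝ) : ℂ) • (Q * S) := by
    rw [mul_sub, mul_one, mul_smul_comm] at hQP
    rw [mul_sub, mul_one, hrc, ← hQP]
    module
  have hV : blaschkeFactor S r - 1 = -(((1 - r : ℝ) : ℂ) • ((1 + S) * Q)) := by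
    calc blaschkeFactor S r - 1 = ((r : ℂ) • 1 - S) * Q - (1 - (r : ℂ) • S) * Q := by
          rw [hPQ]; rfl
      _ = _ := by
          rw [hrc]
          simp only [sub_mul, add_mul, smul_mul_assoc, one_mul]
          module
  have hkey : blaschkeFactor S r ((1 - S) y) - (1 - S) y =
      -(((1 - r : ℝ) : ℂ) • ((1 + S) (y - ((1 - r : ℝ) : ℂ) • Q (S y)))) := by
    calc _ = ((blaschkeFactor S r - 1) * (1 - S)) y := rfl
      _ = (-(((1 - r : ℝ) : ℂ) • ((1 + S) * (Q * (1 - S))))) y := by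
        rw [hV, neg_mul, smul_mul_assoc, mul_assoc]
      _ = _ := by rw [hQS]; rfl
  have hr' : ‖((1 - r : ℝ) : ℂ)‖ = 1 - r := by
    rw [Complex.norm_real, Real.norm_of_nonneg (by linarith)]
  have hSy : ‖S y‖ ≤ ‖y‖ := by simpa using S.le_of_opNorm_le hS y
  set z := y - ((1 - r : ℝ) : ℂ) • Q (S y)
  have hz : ‖z‖ ≤ 2 * ‖y‖ := by
    refine (norm_sub_le _ _).trans ?_
    rw [norm_smul, hr']
    linarith [hQn (S y)]
  have hSz : ‖(1 + S) z‖ ≤ 2 * ‖z‖ := by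
    refine (norm_add_le _ _).trans ?_
    have := S.le_of_opNorm_le hS z
    change ‖z‖ + ‖S z‖ ≤ _
    linarith
  rw [hkey, norm_neg, norm_smul, hr']
  nlinarith

/-- A path of pairs of isometries with complementary ranges, degenerating strongly to the
identity. -/
lemma exists_isometryPair_path [TopologicalSpace.SeparableSpace H]
    (hinf : ¬ FiniteDimensional ℂ H) : ∃ V W : ℝ → H →L[ℂ] H,
      V 0 = 1 ∧ (∀ s, 0 < s → IsIsometryPair (V s) (W s)) ∧ ContinuousOn V (Set.Ioi 0) ∧
      ContinuousOn W (Set.Ioi 0) ∧ ∀ x, Tendsto (fun s => V s x) (𝓝[>] 0) (𝓝 x) := by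
  classical
  obtain ⟨b⟩ := exists_nat_hilbertBasis (H := H) hinf
  obtain ⟨S, T, hS, hT, hST, hSx⟩ := exists_isometry_pair b
  have hp : IsIsometryPair S T := ⟨hS, hT, hST⟩
  have hSn := norm_le_one_of_star_mul_self hS
  have hρ : Set.MapsTo (fun s : ℝ => max (1 - s) 0) (Set.Ioi 0) (Set.Ico 0 1) := fun s hs =>
    ⟨le_max_right _ _, max_lt (by linarith [Set.mem_Ioi.1 hs]) one_pos⟩
  have hρc : ContinuousOn (fun s : ℝ => max (1 - s) 0) (Set.Ioi 0) := by fun_prop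
  have heq : Set.EqOn (fun s => if s ≤ 0 then 1 else blaschkeFactor S (max (1 - s) 0))
      (fun s => blaschkeFactor S (max (1 - s) 0)) (Set.Ioi 0) := fun s hs =>
    if_neg (not_le.2 hs)
  refine ⟨fun s => if s ≤ 0 then 1 else blaschkeFactor S (max (1 - s) 0),
    fun s => blaschkeDefect S T (max (1 - s) 0), if_pos le_rfl, fun s hs => ?_,
    ((continuousOn_blaschkeFactor hSn).comp hρc hρ).congr heq,
    (continuousOn_blaschkeDefect hSn T).comp hρc hρ, fun x => ?_⟩
  · simp only [if_neg (not_le.2 hs)]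
    exact isIsometryPair_blaschke hp (hρ hs).1 (hρ hs).2
  · rw [Metric.tendsto_nhds]
    intro ε hε
    obtain ⟨y, hy⟩ := (denseRange_one_sub hSx).exists_dist_lt x (ε := ε / 4) (by positivity)
    have hlim : Tendsto (fun s : ℝ => 4 * (1 - max (1 - s) 0) * ‖y‖) (𝓝[>] 0) (𝓝 0) := by
      refine Tendsto.mono_left ?_ nhdsWithin_le_nhds
      have : Continuous fun s : ℝ => 4 * (1 - max (1 - s) 0) * ‖y‖ := by fun_prop
      simpa using this.tendsto 0
    filter_upwards [self_mem_nhdsWithin, hlim.eventually_lt_const (half_pos hε)] with s hs hs2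
    simp only [if_neg (not_le.2 (Set.mem_Ioi.1 hs))]
    have hV := norm_apply_of_star_mul_self
      (isIsometryPair_blaschke hp (hρ hs).1 (hρ hs).2).left (x - (1 - S) y)
    have h1 := norm_blaschkeFactor_apply_sub_le hSn (hρ hs).1 (hρ hs).2 y
    rw [dist_eq_norm] at hy ⊢
    set B := blaschkeFactor S (max (1 - s) 0)
    calc ‖B x - x‖ = ‖B (x - (1 - S) y) + (B ((1 - S) y) - (1 - S) y) - (x - (1 - S) y)‖ := by
          rw [map_sub]; congr 1; abel
      _ ≤ ‖B (x - (1 - S) y)‖ + ‖B ((1 - S) y) - (1 - S) y‖ + ‖x - (1 - S) y‖ :=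
          (norm_sub_le _ _).trans (by gcongr; exact norm_add_le _ _)
      _ < ε := by rw [hV]; linarith

end IsometryPath

section Conjugation

variable {H : Type*} [NormedAddCommGroup H] [InnerProductSpace ℂ H] [CompleteSpace H]

omit [CompleteSpace H] in
lemma IsCompactOperator.mul_right {T : H →L[ℂ] H} (hT : IsCompactOperator T) (B : H →L[ℂ] H) :
    IsCompactOperator (T * B) := hT.comp_clm B

omit [CompleteSpace H] in
lemma IsCompactOperator.mul_left {T : H →L[ℂ] H} (hT : IsCompactOperator T) (B : H →L[ℂ] H) :
    IsCompactOperator (B * T) := hT.clm_comp B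

omit [CompleteSpace H] in
lemma opNorm_le_of_unit_ball {T : H →L[ℂ] H} {c : ℝ} (hc : 0 ≤ c)
    (h : ∀ x ∈ Metric.closedBall (0 : H) 1, ‖T x‖ ≤ c) : ‖T‖ ≤ c := by
  refine T.opNorm_le_bound hc fun x => ?_
  rcases eq_or_ne x 0 with rfl | hx
  · simp
  have hx' : 0 < ‖x‖ := norm_pos_iff.2 hx
  have h1 : ‖((‖x‖ : ℂ)⁻¹ • x)‖ = 1 := by
    rw [norm_smul, norm_inv, Complex.norm_real, norm_norm, inv_mul_cancel₀ hx'.ne']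
  have h2 := h ((‖x‖ : ℂ)⁻¹ • x) (by rw [mem_closedBall_zero_iff, h1])
  rw [map_smul, norm_smul, norm_inv, Complex.norm_real, norm_norm] at h2
  rwa [inv_mul_le_iff₀ hx', mul_comm] at h2

omit [CompleteSpace H] in
/-- Composition with a compact operator turns bounded strong convergence into norm convergence. -/
lemma IsCompactOperator.tendsto_norm_sub_one_mul {ι : Type*} {l : Filter ι} {V : ι → H →L[ℂ] H}
    (hV : ∀ᶠ i in l, ‖V i‖ ≤ 1) (hlim : ∀ x, Tendsto (fun i => V i x) l (𝓝 x))
    {T : H →L[ℂ] H} (hT : IsCompactOperator T) :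
    Tendsto (fun i => ‖(V i - 1) * T‖) l (𝓝 0) := by
  have hK : IsCompact (closure (T '' Metric.closedBall 0 1)) :=
    hT.isCompact_closure_image_closedBall (f := (T : H →ₗ[ℂ] H)) 1
  have h0 : ∀ x ∈ Metric.closedBall (0 : H) 1, T x ∈ closure (T '' Metric.closedBall 0 1) :=
    fun x hx => subset_closure (Set.mem_image_of_mem _ hx)
  rw [Metric.tendsto_nhds]
  intro ε hε
  obtain ⟨t, ht, htf, hcov⟩ := hK.finite_cover_balls (e := ε / 4) (by positivity)
  have h1 : ∀ᶠ i in l, ∀ y ∈ t, ‖V i y - y‖ < ε / 4 := by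
    rw [Filter.eventually_all_finite htf]
    intro y _
    simpa [dist_eq_norm] using Metric.tendsto_nhds.1 (hlim y) (ε / 4) (by positivity)
  filter_upwards [hV, h1] with i hi h1
  have h2 : ‖(V i - 1) * T‖ ≤ 3 * (ε / 4) := by
    refine opNorm_le_of_unit_ball (by positivity) fun x hx => ?_
    obtain ⟨y, hyt, hy⟩ := Set.mem_iUnion₂.1 (hcov (h0 x hx))
    rw [Metric.mem_ball, dist_eq_norm] at hy
    have e : ((V i - 1) * T) x = V i (T x) - T x := rfl
    rw [e]
    have h3 : ‖V i (T x - y)‖ ≤ 1 * ‖T x - y‖ := (V i).le_of_opNorm_le hi _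
    calc ‖V i (T x) - T x‖ = ‖V i (T x - y) + (V i y - y) - (T x - y)‖ := by
          rw [map_sub]; congr 1; abel
      _ ≤ ‖V i (T x - y)‖ + ‖V i y - y‖ + ‖T x - y‖ :=
          (norm_sub_le _ _).trans (by gcongr; exact norm_add_le _ _)
      _ ≤ _ := by
          have := h1 y hyt
          linarith
  rw [Real.dist_eq, sub_zero, abs_norm]
  linarith

/-- Conjugation of compact operators by a strongly continuous path of contractions. -/
lemma continuous_conj_of_isCompactOperator {X : Type*} [TopologicalSpace X] {V : ℝ → H →L[ℂ] H}
    (hV0 : V 0 = 1) (hV : ∀ s, 0 < s → ‖V s‖ ≤ 1) (hVc : ContinuousOn V (Set.Ioi 0))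
    (hlim : ∀ x, Tendsto (fun s => V s x) (𝓝[>] 0) (𝓝 x)) {σ : X → ℝ} (hσ : Continuous σ)
    (hσ0 : ∀ x, 0 ≤ σ x) {k : X → H →L[ℂ] H} (hk : Continuous k)
    (hkc : ∀ x, IsCompactOperator (k x)) (hkc' : ∀ x, IsCompactOperator (star (k x) : H →L[ℂ] H)) :
    Continuous fun x => V (σ x) * k x * star (V (σ x)) := by
  refine continuous_iff_continuousAt.2 fun x₀ => ?_
  rcases (hσ0 x₀).eq_or_lt with h0 | h0
  · have hVn : ∀ s, 0 ≤ s → ‖V s‖ ≤ 1 := fun s hs => by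
      rcases hs.eq_or_lt with rfl | hs
      · rw [hV0]; exact ContinuousLinearMap.norm_id_le
      · exact hV s hs
    have hlim' : ∀ y, Tendsto (fun x => V (σ x) y) (𝓝 x₀) (𝓝 y) := fun y => by
      have h1 : Tendsto (fun s => V s y) (𝓝[≥] 0) (𝓝 y) := by
        rw [← Set.Ioi_union_left, nhdsWithin_union, tendsto_sup]
        refine ⟨hlim y, ?_⟩
        rw [nhdsWithin_singleton, tendsto_pure_left]
        intro s hs
        rw [hV0]
        exact mem_of_mem_nhds hs
      refine h1.comp (tendsto_nhdsWithin_iff.2 ⟨?_, Eventually.of_forall fun x => hσ0 x⟩)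
      rw [h0]
      exact hσ.continuousAt
    have hVe : ∀ᶠ x in 𝓝 x₀, ‖V (σ x)‖ ≤ 1 := Eventually.of_forall fun x => hVn _ (hσ0 x)
    have h1 := (hkc x₀).tendsto_norm_sub_one_mul hVe hlim'
    have h2 := (hkc' x₀).tendsto_norm_sub_one_mul hVe hlim'
    have h3 : Tendsto (fun x => ‖k x - k x₀‖) (𝓝 x₀) (𝓝 0) :=
      tendsto_iff_norm_sub_tendsto_zero.1 hk.continuousAt
    rw [ContinuousAt, tendsto_iff_norm_sub_tendsto_zero, ← h0, hV0]
    refine squeeze_zero (fun _ => norm_nonneg _) (fun x => ?_)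
      (by simpa using (h3.add h1).add h2)
    have hx := hVn _ (hσ0 x)
    have hx' : ‖star (V (σ x))‖ ≤ 1 := by rwa [norm_star]
    set U := V (σ x)
    have e : U * k x * star U - 1 * k x₀ * star 1 =
        U * (k x - k x₀) * star U + (U - 1) * k x₀ * star U + star ((U - 1) * star (k x₀)) := by
      simp only [star_mul, star_star, star_sub, star_one]
      noncomm_ring
    rw [e]
    refine (norm_add₃_le).trans ?_
    rw [norm_star]
    gcongr
    · calc _ ≤ ‖U‖ * ‖k x - k x₀‖ * ‖star U‖ := norm_mul₃_le
        _ ≤ 1 * ‖k x - k x₀‖ * 1 := by gcongr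
        _ = _ := by ring
    · calc _ ≤ ‖(U - 1) * k x₀‖ * ‖star U‖ := norm_mul_le _ _
        _ ≤ ‖(U - 1) * k x₀‖ * 1 := by gcongr
        _ = _ := by ring
  · have h1 : ContinuousAt (fun x => V (σ x)) x₀ :=
      ContinuousAt.comp (hVc.continuousAt (Ioi_mem_nhds h0)) hσ.continuousAt
    exact (h1.mul hk.continuousAt).mul h1.star

end Conjugation

section Cayley

variable {H : Type*} [NormedAddCommGroup H] [InnerProductSpace ℂ H] [CompleteSpace H]

/-- The Cayley transform `(1 - iA)(1 + iA)⁻¹`. -/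
noncomputable def cayley (A : H →L[ℂ] H) : H →L[ℂ] H :=
  (1 - Complex.I • A) * Ring.inverse (1 + Complex.I • A)

lemma isUnit_one_add_I_smul {A : H →L[ℂ] H} (hA : star A = A) : IsUnit (1 + Complex.I • A) := by
  have h1 : Complex.I ∉ spectrum ℂ A := fun h => by
    have := IsSelfAdjoint.mem_spectrum_eq_re (a := A) hA h
    simpa using congrArg Complex.im this
  rw [spectrum.notMem_iff] at h1
  have h2 : IsUnit (algebraMap ℂ (H →L[ℂ] H) (-Complex.I)) :=
    (IsUnit.mk0 (-Complex.I) (by simp)).map _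
  convert h2.mul h1 using 1
  rw [mul_sub, ← map_mul, ← Algebra.smul_def]
  simp [Complex.I_mul_I]

omit [CompleteSpace H] in
lemma cayley_zero : cayley (0 : H →L[ℂ] H) = 1 := by simp [cayley]

/-- The Cayley transform in terms of preimages under `1 + iA`. -/
lemma exists_eq_cayley {A : H →L[ℂ] H} (hA : star A = A) (v : H) :
    ∃ y, v = y + Complex.I • A y ∧ cayley A v = y - Complex.I • A y :=
  ⟨Ring.inverse (1 + Complex.I • A) v, (congrArg (fun T : H →L[ℂ] H => T v)
    (Ring.mul_inverse_cancel _ (isUnit_one_add_I_smul hA))).symm, rfl⟩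

lemma cayley_mem_unitary {A : H →L[ℂ] H} (hA : star A = A) :
    cayley A ∈ unitary (H →L[ℂ] H) := by
  have hu := isUnit_one_add_I_smul hA
  set Q := Ring.inverse (1 + Complex.I • A) with hQ
  have h1 : (1 + Complex.I • A) * Q = 1 := Ring.mul_inverse_cancel _ hu
  have h2 : Q * (1 + Complex.I • A) = 1 := Ring.inverse_mul_cancel _ hu
  have hs : star (1 + Complex.I • A) = 1 - Complex.I • A := by
    simp [hA, sub_eq_add_neg]
  have h1' : star Q * (1 - Complex.I • A) = 1 := by simpa [← hs] using congrArg star h1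
  have h2' : (1 - Complex.I • A) * star Q = 1 := by simpa [← hs] using congrArg star h2
  have hs' : star (1 - Complex.I • A) = 1 + Complex.I • A := by rw [← hs, star_star]
  have hc : (1 - Complex.I • A) * (1 + Complex.I • A) =
      (1 + Complex.I • A) * (1 - Complex.I • A) := by
    simp only [sub_mul, add_mul, mul_sub, mul_add, one_mul, mul_one]
    abel
  have e : cayley A = (1 - Complex.I • A) * Q := rfl
  rw [Unitary.mem_iff, e, star_mul, hs']
  constructor
  · calc star Q * (1 + Complex.I • A) * ((1 - Complex.I • A) * Q)
        = star Q * ((1 + Complex.I • A) * (1 - Complex.I • A)) * Q := by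
          simp only [mul_assoc]
      _ = (star Q * (1 - Complex.I • A)) * ((1 + Complex.I • A) * Q) := by
          rw [← hc]; simp only [mul_assoc]
      _ = 1 := by rw [h1, h1', one_mul]
  · have hc' : (1 - Complex.I • A) * Q = Q * (1 - Complex.I • A) := by
      calc (1 - Complex.I • A) * Q
          = Q * ((1 + Complex.I • A) * (1 - Complex.I • A)) * Q := by
            rw [← mul_assoc, h2, one_mul]
        _ = Q * (1 - Complex.I • A) * ((1 + Complex.I • A) * Q) := by
            rw [← hc]; simp only [mul_assoc]
        _ = _ := by rw [h1, mul_one]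
    rw [hc']
    calc Q * (1 - Complex.I • A) * (star Q * (1 + Complex.I • A))
        = Q * ((1 - Complex.I • A) * star Q) * (1 + Complex.I • A) := by
          simp only [mul_assoc]
      _ = 1 := by rw [h2', mul_one, h2]

lemma isCompactOperator_cayley_sub_one {A : H →L[ℂ] H} (hA : star A = A)
    (hc : IsCompactOperator A) : IsCompactOperator (cayley A - 1 : H →L[ℂ] H) := by
  have : cayley A - 1 = A * ((-2 * Complex.I) • Ring.inverse (1 + Complex.I • A)) := by
    calc cayley A - 1 = (1 - Complex.I • A) * Ring.inverse (1 + Complex.I • A) -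
          (1 + Complex.I • A) * Ring.inverse (1 + Complex.I • A) := by
          rw [Ring.mul_inverse_cancel _ (isUnit_one_add_I_smul hA)]; rfl
      _ = _ := by
          simp only [sub_mul, add_mul, smul_mul_assoc, one_mul, mul_smul_comm]
          module
  rw [this]
  exact hc.mul_right _

lemma continuous_cayley {X : Type*} [TopologicalSpace X] {A : X → H →L[ℂ] H}
    (hA : ∀ x, star (A x) = A x) (hc : Continuous A) : Continuous fun x => cayley (A x) := by
  refine Continuous.mul (by fun_prop) (continuous_iff_continuousAt.2 fun x => ?_)
  obtain ⟨w, hw⟩ := isUnit_one_add_I_smul (hA x)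
  have h1 := NormedRing.inverse_continuousAt w
  rw [hw] at h1
  exact ContinuousAt.comp (f := fun x => 1 + Complex.I • A x) h1 (by fun_prop)

end Cayley

section EigenSpans

variable {H : Type*} [NormedAddCommGroup H] [InnerProductSpace ℂ H] [CompleteSpace H]

lemma inner_apply_of_mem_unitary {u : H →L[ℂ] H} (hu : u ∈ unitary (H →L[ℂ] H)) (x y : H) :
    ⟪u x, u y⟫_ℂ = ⟪x, y⟫_ℂ := by
  rw [← inner_star_right]
  exact congrArg (fun T : H →L[ℂ] H => ⟪x, T y⟫_ℂ) (Unitary.mem_iff.1 hu).1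

lemma inner_eq_zero_of_eigenvectors {u : H →L[ℂ] H} (hu : u ∈ unitary (H →L[ℂ] H)) {μ ν : ℂ}
    (hμν : μ ≠ ν) {x y : H} (hx : u x = μ • x) (hy : u y = ν • y) : ⟪x, y⟫_ℂ = 0 := by
  by_contra h
  have hx0 : ‖x‖ ≠ 0 := fun h0 => h (by rw [norm_eq_zero.1 h0, inner_zero_left])
  have h1 := inner_apply_of_mem_unitary hu x y
  rw [hx, hy, inner_smul_left, inner_smul_right, ← mul_assoc] at h1
  have h2 : conj μ * ν = 1 := mul_right_cancel₀ h (by rw [h1, one_mul])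
  have h3 : ‖μ‖ = 1 := by
    have := norm_apply_of_star_mul_self (Unitary.mem_iff.1 hu).1 x
    rw [hx, norm_smul] at this
    exact mul_right_cancel₀ hx0 (by rw [this, one_mul])
  have h4 : μ * conj μ = 1 := by rw [Complex.mul_conj', h3]; simp
  exact hμν (by linear_combination (-μ) * h2 + ν * h4)

/-- The numerical range of a unitary on a span of eigenspaces. -/
lemma inner_apply_im_pos {u : H →L[ℂ] H} (hu : u ∈ unitary (H →L[ℂ] H)) {s : Set ℂ} {c : ℝ}
    (hs : ∀ μ ∈ s, 0 < c * μ.im) {v : H}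
    (hv : v ∈ ⨆ μ ∈ s, Module.End.eigenspace (u : H →ₗ[ℂ] H) μ) (hv0 : v ≠ 0) :
    0 < c * (⟪v, u v⟫_ℂ).im := by
  classical
  rw [iSup_subtype', Submodule.mem_iSup_iff_exists_finsupp] at hv
  obtain ⟨f, hf, rfl⟩ := hv
  have hf' : ∀ i : s, u (f i) = (i : ℂ) • f i := fun i => Module.End.mem_eigenspace_iff.1 (hf i)
  have h1 : ⟪∑ i ∈ f.support, f i, u (∑ i ∈ f.support, f i)⟫_ℂ =
      ∑ i ∈ f.support, ((‖f i‖ ^ 2 : ℝ) : ℂ) * (i : ℂ) := by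
    rw [map_sum, sum_inner]
    refine Finset.sum_congr rfl fun i hi => ?_
    rw [inner_sum, Finset.sum_eq_single i]
    · rw [hf', inner_smul_right, inner_self_eq_norm_sq_to_K]
      push_cast
      exact mul_comm _ _
    · intro j _ hji
      rw [hf', inner_smul_right, inner_eq_zero_of_eigenvectors hu
        (fun h => hji (Subtype.ext h.symm)) (hf' i) (hf' j), mul_zero]
    · exact fun h => absurd hi h
  unfold Finsupp.sum at hv0 ⊢
  rw [h1, Complex.im_sum, Finset.mul_sum]
  refine Finset.sum_pos (fun i hi => ?_) ?_
  · have h2 : 0 < ‖f i‖ := norm_pos_iff.2 (Finsupp.mem_support_iff.1 hi)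
    have h3 := mul_pos (pow_pos h2 2) (hs i i.2)
    rw [Complex.im_ofReal_mul]
    linarith
  · by_contra h
    exact hv0 (by rw [Finset.not_nonempty_iff_eq_empty.1 h, Finset.sum_empty])

lemma finiteDimensional_iSup_eigenspace {u : H →L[ℂ] H} (hu : u ∈ unitary (H →L[ℂ] H))
    {s : Set ℂ} {c : ℝ} (hs : ∀ μ ∈ s, 0 < c * μ.im) {F : H →L[ℂ] H}
    (hF : FiniteDimensional ℂ F.range) (hneg : ∀ v, F v = 0 → c * (⟪v, u v⟫_ℂ).im ≤ 0) :
    FiniteDimensional ℂ (⨆ μ ∈ s, Module.End.eigenspace (u : H →ₗ[ℂ] H) μ : Submodule ℂ H) := by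
  set E := ⨆ μ ∈ s, Module.End.eigenspace (u : H →ₗ[ℂ] H) μ
  refine FiniteDimensional.of_injective ((F : H →ₗ[ℂ] H).rangeRestrict.comp E.subtype) ?_
  rw [injective_iff_map_eq_zero]
  intro v hv
  by_contra h0
  have h1 : F v = 0 := congrArg Subtype.val hv
  exact (hneg v h1).not_gt (inner_apply_im_pos hu hs v.2 fun h => h0 (Subtype.ext h))

omit [CompleteSpace H] in
lemma not_finiteDimensional_iSup_eigenspace {u : H →L[ℂ] H} {s : Set ℂ} {e : ℕ → H}
    (he : LinearIndependent ℂ e) (h : ∀ n, ∃ μ ∈ s, u (e n) = μ • e n) :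
    ¬ FiniteDimensional ℂ
      (⨆ μ ∈ s, Module.End.eigenspace (u : H →ₗ[ℂ] H) μ : Submodule ℂ H) := by
  intro hfin
  have hmem : ∀ n, e n ∈ ⨆ μ ∈ s, Module.End.eigenspace (u : H →ₗ[ℂ] H) μ := fun n => by
    obtain ⟨μ, hμ, hn⟩ := h n
    exact Submodule.mem_iSup_of_mem μ
      (Submodule.mem_iSup_of_mem hμ (Module.End.mem_eigenspace_iff.2 hn))
  have he' : LinearIndependent ℂ fun n =>
      (⟨e n, hmem n⟩ : (⨆ μ ∈ s, Module.End.eigenspace (u : H →ₗ[ℂ] H) μ : Submodule ℂ H)) :=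
    LinearIndependent.of_comp (Submodule.subtype _) he
  exact not_finite_iff_infinite.2 inferInstance he'.finite

lemma inner_cayley_im {A : H →L[ℂ] H} (y : H) (hA : star A = A) :
    (⟪y + Complex.I • A y, y - Complex.I • A y⟫_ℂ).im = -2 * (⟪y, A y⟫_ℂ).re := by
  have h1 : ⟪A y, y⟫_ℂ = ⟪y, A y⟫_ℂ := by rw [← inner_star_right, hA]
  have h2 : ⟪y, y⟫_ℂ = ((‖y‖ ^ 2 : ℝ) : ℂ) := by
    rw [inner_self_eq_norm_sq_to_K]; push_cast; rfl
  have h3 : ⟪A y, A y⟫_ℂ = ((‖A y‖ ^ 2 : ℝ) : ℂ) := by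
    rw [inner_self_eq_norm_sq_to_K]; push_cast; rfl
  have h4 : ⟪y + Complex.I • A y, y - Complex.I • A y⟫_ℂ =
      ((‖y‖ ^ 2 - ‖A y‖ ^ 2 : ℝ) : ℂ) - 2 * Complex.I * ⟪y, A y⟫_ℂ := by
    rw [inner_add_left, inner_sub_right, inner_sub_right, inner_smul_left, inner_smul_left,
      inner_smul_right, inner_smul_right, h1, h2, h3, Complex.conj_I]
    push_cast
    linear_combination (‖A y‖ : ℂ) ^ 2 * Complex.I_sq
  rw [h4, Complex.sub_im, Complex.ofReal_im]
  simp

end EigenSpans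

section Truncation

/-- Pushing the arc of the unit circle at distance at most `σ` from `1` onto `1`. -/
noncomputable def circleTrunc (σ : ℝ) (z : ℂ) : ℂ :=
  (z + ((σ / max σ ‖1 - z‖ : ℝ) : ℂ) * (1 - z)) /
    (‖z + ((σ / max σ ‖1 - z‖ : ℝ) : ℂ) * (1 - z)‖ : ℂ)

lemma norm_div_max_mul_le {σ : ℝ} (hσ : 0 ≤ σ) (y : ℂ) :
    ‖((σ / max σ ‖y‖ : ℝ) : ℂ) * y‖ ≤ σ := by
  rw [norm_mul, Complex.norm_real, Real.norm_of_nonneg (by positivity), div_mul_eq_mul_div]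
  refine div_le_of_le_mul₀ (by positivity) hσ ?_
  gcongr
  exact le_max_right _ _

lemma circleTrunc_denom_pos {σ : ℝ} (h0 : 0 ≤ σ) (h1 : σ ≤ 1 / 2) {z : ℂ} (hz : ‖z‖ = 1) :
    0 < ‖z + ((σ / max σ ‖1 - z‖ : ℝ) : ℂ) * (1 - z)‖ := by
  have h2 := norm_div_max_mul_le h0 (1 - z)
  have h3 := norm_sub_le_norm_add z (((σ / max σ ‖1 - z‖ : ℝ) : ℂ) * (1 - z))
  linarith

lemma norm_circleTrunc {σ : ℝ} (h0 : 0 ≤ σ) (h1 : σ ≤ 1 / 2) {z : ℂ} (hz : ‖z‖ = 1) :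
    ‖circleTrunc σ z‖ = 1 := by
  rw [circleTrunc, norm_div, Complex.norm_real, norm_norm,
    div_self (circleTrunc_denom_pos h0 h1 hz).ne']

lemma circleTrunc_zero {z : ℂ} (hz : ‖z‖ = 1) : circleTrunc 0 z = z := by
  simp [circleTrunc, hz]

lemma circleTrunc_eq_one {σ : ℝ} (h0 : 0 < σ) {z : ℂ} (hz : ‖1 - z‖ ≤ σ) :
    circleTrunc σ z = 1 := by
  simp [circleTrunc, max_eq_left hz, h0.ne']

lemma continuousOn_circleTrunc :
    ContinuousOn (fun p : ℝ × ℂ => circleTrunc p.1 p.2)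
      (Set.Icc 0 (1 / 2) ×ˢ Metric.sphere 0 1) := by
  have h1 : ContinuousOn
      (fun p : ℝ × ℂ => ((p.1 / max p.1 ‖1 - p.2‖ : ℝ) : ℂ) * (1 - p.2))
      (Set.Icc 0 (1 / 2) ×ˢ Metric.sphere 0 1) := by
    rintro ⟨σ, z⟩ ⟨hσ, hz⟩
    rcases eq_or_ne (max σ ‖1 - z‖) 0 with h | h
    · have hσ0 : σ = 0 := le_antisymm ((le_max_left _ _).trans h.le) hσ.1
      subst hσ0
      have e : ((0 / max 0 ‖1 - z‖ : ℝ) : ℂ) * (1 - z) = 0 := by simp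
      rw [ContinuousWithinAt, e]
      refine squeeze_zero_norm' (a := fun p : ℝ × ℂ => p.1) ?_ ?_
      · filter_upwards [self_mem_nhdsWithin] with p hp
        exact norm_div_max_mul_le hp.1.1 _
      · exact (continuous_fst.tendsto _).mono_left nhdsWithin_le_nhds
    · refine ContinuousAt.continuousWithinAt ?_
      have h2 : ContinuousAt (fun p : ℝ × ℂ => p.1 / max p.1 ‖1 - p.2‖) (σ, z) :=
        ContinuousAt.div (by fun_prop) (by fun_prop) h
      exact (Complex.continuous_ofReal.continuousAt.comp h2).mul (by fun_prop)
  have h2 := (continuousOn_snd (s := Set.Icc (0 : ℝ) (1 / 2) ×ˢ Metric.sphere (0 : ℂ) 1)).add h1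
  refine h2.div (Complex.continuous_ofReal.comp_continuousOn h2.norm) fun p hp => ?_
  have := circleTrunc_denom_pos hp.1.1 hp.1.2 (mem_sphere_zero_iff_norm.1 hp.2)
  exact Complex.ofReal_ne_zero.2 this.ne'

lemma continuousOn_circleTrunc_apply {σ : ℝ} (h0 : 0 ≤ σ) (h1 : σ ≤ 1 / 2) :
    ContinuousOn (circleTrunc σ) (Metric.sphere 0 1) :=
  continuousOn_circleTrunc.comp (f := fun z : ℂ => (σ, z)) (by fun_prop)
    fun _ hz => ⟨⟨h0, h1⟩, hz⟩

variable {H : Type*} [NormedAddCommGroup H] [InnerProductSpace ℂ H] [CompleteSpace H]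

/-- Functional calculus with a jointly continuous family of functions. -/
lemma continuous_cfc_circleTrunc {X : Type*} [TopologicalSpace X] {σ : X → ℝ} (hσ : Continuous σ)
    (hσ' : ∀ x, σ x ∈ Set.Icc (0 : ℝ) (1 / 2)) {u : X → H →L[ℂ] H} (hu : Continuous u)
    (hu' : ∀ x, u x ∈ unitary (H →L[ℂ] H)) :
    Continuous fun x => cfc (circleTrunc (σ x)) (u x) := by
  have hs : IsCompact (Metric.sphere (0 : ℂ) 1) := isCompact_sphere _ _
  have h1 : Continuous fun x =>
      UniformOnFun.ofFun {Metric.sphere (0 : ℂ) 1} (circleTrunc (σ x)) := by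
    refine continuous_iff_continuousAt.2 fun x₀ => ?_
    rw [ContinuousAt, UniformOnFun.tendsto_iff_tendstoUniformlyOn]
    rintro _ rfl
    rw [Metric.tendstoUniformlyOn_iff]
    intro ε hε
    obtain ⟨δ, hδ, h⟩ := Metric.uniformContinuousOn_iff.1
      ((isCompact_Icc.prod hs).uniformContinuousOn_of_continuous continuousOn_circleTrunc) ε hε
    filter_upwards [hσ.continuousAt (Metric.ball_mem_nhds _ hδ)] with x hx z hz
    refine h (σ x₀, z) ⟨hσ' x₀, hz⟩ (σ x, z) ⟨hσ' x, hz⟩ ?_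
    rw [Prod.dist_eq, dist_self, dist_comm]
    exact max_lt hx hδ
  have h2 := continuousOn_cfc_setProd (A := H →L[ℂ] H) (p := IsStarNormal) hs
  refine h2.comp_continuous (h1.prodMk hu) fun x => ⟨?_, ?_, ?_⟩
  · exact continuousOn_circleTrunc_apply (hσ' x).1 (hσ' x).2
  · exact isStarNormal_of_mem_unitary (hu' x)
  · exact spectrum.subset_circle_of_unitary (hu' x)

end Truncation

section TruncationOperators

variable {H : Type*} [NormedAddCommGroup H] [InnerProductSpace ℂ H] [CompleteSpace H]

lemma continuousOn_circleTrunc_spectrum {u : H →L[ℂ] H} (hu : u ∈ unitary (H →L[ℂ] H)) {σ : ℝ}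
    (h0 : 0 ≤ σ) (h1 : σ ≤ 1 / 2) : ContinuousOn (circleTrunc σ) (spectrum ℂ u) :=
  (continuousOn_circleTrunc_apply h0 h1).mono (spectrum.subset_circle_of_unitary hu)

lemma cfc_circleTrunc_mem_unitary {u : H →L[ℂ] H} (hu : u ∈ unitary (H →L[ℂ] H)) {σ : ℝ}
    (h0 : 0 ≤ σ) (h1 : σ ≤ 1 / 2) : cfc (circleTrunc σ) u ∈ unitary (H →L[ℂ] H) := by
  rw [cfc_unitary_iff (circleTrunc σ) u (isStarNormal_of_mem_unitary hu)
    (continuousOn_circleTrunc_spectrum hu h0 h1)]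
  intro z hz
  have hz' := mem_sphere_zero_iff_norm.1 (spectrum.subset_circle_of_unitary hu hz)
  rw [Complex.star_def, Complex.conj_mul', norm_circleTrunc h0 h1 hz']
  simp

lemma cfc_circleTrunc_zero {u : H →L[ℂ] H} (hu : u ∈ unitary (H →L[ℂ] H)) :
    cfc (circleTrunc 0) u = u := by
  have h : (spectrum ℂ u).EqOn (circleTrunc 0) id := fun z hz => circleTrunc_zero
    (mem_sphere_zero_iff_norm.1 (spectrum.subset_circle_of_unitary hu hz))
  rw [cfc_congr h, cfc_id ℂ u (isStarNormal_of_mem_unitary hu)]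

/-- The truncation of a unitary differs from `1` by an operator fixed by a compact one. -/
lemma exists_compact_mul_cfc_circleTrunc {u : H →L[ℂ] H} (hu : u ∈ unitary (H →L[ℂ] H))
    (hc : IsCompactOperator (u - 1 : H →L[ℂ] H)) {σ : ℝ} (h0 : 0 < σ) (h1 : σ ≤ 1 / 2) :
    ∃ T : H →L[ℂ] H, IsCompactOperator T ∧
      T * (cfc (circleTrunc σ) u - 1) = cfc (circleTrunc σ) u - 1 := by
  have hn := isStarNormal_of_mem_unitary hu
  have hct := continuousOn_circleTrunc_spectrum hu h0.le h1
  let h : ℂ → ℂ := fun z => conj (z - 1) / ((max σ ‖1 - z‖ ^ 2 : ℝ) : ℂ)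
  have hmax : ∀ z : ℂ, 0 < max σ ‖1 - z‖ := fun z => lt_max_of_lt_left h0
  have hh : Continuous h := by
    refine Continuous.div (by fun_prop) (by fun_prop) fun z => ?_
    exact Complex.ofReal_ne_zero.2 (pow_pos (hmax z) 2).ne'
  have hid : cfc (fun z : ℂ => z - 1) u = u - 1 := by
    rw [cfc_sub (fun z : ℂ => z) (fun _ => 1) u, cfc_id' ℂ u, cfc_const_one ℂ u]
  have hψ : cfc (fun z : ℂ => circleTrunc σ z - 1) u = cfc (circleTrunc σ) u - 1 := by
    rw [cfc_sub (circleTrunc σ) (fun _ => 1) u hct, cfc_const_one ℂ u]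
  refine ⟨(u - 1) * cfc h u, hc.mul_right _, ?_⟩
  rw [← hid, ← hψ, ← cfc_mul (fun z : ℂ => z - 1) h u (by fun_prop) hh.continuousOn,
    ← cfc_mul _ _ u (by fun_prop) (by fun_prop)]
  refine cfc_congr fun z _ => ?_
  change (z - 1) * (conj (z - 1) / _) * (circleTrunc σ z - 1) = circleTrunc σ z - 1
  rcases le_total ‖1 - z‖ σ with hz | hz
  · rw [circleTrunc_eq_one h0 hz, sub_self, mul_zero]
  · have h3 := hmax z
    rw [max_eq_right hz] at h3 ⊢
    rw [← mul_div_assoc, Complex.mul_conj', norm_sub_rev z 1, Complex.ofReal_pow, div_self, one_mul]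
    exact pow_ne_zero 2 (Complex.ofReal_ne_zero.2 h3.ne')

lemma isCompactOperator_cfc_circleTrunc_sub_one {u : H →L[ℂ] H}
    (hu : u ∈ unitary (H →L[ℂ] H)) (hc : IsCompactOperator (u - 1 : H →L[ℂ] H)) {σ : ℝ}
    (h0 : 0 ≤ σ) (h1 : σ ≤ 1 / 2) :
    IsCompactOperator (cfc (circleTrunc σ) u - 1 : H →L[ℂ] H) := by
  rcases h0.eq_or_lt with rfl | h0
  · rwa [cfc_circleTrunc_zero hu]
  · obtain ⟨T, hT, hTe⟩ := exists_compact_mul_cfc_circleTrunc hu hc h0 h1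
    rw [← hTe]
    exact hT.mul_right _

lemma finiteDimensional_range_cfc_circleTrunc_sub_one {u : H →L[ℂ] H}
    (hu : u ∈ unitary (H →L[ℂ] H)) (hc : IsCompactOperator (u - 1 : H →L[ℂ] H)) {σ : ℝ}
    (h0 : 0 < σ) (h1 : σ ≤ 1 / 2) :
    FiniteDimensional ℂ (cfc (circleTrunc σ) u - 1 : H →L[ℂ] H).range := by
  obtain ⟨T, hT, hTe⟩ := exists_compact_mul_cfc_circleTrunc hu hc h0 h1
  have := ContinuousLinearMap.finite_dimensional_eigenspace hT 1 one_ne_zero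
  refine Submodule.finiteDimensional_of_le (S₂ := Module.End.eigenspace (T : H →ₗ[ℂ] H) 1) ?_
  rintro _ ⟨x, rfl⟩
  rw [Module.End.mem_eigenspace_iff, one_smul]
  exact congrArg (fun S : H →L[ℂ] H => S x) hTe

end TruncationOperators

section Twist

variable {H : Type*} [NormedAddCommGroup H] [InnerProductSpace ℂ H] [CompleteSpace H]

/-- A unitary transported by an isometry, followed by a Cayley transform. -/
noncomputable def cayleyTwist (V A u : H →L[ℂ] H) : H →L[ℂ] H :=
  cayley A * (1 + V * (u - 1) * star V)

lemma cayleyTwist_mem_unitary {V A u : H →L[ℂ] H} (hV : star V * V = 1) (hA : star A = A)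
    (hu : u ∈ unitary (H →L[ℂ] H)) : cayleyTwist V A u ∈ unitary (H →L[ℂ] H) := by
  refine mul_mem (cayley_mem_unitary hA) ?_
  obtain ⟨h1, h2⟩ := Unitary.mem_iff.1 hu
  rw [Unitary.mem_iff]
  have key : ∀ a b : H →L[ℂ] H, a * b = 1 →
      (1 + V * (a - 1) * star V) * (1 + V * (b - 1) * star V) = 1 := fun a b hab => by
    calc _ = 1 + V * ((a - 1) + (b - 1) + (a - 1) * (star V * V) * (b - 1)) * star V := by
          noncomm_ring
      _ = 1 + V * (a * b - 1) * star V := by rw [hV]; noncomm_ring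
      _ = 1 := by rw [hab]; simp
  have hs : star (1 + V * (u - 1) * star V) = 1 + V * (star u - 1) * star V := by
    simp [mul_assoc]
  rw [hs]
  exact ⟨key _ _ h1, key _ _ h2⟩

lemma isCompactOperator_cayleyTwist_sub_one {V A u : H →L[ℂ] H} (hA : star A = A)
    (hAc : IsCompactOperator A) (hc : IsCompactOperator (u - 1 : H →L[ℂ] H)) :
    IsCompactOperator (cayleyTwist V A u - 1 : H →L[ℂ] H) := by
  have h1 : cayleyTwist V A u - 1 =
      (cayley A - 1) * (1 + V * (u - 1) * star V) + V * (u - 1) * star V := by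
    rw [cayleyTwist]; noncomm_ring
  rw [h1]
  exact ((isCompactOperator_cayley_sub_one hA hAc).mul_right _).add
    ((hc.mul_left V).mul_right _)

/-- Fixed vectors of a twist. -/
lemma exists_of_cayleyTwist_apply_eq {V A u : H →L[ℂ] H} (hA : star A = A) {v : H}
    (hv : cayleyTwist V A u v = v) :
    ∃ y, v = y - Complex.I • A y ∧ V ((u - 1) (star V v)) = (2 * Complex.I) • A y := by
  obtain ⟨y, h1, h2⟩ := exists_eq_cayley hA (v + V ((u - 1) (star V v)))
  have h3 : v = y - Complex.I • A y := by rw [← h2]; exact hv.symm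
  refine ⟨y, h3, ?_⟩
  have h4 : V ((u - 1) (star V v)) = y + Complex.I • A y - v := by rw [← h1]; abel
  rw [h4, h3]
  module

lemma IsIsometryPair.eq_zero {V W : H →L[ℂ] H} (h : IsIsometryPair V W) {y : H}
    (h1 : star V y = 0) (h2 : star W y = 0) : y = 0 := by
  have h3 : V (star V y) + W (star W y) = y := congrArg (fun T : H →L[ℂ] H => T y) h.sum
  rw [← h3, h1, h2, map_zero, map_zero, add_zero]

omit [CompleteSpace H] in
lemma injective_one_sub_of_forall {u : H →L[ℂ] H} (h : ∀ v, u v = v → v = 0) :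
    Function.Injective ⇑((1 : H →L[ℂ] H) - u) := by
  rw [injective_iff_map_eq_zero]
  intro v hv
  exact h v (sub_eq_zero.1 hv).symm

end Twist

section Deformation

/-- A deformation which moves a space into a subspace at all positive times makes the inclusion
a homotopy equivalence. -/
lemma exists_isHomotopyEquiv_of_deformation {E : Type*} [TopologicalSpace E] {P Q : E → Prop}
    (hQP : ∀ u, Q u → P u) (Φ : ℝ → E → E)
    (hc : Continuous fun p : unitInterval × {u // P u} => Φ p.1 p.2) (h0 : ∀ u, P u → Φ 0 u = u)
    (h : ∀ s : ℝ, 0 < s → s ≤ 1 → ∀ u, P u → Q (Φ s u)) :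
    ∃ f : C({u // Q u}, {u // P u}), (∀ u, (f u : E) = u) ∧ IsHomotopyEquiv f := by
  have hP : ∀ (s : unitInterval) (u : E), P u → P (Φ s u) := fun s u hu => by
    rcases s.2.1.eq_or_lt with hs | hs
    · rwa [← hs, h0 u hu]
    · exact hQP _ (h s hs s.2.2 u hu)
  have hQ : ∀ (s : unitInterval) (u : E), Q u → Q (Φ s u) := fun s u hu => by
    rcases s.2.1.eq_or_lt with hs | hs
    · rwa [← hs, h0 u (hQP u hu)]
    · exact h s hs s.2.2 u (hQP u hu)
  have hc1 : Continuous fun u : {u // P u} => Φ 1 u :=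
    hc.comp (f := fun u : {u // P u} => ((1 : unitInterval), u)) (by fun_prop)
  have hcQ : Continuous fun p : unitInterval × {u // Q u} => Φ p.1 p.2 :=
    hc.comp (f := fun p : unitInterval × {u // Q u} =>
      (p.1, (⟨p.2, hQP _ p.2.2⟩ : {u // P u}))) (by fun_prop)
  refine ⟨⟨fun u => ⟨u, hQP u u.2⟩, by fun_prop⟩, fun _ => rfl,
    ⟨fun u => ⟨Φ 1 u, h 1 one_pos le_rfl u u.2⟩, hc1.subtype_mk _⟩, ?_, ?_⟩
  · refine ContinuousMap.Homotopic.symm ⟨⟨⟨fun p => ⟨Φ p.1 p.2, hP p.1 p.2 p.2.2⟩,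
      hc.subtype_mk _⟩, fun u => Subtype.ext ?_, fun u => Subtype.ext ?_⟩⟩
    · simpa using h0 u u.2
    · simp
  · refine ContinuousMap.Homotopic.symm ⟨⟨⟨fun p => ⟨Φ p.1 p.2, hQ p.1 p.2 p.2.2⟩,
      hcQ.subtype_mk _⟩, fun u => Subtype.ext ?_, fun u => Subtype.ext ?_⟩⟩
    · simpa using h0 u (hQP u u.2)
    · simp

end Deformation

section Families

variable {H : Type*} [NormedAddCommGroup H] [InnerProductSpace ℂ H] [CompleteSpace H]

omit [CompleteSpace H] in
lemma continuous_smul_of_continuousOn_Ioi {K : ℝ → H →L[ℂ] H} (hK : ContinuousOn K (Set.Ioi 0))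
    {M : ℝ} (hM : ∀ s, 0 < s → ‖K s‖ ≤ M) (c : ℝ) :
    Continuous fun s : unitInterval => ((c * s : ℝ) : ℂ) • K s := by
  refine continuous_iff_continuousAt.2 fun s₀ => ?_
  rcases s₀.2.1.eq_or_lt with h0 | h0
  · rw [ContinuousAt, ← h0]
    have hM' : ∀ s : unitInterval, ‖((c * s : ℝ) : ℂ) • K s‖ ≤ ‖c * s‖ * M := fun s => by
      rw [norm_smul, Complex.norm_real]
      rcases s.2.1.eq_or_lt with h | h
      · simp [← h]
      · gcongr
        exact hM s h
    have hlim : Tendsto (fun s : unitInterval => ‖c * s‖ * M) (𝓝 s₀) (𝓝 0) := by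
      have h1 : Continuous fun s : unitInterval => ‖c * s‖ * M := by fun_prop
      simpa [← h0] using h1.tendsto s₀
    simpa using squeeze_zero_norm hM' hlim
  · have h1 : ContinuousAt (fun s : unitInterval => K s) s₀ :=
      ContinuousAt.comp (hK.continuousAt (Ioi_mem_nhds h0)) continuous_subtype_val.continuousAt
    exact ContinuousAt.smul (f := fun s : unitInterval => ((c * s : ℝ) : ℂ)) (by fun_prop) h1

lemma continuous_cayleyTwist {X : Type*} [TopologicalSpace X] {V : ℝ → H →L[ℂ] H}
    (hV0 : V 0 = 1) (hV : ∀ s, 0 < s → star (V s) * V s = 1) (hVc : ContinuousOn V (Set.Ioi 0))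
    (hlim : ∀ x, Tendsto (fun s => V s x) (𝓝[>] 0) (𝓝 x)) {σ : X → ℝ} (hσ : Continuous σ)
    (hσ0 : ∀ x, 0 ≤ σ x) {A : X → H →L[ℂ] H} (hA : ∀ x, star (A x) = A x) (hAc : Continuous A)
    {u : X → H →L[ℂ] H} (hu : Continuous u) (hu' : ∀ x, u x ∈ unitary (H →L[ℂ] H))
    (huc : ∀ x, IsCompactOperator (u x - 1 : H →L[ℂ] H)) :
    Continuous fun x => cayleyTwist (V (σ x)) (A x) (u x) := by
  have hk : Continuous fun x => u x - 1 := by fun_prop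
  refine (continuous_cayley hA hAc).mul (continuous_const.add
    (continuous_conj_of_isCompactOperator hV0
      (fun s hs => norm_le_one_of_star_mul_self (hV s hs)) hVc hlim hσ hσ0 hk huc fun x => ?_))
  have h1 : star (u x - 1) = -star (u x) * (u x - 1) := by
    rw [mul_sub, neg_mul, (Unitary.mem_iff.1 (hu' x)).1, star_sub, star_one]
    noncomm_ring
  rw [h1]
  exact (huc x).mul_left _

end Families

section Semibounded

variable {H : Type*} [NormedAddCommGroup H] [InnerProductSpace ℂ H] [CompleteSpace H]
  {V W C D A u : H →L[ℂ] H} {t : ℝ}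

lemma star_smul_star_mul_self (L : H →L[ℂ] H) (t : ℝ) :
    star ((t : ℂ) • (star L * L)) = (t : ℂ) • (star L * L) := by
  simp

lemma injective_one_sub_cayleyTwist (h : IsIsometryPair V W) (hD : star D = D)
    (hD0 : ∀ x, D x = 0 → x = 0) (hCD : ∀ x y, C x + D y = 0 → x = 0 ∧ y = 0) (ht : t ≠ 0)
    (hA : A = (t : ℂ) • (star (C * star V + D * star W) * (C * star V + D * star W))) :
    Function.Injective ⇑((1 : H →L[ℂ] H) - cayleyTwist V A u) := by
  refine injective_one_sub_of_forall fun v hv => ?_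
  set L := C * star V + D * star W with hL
  obtain ⟨y, h1, h2⟩ := exists_of_cayleyTwist_apply_eq (hA ▸ star_smul_star_mul_self L t) hv
  have h3 : star W * star L = D := by
    rw [hL, star_add, star_mul, star_mul, star_star, star_star, mul_add, ← mul_assoc, ← mul_assoc,
      h.star_right_mul_left, h.right, hD]
    simp
  have h4 : star W (V ((u - 1) (star V v))) = 0 :=
    congrArg (fun T : H →L[ℂ] H => T ((u - 1) (star V v))) h.star_right_mul_left
  have h5 : star W (star L (L y)) = D (L y) := congrArg (fun T : H →L[ℂ] H => T (L y)) h3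
  have h6 : A y = (t : ℂ) • star L (L y) := by rw [hA]; rfl
  rw [h2, map_smul, h6, map_smul, h5] at h4
  have h7 : D (L y) = 0 := by simpa [ht] using h4
  have h8 : C (star V y) + D (star W y) = 0 := hD0 _ h7
  obtain ⟨h9, h10⟩ := hCD _ _ h8
  rw [h1, h.eq_zero h9 h10]
  simp

lemma finiteDimensional_iSup_eigenspace_cayleyTwist (hV : star V * V = 1) (L : H →L[ℂ] H)
    (hu : u ∈ unitary (H →L[ℂ] H)) (hF : FiniteDimensional ℂ (u - 1 : H →L[ℂ] H).range)
    {s : Set ℂ} {c : ℝ} (hs : ∀ μ ∈ s, 0 < c * μ.im) (hct : 0 ≤ c * t) :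
    FiniteDimensional ℂ (⨆ μ ∈ s, Module.End.eigenspace
      (cayleyTwist V ((t : ℂ) • (star L * L)) u : H →ₗ[ℂ] H) μ : Submodule ℂ H) := by
  have hA := star_smul_star_mul_self L t
  refine finiteDimensional_iSup_eigenspace (F := V * (u - 1) * star V)
    (cayleyTwist_mem_unitary hV hA hu) hs ?_ fun v hv => ?_
  · have : FiniteDimensional ℂ ((u - 1 : H →L[ℂ] H).range.map (V : H →ₗ[ℂ] H)) := inferInstance
    refine Submodule.finiteDimensional_of_le
      (S₂ := (u - 1 : H →L[ℂ] H).range.map (V : H →ₗ[ℂ] H)) ?_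
    rintro _ ⟨x, rfl⟩
    exact ⟨(u - 1) (star V x), ⟨star V x, rfl⟩, rfl⟩
  · obtain ⟨y, h1, h2⟩ := exists_eq_cayley hA v
    have h3 : cayleyTwist V ((t : ℂ) • (star L * L)) u v = cayley ((t : ℂ) • (star L * L)) v := by
      change cayley _ (v + (V * (u - 1) * star V) v) = _
      rw [hv, add_zero]
    have h4 : ⟪y, ((t : ℂ) • (star L * L)) y⟫_ℂ = ((t * ‖L y‖ ^ 2 : ℝ) : ℂ) := by
      change ⟪y, (t : ℂ) • star L (L y)⟫_ℂ = _
      rw [inner_smul_right, inner_star_right, inner_self_eq_norm_sq_to_K]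
      push_cast
      rfl
    rw [h3, h2]
    nth_rw 1 [h1]
    rw [inner_cayley_im y hA, h4, Complex.ofReal_re]
    nlinarith [mul_nonneg hct (sq_nonneg ‖L y‖)]

end Semibounded

section Unbounded

variable {H : Type*} [NormedAddCommGroup H] [InnerProductSpace ℂ H] [CompleteSpace H]
  {V W D u : H →L[ℂ] H} {t : ℝ}

lemma star_smul_conj (W : H →L[ℂ] H) (hD : star D = D) (t : ℝ) :
    star ((t : ℂ) • (W * D * star W)) = (t : ℂ) • (W * D * star W) := by
  simp [hD, mul_assoc]

lemma injective_one_sub_cayleyTwist_conj (h : IsIsometryPair V W) (hD : star D = D)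
    (hD0 : ∀ x, D x = 0 → x = 0) (ht : t ≠ 0)
    (hu : Function.Injective ⇑((1 : H →L[ℂ] H) - u)) :
    Function.Injective
      ⇑((1 : H →L[ℂ] H) - cayleyTwist V ((t : ℂ) • (W * D * star W)) u) := by
  refine injective_one_sub_of_forall fun v hv => ?_
  obtain ⟨y, h1, h2⟩ := exists_of_cayleyTwist_apply_eq (star_smul_conj W hD t) hv
  have h6 : ((t : ℂ) • (W * D * star W)) y = (t : ℂ) • W (D (star W y)) := rfl
  rw [h6] at h1 h2
  have h3 : ∀ x, star V (W x) = 0 := fun x =>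
    congrArg (fun T : H →L[ℂ] H => T x) h.star_left_mul_right
  have h4 : ∀ x, star V (V x) = x := fun x => congrArg (fun T : H →L[ℂ] H => T x) h.left
  have h4' : ∀ x, star W (W x) = x := fun x => congrArg (fun T : H →L[ℂ] H => T x) h.right
  have h5 := congrArg ⇑(star V) h2
  rw [h4, map_smul, map_smul, h3, smul_zero, smul_zero] at h5
  have h7 : star V v = 0 := by
    rw [injective_iff_map_eq_zero] at hu
    refine hu _ ?_
    rw [← neg_sub u 1]
    exact neg_eq_zero.2 h5
  have h8 := congrArg ⇑(star W) h2
  rw [h7, map_zero, map_zero, map_zero, map_smul, map_smul, h4'] at h8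
  have h9 : D (star W y) = 0 := by simpa [ht] using h8.symm
  have h10 : v = y := by rw [h1, h9]; simp
  exact h.eq_zero h7 (h10 ▸ hD0 _ h9)

lemma cayleyTwist_conj_apply_of_eigenvector (h : IsIsometryPair V W) (hD : star D = D) {x : H}
    {a : ℝ} (hx : D x = (a : ℂ) • x) :
    cayleyTwist V ((t : ℂ) • (W * D * star W)) u (W x) =
      ((1 - Complex.I * (t * a : ℝ)) / (1 + Complex.I * (t * a : ℝ))) • W x := by
  have h3 : star V (W x) = 0 := congrArg (fun T : H →L[ℂ] H => T x) h.star_left_mul_right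
  have h4 : star W (W x) = x := congrArg (fun T : H →L[ℂ] H => T x) h.right
  have hA := star_smul_conj W hD t
  have hne : (1 + Complex.I * (t * a : ℝ) : ℂ) ≠ 0 := fun h0 => by
    simpa using congrArg Complex.re h0
  have e : cayleyTwist V ((t : ℂ) • (W * D * star W)) u (W x) =
      cayley ((t : ℂ) • (W * D * star W)) (W x) := by
    change cayley _ (W x + V ((u - 1) (star V (W x)))) = _
    rw [h3, map_zero, map_zero, add_zero]
  have hAx : ((t : ℂ) • (W * D * star W)) (W x) = ((t * a : ℝ) : ℂ) • W x := by
    change (t : ℂ) • W (D (star W (W x))) = _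
    rw [h4, hx, map_smul, smul_smul, Complex.ofReal_mul]
  set A := (t : ℂ) • (W * D * star W)
  have h5 : cayley A ((1 + Complex.I • A) (W x)) = (1 - Complex.I • A) (W x) :=
    congrArg (fun T : H →L[ℂ] H => ((1 - Complex.I • A) * T) (W x))
      (Ring.inverse_mul_cancel _ (isUnit_one_add_I_smul hA))
  have h6 : (1 + Complex.I • A) (W x) = (1 + Complex.I * (t * a : ℝ) : ℂ) • W x := by
    change W x + Complex.I • A (W x) = _
    rw [hAx]; module
  have h7 : (1 - Complex.I • A) (W x) = (1 - Complex.I * (t * a : ℝ) : ℂ) • W x := by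
    change W x - Complex.I • A (W x) = _
    rw [hAx]; module
  rw [h6, h7, map_smul] at h5
  rw [e, div_eq_inv_mul, mul_smul, ← h5, smul_smul, inv_mul_cancel₀ hne, one_smul]

lemma im_cayley_ofReal (r : ℝ) :
    ((1 - Complex.I * r) / (1 + Complex.I * r)).im = -(2 * r) / (1 + r ^ 2) := by
  have hpos : (0 : ℝ) < 1 + r ^ 2 := by positivity
  rw [Complex.div_im]
  simp [Complex.normSq_apply]
  field_simp
  ring

/-- If a self-adjoint operator has infinitely many eigenvalues of the sign prescribed by `s`, then
the twist has an infinite-dimensional span of eigenspaces for eigenvalues in `s`. -/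
lemma not_finiteDimensional_iSup_eigenspace_cayleyTwist (h : IsIsometryPair V W)
    (hD : star D = D) {e : ℕ → H} (he : LinearIndependent ℂ e) {a : ℕ → ℝ}
    (hx : ∀ n, D (e n) = (a n : ℂ) • e n) {s : Set ℂ}
    (hs : ∀ n, ((1 - Complex.I * (t * a n : ℝ)) / (1 + Complex.I * (t * a n : ℝ)) : ℂ) ∈ s) :
    ¬ FiniteDimensional ℂ (⨆ μ ∈ s, Module.End.eigenspace
      (cayleyTwist V ((t : ℂ) • (W * D * star W)) u : H →ₗ[ℂ] H) μ : Submodule ℂ H) := by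
  refine not_finiteDimensional_iSup_eigenspace (e := fun n => W (e n)) ?_ fun n =>
    ⟨_, hs n, cayleyTwist_conj_apply_of_eigenvector h hD (hx n)⟩
  refine he.map' (W : H →ₗ[ℂ] H) (LinearMap.ker_eq_bot.2 ?_)
  intro x y hxy
  have := congrArg ⇑(star W) hxy
  have h4 : ∀ x, star W (W x) = x := fun x => congrArg (fun T : H →L[ℂ] H => T x) h.right
  exact (h4 x).symm.trans (this.trans (h4 y))

/-- On an infinite-dimensional separable Hilbert space there is an injective compact self-adjoint
operator with infinitely many eigenvalues of each sign. -/
lemma exists_compact_eigenvalues (b : HilbertBasis ℕ ℂ H) :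
    ∃ (D : H →L[ℂ] H) (a : ℕ → ℝ), IsCompactOperator D ∧ star D = D ∧ (∀ x, D x = 0 → x = 0) ∧
      (∀ n, D (b n) = (a n : ℂ) • b n) ∧ (∀ n, 0 < a (2 * n)) ∧ ∀ n, a (2 * n + 1) < 0 := by
  let a : ℕ → ℝ := fun n => (-1 / 2) ^ n
  have ha : Summable fun n => ‖((a n : ℝ) : ℂ)‖ := by
    simpa [a] using summable_geometric_of_lt_one (r := (2⁻¹ : ℝ)) (by norm_num) (by norm_num)
  refine ⟨weightedOp b (fun n => (a n : ℂ)) id, a, isCompactOperator_weightedOp b id ha,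
    star_weightedOp b ha fun n => Complex.conj_ofReal _, fun x hx => ?_,
    weightedOp_id_apply b ha, fun n => ?_, fun n => ?_⟩
  · refine HilbertBasis.ext_inner b fun n => ?_
    have h1 := inner_weightedOp b id ha n x
    rw [hx, inner_zero_right] at h1
    have h2 : ((a n : ℝ) : ℂ) ≠ 0 := Complex.ofReal_ne_zero.2 (pow_ne_zero _ (by norm_num))
    rw [inner_zero_right]
    exact (mul_eq_zero.1 h1.symm).resolve_left h2
  · simp only [a, pow_mul]; positivity
  · simp only [a, pow_succ, pow_mul]
    have : (0 : ℝ) < ((-1 / 2) ^ 2) ^ n := by positivity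
    norm_num at this ⊢

end Unbounded

section Main

variable {H : Type*} [NormedAddCommGroup H] [InnerProductSpace ℂ H] [CompleteSpace H]
  [TopologicalSpace.SeparableSpace H]

/-- Unitaries with injective compact defect deform into those having only finitely many eigenvalues
on one side of the real axis. -/
lemma exists_isHomotopyEquiv_finiteDimensional (hinf : ¬ FiniteDimensional ℂ H)
    {P : (H →L[ℂ] H) → Prop} (hP : ∀ u, P u ↔ u ∈ unitary (H →L[ℂ] H) ∧
      IsCompactOperator ⇑(u - 1) ∧ Function.Injective ⇑((1 : H →L[ℂ] H) - u))
    {S : Set ℂ} {c : ℝ} (hc : c ≠ 0) (hS : ∀ μ ∈ S, 0 < c * μ.im) :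
    ∃ f : C({u : H →L[ℂ] H // P u ∧ FiniteDimensional ℂ
        (⨆ μ ∈ S, Module.End.eigenspace (u : H →ₗ[ℂ] H) μ : Submodule ℂ H)}, {u // P u}),
      (∀ u, (f u : H →L[ℂ] H) = (u : H →L[ℂ] H)) ∧ IsHomotopyEquiv f := by
  obtain ⟨b⟩ := exists_nat_hilbertBasis (H := H) hinf
  obtain ⟨C, D, hCc, hDc, hD, hD0, hCD⟩ := exists_transverse_pair b
  obtain ⟨V, W, hV0, hVW, hVc, hWc, hlim⟩ := exists_isometryPair_path (H := H) hinf
  let L : ℝ → H →L[ℂ] H := fun s => C * star (V s) + D * star (W s)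
  have hLc : ContinuousOn (fun s => star (L s) * L s) (Set.Ioi 0) := by
    have h1 : ContinuousOn L (Set.Ioi 0) :=
      (continuousOn_const.mul hVc.star).add (continuousOn_const.mul hWc.star)
    exact h1.star.mul h1
  have hLn : ∀ s, 0 < s → ‖star (L s) * L s‖ ≤ (‖C‖ + ‖D‖) * (‖C‖ + ‖D‖) := fun s hs => by
    have hV1 := norm_le_one_of_star_mul_self (hVW s hs).left
    have hW1 := norm_le_one_of_star_mul_self (hVW s hs).right
    rw [← norm_star] at hV1 hW1
    have h1 : ‖L s‖ ≤ ‖C‖ + ‖D‖ := by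
      calc ‖L s‖ ≤ ‖C * star (V s)‖ + ‖D * star (W s)‖ := norm_add_le _ _
        _ ≤ ‖C‖ * ‖star (V s)‖ + ‖D‖ * ‖star (W s)‖ := by gcongr <;> exact norm_mul_le _ _
        _ ≤ ‖C‖ * 1 + ‖D‖ * 1 := by gcongr
        _ = _ := by ring
    calc _ ≤ ‖star (L s)‖ * ‖L s‖ := norm_mul_le _ _
      _ ≤ _ := by rw [norm_star]; gcongr
  have hLk : ∀ s, IsCompactOperator (L s) := fun s => (hCc.mul_right _).add (hDc.mul_right _)
  have hsA := star_smul_star_mul_self (H := H)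
  have hu : ∀ u : {u // P u}, (u : H →L[ℂ] H) ∈ unitary (H →L[ℂ] H) := fun u => ((hP u).1 u.2).1
  have hk : ∀ u : {u // P u}, IsCompactOperator (u - 1 : H →L[ℂ] H) :=
    fun u => ((hP u).1 u.2).2.1
  refine exists_isHomotopyEquiv_of_deformation (fun u hu => hu.1)
    (fun s u => cayleyTwist (V s) (((c * s : ℝ) : ℂ) • (star (L s) * L s))
      (cfc (circleTrunc (s / 2)) u)) ?_ (fun u hu => ?_)
    (fun s hs hs1 u hu => ⟨(hP _).2 ⟨?_, ?_, ?_⟩, ?_⟩)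
  · have hσ : ∀ s : unitInterval, (s : ℝ) / 2 ∈ Set.Icc (0 : ℝ) (1 / 2) := fun s =>
      ⟨by linarith [s.2.1], by linarith [s.2.2]⟩
    have hA : Continuous fun s : unitInterval => ((c * s : ℝ) : ℂ) • (star (L s) * L s) :=
      continuous_smul_of_continuousOn_Ioi hLc hLn c
    have hcfc : Continuous fun p : unitInterval × {u // P u} =>
        cfc (circleTrunc ((p.1 : ℝ) / 2)) (p.2 : H →L[ℂ] H) := by
      have hσc : Continuous fun p : unitInterval × {u // P u} => (p.1 : ℝ) / 2 := by fun_prop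
      exact continuous_cfc_circleTrunc hσc (fun p => hσ p.1)
        (continuous_subtype_val.comp continuous_snd) fun p => hu p.2
    exact continuous_cayleyTwist hV0 (fun s hs => (hVW s hs).left) hVc hlim (by fun_prop)
      (fun p => p.1.2.1) (fun p => hsA _ _) (hA.comp continuous_fst) hcfc
      (fun p => cfc_circleTrunc_mem_unitary (hu p.2) (hσ p.1).1 (hσ p.1).2) fun p =>
      isCompactOperator_cfc_circleTrunc_sub_one (hu p.2) (hk p.2) (hσ p.1).1 (hσ p.1).2
  · simp [cayleyTwist, hV0, cayley_zero, cfc_circleTrunc_zero ((hP u).1 hu).1]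
  · exact cayleyTwist_mem_unitary (hVW s hs).left (hsA _ _)
      (cfc_circleTrunc_mem_unitary ((hP u).1 hu).1 (by linarith) (by linarith))
  · exact isCompactOperator_cayleyTwist_sub_one (hsA _ _)
      (((hLk s).mul_left _).smul _)
      (isCompactOperator_cfc_circleTrunc_sub_one ((hP u).1 hu).1 ((hP u).1 hu).2.1
        (by linarith) (by linarith))
  · exact injective_one_sub_cayleyTwist (hVW s hs) hD hD0 hCD (mul_ne_zero hc hs.ne') rfl
  · refine finiteDimensional_iSup_eigenspace_cayleyTwist (hVW s hs).left (L s)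
      (cfc_circleTrunc_mem_unitary ((hP u).1 hu).1 (by linarith) (by linarith))
      (finiteDimensional_range_cfc_circleTrunc_sub_one ((hP u).1 hu).1 ((hP u).1 hu).2.1
        (by linarith) (by linarith))
      hS ?_
    rw [← mul_assoc]
    exact mul_nonneg (mul_self_nonneg c) hs.le

/-- Unitaries with injective compact defect deform into those having infinitely many eigenvalues
on both sides of the real axis. -/
lemma exists_isHomotopyEquiv_not_finiteDimensional (hinf : ¬ FiniteDimensional ℂ H)
    {P : (H →L[ℂ] H) → Prop} (hP : ∀ u, P u ↔ u ∈ unitary (H →L[ℂ] H) ∧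
      IsCompactOperator ⇑(u - 1) ∧ Function.Injective ⇑((1 : H →L[ℂ] H) - u)) :
    ∃ f : C({u : H →L[ℂ] H // P u ∧ ¬ FiniteDimensional ℂ
        (⨆ μ ∈ {μ : ℂ | 0 < μ.im}, Module.End.eigenspace (u : H →ₗ[ℂ] H) μ : Submodule ℂ H) ∧
        ¬ FiniteDimensional ℂ
        (⨆ μ ∈ {μ : ℂ | μ.im < 0}, Module.End.eigenspace (u : H →ₗ[ℂ] H) μ : Submodule ℂ H)},
        {u // P u}),
      (∀ u, (f u : H →L[ℂ] H) = (u : H →L[ℂ] H)) ∧ IsHomotopyEquiv f := by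
  obtain ⟨b⟩ := exists_nat_hilbertBasis (H := H) hinf
  obtain ⟨D, a, hDc, hD, hD0, hDa, ha0, ha1⟩ := exists_compact_eigenvalues b
  obtain ⟨V, W, hV0, hVW, hVc, hWc, hlim⟩ := exists_isometryPair_path (H := H) hinf
  have hKc : ContinuousOn (fun s => W s * D * star (W s)) (Set.Ioi 0) :=
    (hWc.mul continuousOn_const).mul hWc.star
  have hKn : ∀ s, 0 < s → ‖W s * D * star (W s)‖ ≤ ‖D‖ := fun s hs => by
    have hW1 := norm_le_one_of_star_mul_self (hVW s hs).right
    have hW2 := hW1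
    rw [← norm_star] at hW2
    calc _ ≤ ‖W s‖ * ‖D‖ * ‖star (W s)‖ := norm_mul₃_le
      _ ≤ 1 * ‖D‖ * 1 := by gcongr
      _ = _ := by ring
  have hb := b.orthonormal.linearIndependent
  have hsA := fun s : ℝ => star_smul_conj (W s) hD
  refine exists_isHomotopyEquiv_of_deformation (fun u hu => hu.1)
    (fun s u => cayleyTwist (V s) (((1 * s : ℝ) : ℂ) • (W s * D * star (W s))) u)
    ?_ (fun u hu => ?_) (fun s hs _ u hu => ⟨(hP _).2 ⟨?_, ?_, ?_⟩, ?_, ?_⟩)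
  · have hA : Continuous fun s : unitInterval =>
        ((1 * s : ℝ) : ℂ) • (W s * D * star (W s)) :=
      continuous_smul_of_continuousOn_Ioi hKc hKn 1
    exact continuous_cayleyTwist hV0 (fun s hs => (hVW s hs).left) hVc hlim (by fun_prop)
      (fun p => p.1.2.1) (fun p => hsA _ _) (hA.comp continuous_fst)
      (by fun_prop) (fun p => ((hP p.2).1 p.2.2).1) fun p => ((hP p.2).1 p.2.2).2.1
  · simp [cayleyTwist, hV0, cayley_zero]
  · exact cayleyTwist_mem_unitary (hVW s hs).left (hsA _ _) ((hP u).1 hu).1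
  · exact isCompactOperator_cayleyTwist_sub_one (hsA _ _)
      (((hDc.mul_left _).mul_right _).smul _) ((hP u).1 hu).2.1
  · exact injective_one_sub_cayleyTwist_conj (hVW s hs) hD hD0 (by simpa using hs.ne')
      ((hP u).1 hu).2.2
  · refine not_finiteDimensional_iSup_eigenspace_cayleyTwist (hVW s hs) hD
      (hb.comp (fun n : ℕ => 2 * n + 1) fun m n h => by simpa using h)
      (fun n => hDa (2 * n + 1)) fun n => ?_
    rw [Set.mem_ofPred_eq, im_cayley_ofReal]
    have := mul_neg_of_pos_of_neg hs (ha1 n)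
    exact div_pos (by linarith) (by positivity)
  · refine not_finiteDimensional_iSup_eigenspace_cayleyTwist (hVW s hs) hD
      (hb.comp (fun n : ℕ => 2 * n) fun m n h => by simpa using h)
      (fun n => hDa (2 * n)) fun n => ?_
    rw [Set.mem_ofPred_eq, im_cayley_ofReal]
    have := mul_pos hs (ha0 n)
    exact div_neg_of_neg_of_pos (by linarith) (by positivity)

end Main

/-- Each of the inclusions `Y⁺ ↪ Y`, `Y⁻ ↪ Y`, `Y* ↪ Y` is a homotopy equivalence, where
`Y = {u ∈ U(H) : u − 1 compact, 1 − u injective}`, `Y⁺` (resp. `Y⁻`) consists of those `u`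
for which the span of the eigenspaces with eigenvalues of positive (resp. negative) imaginary
part is finite-dimensional, and `Y*` of those for which both spans are infinite-dimensional. -/
theorem stmt_8 (H : Type*) [NormedAddCommGroup H] [InnerProductSpace ℂ H]
    [CompleteSpace H] [TopologicalSpace.SeparableSpace H]
    (hinf : ¬ FiniteDimensional ℂ H) :
    (∃ f : C({u : H →L[ℂ] H // (u ∈ unitary (H →L[ℂ] H) ∧ IsCompactOperator ⇑(u - 1) ∧
                Function.Injective ⇑((1 : H →L[ℂ] H) - u)) ∧
                FiniteDimensional ℂ (posEigenSpan u)},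
            {u : H →L[ℂ] H // u ∈ unitary (H →L[ℂ] H) ∧ IsCompactOperator ⇑(u - 1) ∧
                Function.Injective ⇑((1 : H →L[ℂ] H) - u)}),
      (∀ u, (f u : H →L[ℂ] H) = (u : H →L[ℂ] H)) ∧ IsHomotopyEquiv f) ∧
    (∃ f : C({u : H →L[ℂ] H // (u ∈ unitary (H →L[ℂ] H) ∧ IsCompactOperator ⇑(u - 1) ∧
                Function.Injective ⇑((1 : H →L[ℂ] H) - u)) ∧
                FiniteDimensional ℂ (negEigenSpan u)},
            {u : H →L[ℂ] H // u ∈ unitary (H →L[ℂ] H) ∧ IsCompactOperator ⇑(u - 1) ∧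
                Function.Injective ⇑((1 : H →L[ℂ] H) - u)}),
      (∀ u, (f u : H →L[ℂ] H) = (u : H →L[ℂ] H)) ∧ IsHomotopyEquiv f) ∧
    (∃ f : C({u : H →L[ℂ] H // (u ∈ unitary (H →L[ℂ] H) ∧ IsCompactOperator ⇑(u - 1) ∧
                Function.Injective ⇑((1 : H →L[ℂ] H) - u)) ∧
                ¬ FiniteDimensional ℂ (posEigenSpan u) ∧
                ¬ FiniteDimensional ℂ (negEigenSpan u)},
            {u : H →L[ℂ] H // u ∈ unitary (H →L[ℂ] H) ∧ IsCompactOperator ⇑(u - 1) ∧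
                Function.Injective ⇑((1 : H →L[ℂ] H) - u)}),
      (∀ u, (f u : H →L[ℂ] H) = (u : H →L[ℂ] H)) ∧ IsHomotopyEquiv f) := by
  refine ⟨exists_isHomotopyEquiv_finiteDimensional hinf (fun _ => Iff.rfl) (c := 1) one_ne_zero
      fun μ hμ => ?_,
    exists_isHomotopyEquiv_finiteDimensional hinf (fun _ => Iff.rfl) (c := -1) (by norm_num)
      fun μ hμ => ?_,
    exists_isHomotopyEquiv_not_finiteDimensional hinf fun _ => Iff.rfl⟩
  · rwa [one_mul]
  · rw [neg_one_mul]
    exact neg_pos.2 hμ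
end

section
/- Each of the subsets Y⁺, Y⁻, and Y* is dense in Y with respect to the operator-norm topology. -/
open scoped InnerProductSpace

section
variable {H : Type*} [NormedAddCommGroup H] [InnerProductSpace ℂ H] [CompleteSpace H]

theorem exists_finiteDimensional_reducing_of_isCompactOperator_sub_one {u : H →L[ℂ] H}
    (hu : u ∈ unitary (H →L[ℂ] H)) (hc : IsCompactOperator ⇑(u - 1)) {ε : ℝ} (hε : 0 < ε) :
    ∃ K : Submodule ℂ H, FiniteDimensional ℂ K ∧ (∀ x ∈ K, u x ∈ K) ∧ (∀ x ∈ K, star u x ∈ K) ∧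
      ∀ x ∈ Kᗮ, ‖(u - 1) x‖ ≤ ε * ‖x‖ := by
  have hn : IsStarNormal u := ⟨by
    rw [Commute, SemiconjBy, Unitary.star_mul_self_of_mem hu, Unitary.mul_star_self_of_mem hu]⟩
  let d : ℂ → ℂ := fun z ↦ ((max ‖z - 1‖ ε : ℝ) : ℂ)
  have hd0 : ∀ z, d z ≠ 0 := fun z ↦
    Complex.ofReal_ne_zero.2 (lt_of_lt_of_le hε (le_max_right _ _)).ne'
  have hd : Continuous d := by fun_prop
  let h : ℂ → ℂ := fun z ↦ ((max (‖z - 1‖ - ε) 0 : ℝ) : ℂ)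
  have hh : Continuous h := by fun_prop
  let r : ℂ → ℂ := fun z ↦ (z - 1) / d z
  have hr : Continuous r := (by fun_prop : Continuous fun z : ℂ ↦ z - 1).div₀ hd hd0
  let q : ℂ → ℂ := fun z ↦ star (z - 1) / (d z * d z)
  have hq : Continuous q := (by fun_prop : Continuous fun z : ℂ ↦ star (z - 1)).div₀ (hd.mul hd)
    fun z ↦ mul_ne_zero (hd0 z) (hd0 z)
  have hid : cfc (fun z : ℂ ↦ z - 1) u = u - 1 := by
    rw [cfc_sub (R := ℂ) (fun z ↦ z) (fun _ ↦ 1) u, cfc_id' ℂ u, cfc_const_one ℂ u]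
  set P := cfc h u with hP
  have hPs : star P = P := by
    rw [hP, ← cfc_star]
    congr 1
    funext z
    simp [h]
  have hPn : IsStarNormal P := ⟨by rw [hPs]⟩
  set S := cfc q u * (u - 1) with hS
  have hSc : IsCompactOperator S := hc.clm_comp (cfc q u)
  have hSP : S * P = P := by
    rw [hS, ← hid, hP, ← cfc_mul q (fun z ↦ z - 1) u hq.continuousOn (by fun_prop),
      ← cfc_mul (fun z ↦ q z * (z - 1)) h u ((hq.mul (by fun_prop)).continuousOn) hh.continuousOn]
    congr 1
    funext z
    rcases le_total ‖z - 1‖ ε with hz | hz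
    · have : h z = 0 := by simp [h, max_eq_right (sub_nonpos.2 hz)]
      simp [this]
    · have h1 : d z * d z = star (z - 1) * (z - 1) := by
        simp only [d, max_eq_left hz]
        rw [← Complex.ofReal_mul, Complex.star_def, Complex.conj_mul']
        push_cast; ring
      have : q z * (z - 1) = 1 := by
        simp only [q]
        rw [div_mul_eq_mul_div, ← h1, div_self (mul_ne_zero (hd0 z) (hd0 z))]
      rw [this, one_mul]
  have hRP : u - 1 - cfc r u * P = cfc (fun z ↦ z - 1 - r z * h z) u := by
    rw [cfc_sub (fun z : ℂ ↦ z - 1) (fun z ↦ r z * h z) u (by fun_prop) (hr.mul hh).continuousOn, hid,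
      cfc_mul r h u hr.continuousOn hh.continuousOn]
  have hbd : ‖u - 1 - cfc r u * P‖ ≤ ε := by
    rw [hRP]
    refine norm_cfc_le hε.le fun z _ ↦ ?_
    rcases le_total ‖z - 1‖ ε with hz | hz
    · have : h z = 0 := by simp [h, max_eq_right (sub_nonpos.2 hz)]
      simpa [this] using hz
    · have h1 : z - 1 - r z * h z = ε * r z := by
        have : h z = d z - ε := by
          simp [h, d, max_eq_left hz, max_eq_left (sub_nonneg.2 hz)]
        have h0 := hd0 z
        rw [this]
        simp only [r]
        field_simp
        ring
      have h2 : ‖r z‖ = 1 := by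
        simp only [r, d, max_eq_left hz, norm_div, Complex.norm_real, norm_norm]
        exact div_self (hε.trans_le hz).ne'
      rw [h1, norm_mul, h2]
      simp [abs_of_pos hε]
  have hcu : Commute u P := by
    have := cfc_commute_cfc (fun z : ℂ ↦ z) h u
    rwa [cfc_id' ℂ u] at this
  have hcs : Commute (star u) P := by
    have := hcu.star_star
    rwa [hPs] at this
  refine ⟨P.range, ?_, ?_, ?_, ?_⟩
  · have : FiniteDimensional ℂ (Module.End.eigenspace (S : H →ₗ[ℂ] H) 1) :=
      ContinuousLinearMap.finite_dimensional_eigenspace hSc 1 one_ne_zero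
    refine Submodule.finiteDimensional_of_le (S₂ := Module.End.eigenspace (S : H →ₗ[ℂ] H) 1) ?_
    rintro _ ⟨x, rfl⟩
    rw [Module.End.mem_eigenspace_iff, one_smul]
    exact congr($hSP x)
  · rintro _ ⟨x, rfl⟩
    exact ⟨u x, congr($hcu.eq.symm x)⟩
  · rintro _ ⟨x, rfl⟩
    exact ⟨star u x, congr($hcs.eq.symm x)⟩
  · intro x hx
    rw [ContinuousLinearMap.IsStarNormal.orthogonal_range hPn] at hx
    have hx' : P x = 0 := hx
    have := (u - 1 - cfc r u * P).le_of_opNorm_le hbd x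
    simpa [hx'] using this

theorem exists_compact_diagonal {e : ℕ → H} (he : Orthonormal ℂ e) {ε : ℝ} {c : ℕ → ℂ}
    (hc : ∀ n, ‖c n‖ ≤ ε / 2 / 2 ^ n) :
    ∃ W : H →L[ℂ] H, IsCompactOperator W ∧ ‖W‖ ≤ ε ∧
      (∀ y x, HasSum (fun n ↦ c n * ⟪e n, x⟫_ℂ * ⟪y, e n⟫_ℂ) ⟪y, W x⟫_ℂ) := by
  let f : ℕ → H →L[ℂ] H := fun n ↦ c n • InnerProductSpace.rankOne ℂ (e n) (e n)
  have hf : ∀ n, ‖f n‖ ≤ ε / 2 / 2 ^ n := fun n ↦ by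
    simpa [f, norm_smul, he.norm_eq_one] using hc n
  have hs : Summable f := .of_norm_bounded (hasSum_geometric_two' ε).summable hf
  refine ⟨∑' n, f n, ?_, tsum_of_norm_bounded (hasSum_geometric_two' ε) hf, fun y x ↦ ?_⟩
  · have hcl : IsClosed {T : H →L[ℂ] H | IsCompactOperator T} := isClosed_setOfPred_isCompactOperator
    refine hcl.mem_of_tendsto hs.hasSum (.of_forall fun s ↦ ?_)
    refine (compactOperator (RingHom.id ℂ) H H).sum_mem fun n _ ↦ ?_
    refine (compactOperator (RingHom.id ℂ) H H).smul_mem _ ?_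
    exact (isCompactOperator_of_locallyCompactSpace_rng
      (ContinuousLinearMap.toSpanSingleton ℂ (e n))).comp_clm (innerSL ℂ (e n))
  · have h1 := (hs.hasSum.mapL (ContinuousLinearMap.apply ℂ H x)).mapL (innerSL ℂ y)
    simpa [f, mul_assoc] using h1

theorem exists_orthonormal_nat_of_orthogonal [TopologicalSpace.SeparableSpace H]
    (hinf : ¬ FiniteDimensional ℂ H) (K : Submodule ℂ H) [FiniteDimensional ℂ K] :
    ∃ e : ℕ → H, Orthonormal ℂ e ∧ (∀ n, e n ∈ Kᗮ) ∧ ∀ x, (∀ n, ⟪e n, x⟫_ℂ = 0) → x ∈ K := by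
  obtain ⟨w, b, hb⟩ := exists_hilbertBasis ℂ Kᗮ
  have hbo : Orthonormal ℂ fun i ↦ (b i : H) := b.orthonormal.comp_linearIsometry Kᗮ.subtypeₗᵢ
  have hcount : Countable w := by
    refine Pairwise.countable_of_isOpen_disjoint (s := fun i : w ↦ Metric.ball (b i : H) (1 / 2))
      (fun i j hij ↦ Metric.ball_disjoint_ball ?_) (fun _ ↦ Metric.isOpen_ball)
      fun _ ↦ Metric.nonempty_ball.2 (by norm_num)
    have h2 : ‖(b i : H) - b j‖ ^ 2 = 2 := by
      rw [norm_sub_sq (𝕜 := ℂ), hbo.1 i, hbo.1 j, hbo.2 hij]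
      norm_num
    rw [dist_eq_norm]
    nlinarith [norm_nonneg ((b i : H) - b j)]
  have hK : ∀ x, (∀ i, ⟪(b i : H), x⟫_ℂ = 0) → x ∈ K := fun x hx ↦ by
    rw [← K.orthogonal_orthogonal, Submodule.mem_orthogonal]
    intro y hy
    have h1 := b.hasSum_repr ⟨y, hy⟩
    have h2 := (h1.mapL Kᗮ.subtypeL).mapL (innerSL ℂ x)
    have h3 : ∀ i, ⟪x, (b i : H)⟫_ℂ = 0 := fun i ↦ inner_eq_zero_symm.1 (hx i)
    simp only [map_smul, Submodule.subtypeL_apply, innerSL_apply_apply, h3, smul_zero] at h2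
    exact inner_eq_zero_symm.1 (h2.unique hasSum_zero)
  have hw : Infinite w := by
    by_contra hfin
    rw [not_infinite_iff_finite] at hfin
    let L : H →ₗ[ℂ] (w → ℂ) := LinearMap.pi fun i ↦ (innerSL ℂ (b i : H) : H →ₗ[ℂ] ℂ)
    have hL : FiniteDimensional ℂ L.ker :=
      Submodule.finiteDimensional_of_le (S₂ := K) fun x hx ↦ hK x fun i ↦ congrFun hx i
    have := Module.Finite.equiv L.quotKerEquivRange.symm
    exact hinf (Module.Finite.of_submodule_quotient L.ker)
  obtain ⟨g⟩ : Nonempty (ℕ ≃ w) := nonempty_equiv_of_countable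
  exact ⟨fun n ↦ (b (g n) : H), hbo.comp _ g.injective, fun n ↦ (b (g n)).2,
    fun x hx ↦ hK x fun i ↦ by simpa using hx (g.symm i)⟩

theorem ContinuousLinearMap.eq_of_eqOn_of_orthonormal {e : ℕ → H} {K : Submodule ℂ H}
    (hK : ∀ x, (∀ n, ⟪e n, x⟫_ℂ = 0) → x ∈ K) {A B : H →L[ℂ] H} (hABK : ∀ x ∈ K, A x = B x)
    (hABe : ∀ n, A (e n) = B (e n)) : A = B := by
  rw [← sub_eq_zero, ← star_eq_zero]
  ext y
  have hy : star (A - B) y ∈ K := hK _ fun n ↦ by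
    rw [ContinuousLinearMap.star_eq_adjoint, ContinuousLinearMap.adjoint_inner_right]
    simp [hABe n]
  rw [zero_apply, ← inner_self_eq_zero (𝕜 := ℂ)]
  nth_rewrite 2 [ContinuousLinearMap.star_eq_adjoint]
  rw [ContinuousLinearMap.adjoint_inner_right]
  rw [sub_apply, hABK _ hy, sub_self, inner_zero_left]

theorem exists_unitary_near_with_diagonal_part [TopologicalSpace.SeparableSpace H]
    (hinf : ¬ FiniteDimensional ℂ H) {u : H →L[ℂ] H}
    (hu : u ∈ unitary (H →L[ℂ] H)) (hc : IsCompactOperator ⇑(u - 1))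
    (hi : Function.Injective ⇑((1 : H →L[ℂ] H) - u)) {ε : ℝ} (hε : 0 < ε)
    {lam : ℕ → ℂ} (hl1 : ∀ n, ‖lam n‖ = 1) (hl : ∀ n, lam n ≠ 1)
    (hle : ∀ n, ‖lam n - 1‖ ≤ ε / 2 / 2 ^ n) :
    ∃ v : H →L[ℂ] H, (v ∈ unitary (H →L[ℂ] H) ∧ IsCompactOperator ⇑(v - 1) ∧
      Function.Injective ⇑((1 : H →L[ℂ] H) - v)) ∧ ‖u - v‖ ≤ 2 * ε ∧
      ∃ (e : ℕ → H) (K : Submodule ℂ H), Orthonormal ℂ e ∧ FiniteDimensional ℂ K ∧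
        (∀ n, v (e n) = lam n • e n) ∧
        ∀ μ x, v x = μ • x → (∀ n, μ ≠ lam n) → x ∈ K := by
  obtain ⟨K, hKf, huK, hsuK, hKε⟩ :=
    exists_finiteDimensional_reducing_of_isCompactOperator_sub_one hu hc hε
  obtain ⟨e, he, heK, hK⟩ := exists_orthonormal_nat_of_orthogonal hinf K
  obtain ⟨W, hWc, hWε, hW⟩ := exists_compact_diagonal he hle
  have heK' : ∀ n, ∀ k ∈ K, ⟪e n, k⟫_ℂ = 0 := fun n k hk ↦
    Submodule.inner_left_of_mem_orthogonal hk (heK n)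
  have hKe : ∀ n, ∀ k ∈ K, ⟪k, e n⟫_ℂ = 0 := fun n k hk ↦
    Submodule.inner_right_of_mem_orthogonal hk (heK n)
  have hWK : ∀ k ∈ K, W k = 0 := fun k hk ↦ by
    rw [← inner_self_eq_zero (𝕜 := ℂ)]
    refine (hW (W k) k).unique ?_
    simp [heK' _ k hk]
  have hKW : ∀ k ∈ K, ∀ x, ⟪k, W x⟫_ℂ = 0 := fun k hk x ↦ by
    refine (hW k x).unique ?_
    simp [hKe _ k hk]
  have hortho : ∀ m n, m ≠ n → ⟪e m, e n⟫_ℂ = 0 := fun m n h ↦ he.2 h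
  have heW : ∀ n x, ⟪e n, W x⟫_ℂ = (lam n - 1) * ⟪e n, x⟫_ℂ := fun n x ↦ by
    refine (hW (e n) x).unique ?_
    have := hasSum_single (f := fun m ↦ (lam m - 1) * ⟪e m, x⟫_ℂ * ⟪e n, e m⟫_ℂ) n
      fun m hm ↦ by rw [hortho n m hm.symm, mul_zero]
    simpa [he.1] using this
  have hWe : ∀ n, W (e n) = (lam n - 1) • e n := fun n ↦ by
    refine ext_inner_left ℂ fun y ↦ ?_
    refine (hW y (e n)).unique ?_
    have := hasSum_single (f := fun m ↦ (lam m - 1) * ⟪e m, e n⟫_ℂ * ⟪y, e m⟫_ℂ) n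
      fun m hm ↦ by rw [hortho m n hm, mul_zero, zero_mul]
    simpa [he.1, inner_smul_right] using this
  set P := K.starProjection with hP
  have hPmem : ∀ x, P x ∈ K := fun x ↦ K.starProjection_apply_mem x
  have hPK : ∀ k ∈ K, P k = k := fun k hk ↦ K.starProjection_eq_self_iff.2 hk
  have hPe : ∀ n, P (e n) = 0 := fun n ↦ (K.starProjection_apply_eq_zero_iff).2 (heK n)
  have hPo : ∀ x, x - P x ∈ Kᗮ := fun x ↦ K.sub_starProjection_mem_orthogonal x
  let v : H →L[ℂ] H := u * P + (1 - P) + W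
  have hv : ∀ x, v x = u (P x) + (x - P x) + W x := fun x ↦ rfl
  have hvK : ∀ k ∈ K, v k = u k := fun k hk ↦ by simp [hv, hPK k hk, hWK k hk]
  have hve : ∀ n, v (e n) = lam n • e n := fun n ↦ by
    simp [hv, hPe n, hWe n, sub_smul]
  have hev : ∀ n x, ⟪e n, v x⟫_ℂ = lam n * ⟪e n, x⟫_ℂ := fun n x ↦ by
    rw [hv, inner_add_right, inner_add_right, inner_sub_right, heK' n _ (huK _ (hPmem x)),
      heK' n _ (hPmem x), heW]
    ring
  have hsvK : ∀ k ∈ K, star v k = star u k := fun k hk ↦ by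
    refine ext_inner_right ℂ fun x ↦ ?_
    have h1 : ⟪star u k, x - P x⟫_ℂ = 0 :=
      Submodule.inner_right_of_mem_orthogonal (hsuK k hk) (hPo x)
    rw [inner_sub_right, sub_eq_zero] at h1
    rw [h1, ContinuousLinearMap.star_eq_adjoint, ContinuousLinearMap.star_eq_adjoint,
      ContinuousLinearMap.adjoint_inner_left, ContinuousLinearMap.adjoint_inner_left, hv,
      inner_add_right, inner_add_right, hKW k hk,
      Submodule.inner_right_of_mem_orthogonal hk (hPo x), add_zero, add_zero]
  have hsve : ∀ n, star v (e n) = star (lam n) • e n := fun n ↦ by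
    refine ext_inner_right ℂ fun x ↦ ?_
    rw [ContinuousLinearMap.star_eq_adjoint, ContinuousLinearMap.adjoint_inner_left, hev,
      inner_smul_left, Complex.star_def, Complex.conj_conj]
  have hll : ∀ n, star (lam n) * lam n = 1 := fun n ↦ by
    rw [Complex.star_def, Complex.conj_mul', hl1]; simp
  have hmem : ∀ μ x, v x = μ • x → (∀ n, μ ≠ lam n) → x ∈ K := fun μ x hx hμ ↦ by
    refine hK x fun n ↦ ?_
    have h1 := hev n x
    rw [hx, inner_smul_right, ← sub_eq_zero, ← sub_mul] at h1
    exact (mul_eq_zero.1 h1).resolve_left (sub_ne_zero.2 (hμ n))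
  refine ⟨v, ⟨Unitary.mem_iff.2 ⟨?_, ?_⟩, ?_, ?_⟩, ?_, e, K, he, hKf, hve, hmem⟩
  · refine ContinuousLinearMap.eq_of_eqOn_of_orthonormal hK (fun k hk ↦ ?_) fun n ↦ ?_
    · rw [mul_apply_eq_comp, hvK k hk, hsvK _ (huK k hk)]
      exact congr($(Unitary.star_mul_self_of_mem hu) k)
    · rw [mul_apply_eq_comp, hve, map_smul, hsve, smul_smul, mul_comm, hll, one_smul]
      rfl
  · refine ContinuousLinearMap.eq_of_eqOn_of_orthonormal hK (fun k hk ↦ ?_) fun n ↦ ?_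
    · rw [mul_apply_eq_comp, hsvK k hk, hvK _ (hsuK k hk)]
      exact congr($(Unitary.mul_star_self_of_mem hu) k)
    · rw [mul_apply_eq_comp, hsve, map_smul, hve, smul_smul, hll, one_smul]
      rfl
  · have h1 : v - 1 = (u - 1) * P + W := by
      simp only [v]; noncomm_ring
    rw [h1]
    exact (hc.comp_clm P).add hWc
  · rw [injective_iff_map_eq_zero]
    intro x hx
    have hvx : v x = x := (sub_eq_zero.1 hx).symm
    have hxK : x ∈ K := hmem 1 x (by rw [hvx, one_smul]) fun n ↦ (hl n).symm
    rw [hvK x hxK] at hvx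
    exact (injective_iff_map_eq_zero _).1 hi x (by simp [hvx])
  · refine ContinuousLinearMap.opNorm_le_bound _ (by positivity) fun x ↦ ?_
    have h1 : (u - v) x = (u - 1) (x - P x) - W x := by
      simp [hv]; abel
    have h2 : ‖x - P x‖ ≤ ‖x‖ := by
      have : x - P x = Kᗮ.starProjection x := by
        rw [Submodule.starProjection_orthogonal']; rfl
      rw [this]
      exact Kᗮ.norm_starProjection_apply_le x
    rw [h1]
    calc ‖(u - 1) (x - P x) - W x‖ ≤ ‖(u - 1) (x - P x)‖ + ‖W x‖ := norm_sub_le _ _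
      _ ≤ ε * ‖x‖ + ε * ‖x‖ := add_le_add
        ((hKε _ (hPo x)).trans (mul_le_mul_of_nonneg_left h2 hε.le)) (W.le_of_opNorm_le hWε x)
      _ = 2 * ε * ‖x‖ := by ring

theorem exists_unit_sequence_near_one {ε : ℝ} (hε : 0 < ε) (hε1 : ε < 1) {s : ℕ → ℝ}
    (hs : ∀ n, |s n| = 1) :
    ∃ lam : ℕ → ℂ, (∀ n, ‖lam n‖ = 1) ∧ (∀ n, lam n ≠ 1) ∧
      (∀ n, ‖lam n - 1‖ ≤ ε / 2 / 2 ^ n) ∧ ∀ n, 0 < s n * (lam n).im := by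
  have ht : ∀ n : ℕ, 0 < ε / 2 / 2 ^ n := fun n ↦ by positivity
  have ht1 : ∀ n : ℕ, ε / 2 / 2 ^ n < Real.pi := fun n ↦ by
    have : ε / 2 / 2 ^ n ≤ ε / 2 := div_le_self (by positivity) (one_le_pow₀ (by norm_num))
    linarith [Real.pi_gt_three]
  let lam : ℕ → ℂ := fun n ↦ Complex.exp (Complex.I * ((s n * (ε / 2 / 2 ^ n) : ℝ) : ℂ))
  have him : ∀ n, 0 < s n * (lam n).im := fun n ↦ by
    have h1 : (lam n).im = Real.sin (s n * (ε / 2 / 2 ^ n)) := by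
      simp only [lam]
      rw [mul_comm, Complex.exp_ofReal_mul_I_im]
    have h2 := Real.sin_pos_of_pos_of_lt_pi (ht n) (ht1 n)
    rw [h1]
    rcases (abs_eq one_pos.le).1 (hs n) with h | h <;> rw [h]
    · simpa using h2
    · simpa using h2
  refine ⟨lam, fun n ↦ ?_, fun n h ↦ ?_, fun n ↦ ?_, him⟩
  · simp only [lam]
    rw [mul_comm, Complex.norm_exp_ofReal_mul_I]
  · simpa [h] using him n
  · refine Real.norm_exp_I_mul_ofReal_sub_one_le.trans ?_
    rw [Real.norm_eq_abs, abs_mul, hs, one_mul, abs_of_pos (ht n)]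

end

theorem not_finiteDimensional_of_orthonormal_mem {H : Type*} [NormedAddCommGroup H]
    [InnerProductSpace ℂ H] {e : ℕ → H} (he : Orthonormal ℂ e)
    {f : ℕ → ℕ} (hf : Function.Injective f) {V : Submodule ℂ H} (hV : ∀ n, e (f n) ∈ V) :
    ¬ FiniteDimensional ℂ V := fun h ↦ by
  have h1 : LinearIndependent ℂ fun n ↦ (⟨e (f n), hV n⟩ : V) :=
    LinearIndependent.of_comp V.subtype (he.comp f hf).linearIndependent
  exact not_finite_iff_infinite.2 (inferInstanceAs (Infinite ℕ)) h1.finite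

/-- Each of `Y⁺`, `Y⁻`, `Y*` is dense in
`Y = {u ∈ U(H) : u − 1 compact, 1 − u injective}` for the operator-norm topology. -/
theorem stmt_9 (H : Type*) [NormedAddCommGroup H] [InnerProductSpace ℂ H]
    [CompleteSpace H] [TopologicalSpace.SeparableSpace H]
    (hinf : ¬ FiniteDimensional ℂ H) :
    ∀ u : H →L[ℂ] H,
      u ∈ {u : H →L[ℂ] H | u ∈ unitary (H →L[ℂ] H) ∧ IsCompactOperator ⇑(u - 1) ∧
            Function.Injective ⇑((1 : H →L[ℂ] H) - u)} →
      (u ∈ closure {u : H →L[ℂ] H | (u ∈ unitary (H →L[ℂ] H) ∧ IsCompactOperator ⇑(u - 1) ∧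
              Function.Injective ⇑((1 : H →L[ℂ] H) - u)) ∧
              FiniteDimensional ℂ (posEigenSpan u)} ∧
        u ∈ closure {u : H →L[ℂ] H | (u ∈ unitary (H →L[ℂ] H) ∧ IsCompactOperator ⇑(u - 1) ∧
              Function.Injective ⇑((1 : H →L[ℂ] H) - u)) ∧
              FiniteDimensional ℂ (negEigenSpan u)} ∧
        u ∈ closure {u : H →L[ℂ] H | (u ∈ unitary (H →L[ℂ] H) ∧ IsCompactOperator ⇑(u - 1) ∧
              Function.Injective ⇑((1 : H →L[ℂ] H) - u)) ∧
              ¬ FiniteDimensional ℂ (posEigenSpan u) ∧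
              ¬ FiniteDimensional ℂ (negEigenSpan u)}) := by
  rintro u ⟨hu, hc, hi⟩
  have key : ∀ s : ℕ → ℝ, (∀ n, |s n| = 1) → ∀ δ > 0, ∃ v : H →L[ℂ] H,
      (v ∈ unitary (H →L[ℂ] H) ∧ IsCompactOperator ⇑(v - 1) ∧
        Function.Injective ⇑((1 : H →L[ℂ] H) - v)) ∧ dist u v < δ ∧
      ∃ (e : ℕ → H) (K : Submodule ℂ H) (lam : ℕ → ℂ), Orthonormal ℂ e ∧
        FiniteDimensional ℂ K ∧ (∀ n, v (e n) = lam n • e n) ∧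
        (∀ μ x, v x = μ • x → (∀ n, μ ≠ lam n) → x ∈ K) ∧ ∀ n, 0 < s n * (lam n).im := by
    intro s hs δ hδ
    have hε : 0 < min (δ / 3) (1 / 2) := by positivity
    obtain ⟨lam, hl1, hl, hle, him⟩ := exists_unit_sequence_near_one hε
      ((min_le_right _ _).trans_lt (by norm_num)) hs
    obtain ⟨v, hv, huv, e, K, he, hK, hve, hmem⟩ :=
      exists_unitary_near_with_diagonal_part hinf hu hc hi hε hl1 hl hle
    refine ⟨v, hv, ?_, e, K, lam, he, hK, hve, hmem, him⟩
    rw [dist_eq_norm]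
    linarith [min_le_left (δ / 3) (1 / 2)]
  refine ⟨Metric.mem_closure_iff.2 fun δ hδ ↦ ?_, Metric.mem_closure_iff.2 fun δ hδ ↦ ?_,
    Metric.mem_closure_iff.2 fun δ hδ ↦ ?_⟩
  · obtain ⟨v, hv, huv, e, K, lam, he, hK, hve, hmem, him⟩ := key (fun _ ↦ -1) (by simp) δ hδ
    refine ⟨v, ⟨hv, Submodule.finiteDimensional_of_le (S₂ := K) ?_⟩, huv⟩
    refine iSup₂_le fun μ hμ x hx ↦ ?_
    refine hmem μ x (Module.End.mem_eigenspace_iff.1 hx) fun n h ↦ ?_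
    have h1 := him n
    have h2 : 0 < μ.im := hμ
    rw [h] at h2
    linarith
  · obtain ⟨v, hv, huv, e, K, lam, he, hK, hve, hmem, him⟩ := key (fun _ ↦ 1) (by simp) δ hδ
    refine ⟨v, ⟨hv, Submodule.finiteDimensional_of_le (S₂ := K) ?_⟩, huv⟩
    refine iSup₂_le fun μ hμ x hx ↦ ?_
    refine hmem μ x (Module.End.mem_eigenspace_iff.1 hx) fun n h ↦ ?_
    have h1 := him n
    have h2 : μ.im < 0 := hμ
    rw [h] at h2
    linarith
  · obtain ⟨v, hv, huv, e, K, lam, he, hK, hve, hmem, him⟩ :=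
      key (fun n ↦ (-1) ^ n) (by simp) δ hδ
    refine ⟨v, ⟨hv, ?_, ?_⟩, huv⟩
    · refine not_finiteDimensional_of_orthonormal_mem he (f := fun n ↦ 2 * n)
        (fun a b h ↦ by simpa using h) fun n ↦ ?_
      refine Submodule.mem_iSup_of_mem (lam (2 * n)) (Submodule.mem_iSup_of_mem ?_
        (Module.End.mem_eigenspace_iff.2 (hve _)))
      simpa [pow_mul] using him (2 * n)
    · refine not_finiteDimensional_of_orthonormal_mem he (f := fun n ↦ 2 * n + 1)
        (fun a b h ↦ by simpa using h) fun n ↦ ?_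
      refine Submodule.mem_iSup_of_mem (lam (2 * n + 1)) (Submodule.mem_iSup_of_mem ?_
        (Module.End.mem_eigenspace_iff.2 (hve _)))
      simpa [pow_mul, pow_succ] using him (2 * n + 1)
end

section
/- The space Z = {a ∈ B(H) : a is self-adjoint and injective}, with the operator-norm topology, is contractible. -/
open MeasureTheory AddCircle
open scoped unitInterval

/-- Conjugation by a unitary identifies the injective self-adjoint operators on two Hilbert
spaces. -/
noncomputable def injectiveSelfAdjointHomeomorph {H K : Type*}
    [NormedAddCommGroup H] [InnerProductSpace ℂ H]
    [CompleteSpace H] [NormedAddCommGroup K] [InnerProductSpace ℂ K] [CompleteSpace K]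
    (e : H ≃ₗᵢ[ℂ] K) :
    {a : H →L[ℂ] H // IsSelfAdjoint a ∧ Function.Injective ⇑a} ≃ₜ
      {a : K →L[ℂ] K // IsSelfAdjoint a ∧ Function.Injective ⇑a} :=
  Homeomorph.subtype
    { e.conjStarAlgEquiv.toEquiv with
      continuous_toFun := StarAlgEquiv.isometry e.conjStarAlgEquiv |>.continuous
      continuous_invFun := StarAlgEquiv.isometry e.conjStarAlgEquiv.symm |>.continuous }
    fun a => by
      have hinj : Function.Injective ⇑(e.conjStarAlgEquiv a) ↔ Function.Injective ⇑a :=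
        (e.injective.of_comp_iff _).trans (Function.Injective.of_comp_iff' _ e.symm.bijective)
      have hsa : IsSelfAdjoint (e.conjStarAlgEquiv a) ↔ IsSelfAdjoint a := by
        rw [isSelfAdjoint_iff, isSelfAdjoint_iff, ← map_star]
        exact (EquivLike.injective e.conjStarAlgEquiv).eq_iff
      exact and_congr hsa.symm hinj.symm

section Abstract

variable {H : Type*} [NormedAddCommGroup H] [InnerProductSpace ℂ H]

theorem injective_one_sub_smul_one_add_smul {T : H →L[ℂ] H} (hT : T.IsPositive)
    (hTinj : ∀ x, T x = 0 → x = 0) (s : I) (x : H)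
    (hx : ((1 - (s : ℝ)) • (1 : H →L[ℂ] H) + (s : ℝ) • T) x = 0) : x = 0 := by
  rcases eq_or_ne (s : ℝ) 1 with hs | hs
  · exact hTinj x (by simpa [hs] using hx)
  · have hs1 : 0 < 1 - (s : ℝ) := sub_pos.2 (lt_of_le_of_ne s.2.2 hs)
    have h := congrArg (fun y => RCLike.re (inner ℂ y x)) hx
    have hp := hT.re_inner_nonneg_left x
    simp only [add_apply, smul_apply, one_apply_eq_self, inner_add_left, inner_zero_left,
      map_add, map_zero, inner_smul_left_eq_smul, RCLike.smul_re, inner_self_eq_norm_sq] at h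
    have h0 : ‖x‖ ^ 2 ≤ 0 := by
      nlinarith [mul_nonneg s.2.1 hp, sq_nonneg ‖x‖]
    simpa using le_antisymm h0 (sq_nonneg _)

variable [CompleteSpace H]

theorem isSelfAdjoint_and_injective_congruence {a S : H →L[ℂ] H} (ha : IsSelfAdjoint a)
    (hainj : Function.Injective a) (hS : IsSelfAdjoint S) (hSinj : ∀ x, S x = 0 → x = 0) :
    IsSelfAdjoint (S * a * S) ∧ Function.Injective ⇑(S * a * S) := by
  refine ⟨by simpa [hS.star_eq] using ha.conjugate S, ?_⟩
  have hS' : Function.Injective S := (injective_iff_map_eq_zero S).2 hSinj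
  exact hS'.comp (hainj.comp hS')

theorem isSelfAdjoint_and_injective_compression {a T d c : H →L[ℂ] H} (ha : IsSelfAdjoint a)
    (hainj : Function.Injective a) (hT : IsSelfAdjoint T) (hd : IsSelfAdjoint d)
    (hc : IsSelfAdjoint c) (hdc : d * c = 0) (hker : ∀ x, d x = 0 → c x = 0 → x = 0)
    (hdT : d = 0 ∨ ∀ x, d (T x) = 0 → x = 0) :
    IsSelfAdjoint (d * (T * a * T) * d + c) ∧
      Function.Injective ⇑(d * (T * a * T) * d + c) := by
  have hTaT : IsSelfAdjoint (T * a * T) := by simpa [hT.star_eq] using ha.conjugate T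
  refine ⟨(by simpa [hd.star_eq] using hTaT.conjugate d : IsSelfAdjoint _).add hc, ?_⟩
  rw [injective_iff_map_eq_zero]
  intro x hx
  rcases hdT with rfl | hdT
  · exact hker x (by simp) (by simpa using hx)
  have hadj : ∀ u v : H, inner ℂ (d u) v = inner ℂ u (d v) := fun u v => by
    rw [← ContinuousLinearMap.adjoint_inner_right, hd.adjoint_eq]
  have hadjT : ∀ u v : H, inner ℂ (T u) v = inner ℂ u (T v) := fun u v => by
    rw [← ContinuousLinearMap.adjoint_inner_right, hT.adjoint_eq]
  have hdcx : d (c x) = 0 := DFunLike.congr_fun hdc x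
  have hx' : d (T (a (T (d x)))) + c x = 0 := hx
  have h1 : d (T (a (T (d x)))) = 0 := by
    have h2 : d (d (T (a (T (d x))))) = 0 := by
      have := congrArg d hx'
      rwa [map_add, hdcx, add_zero, map_zero] at this
    rw [← inner_self_eq_zero (𝕜 := ℂ), hadj, h2, inner_zero_right]
  have hT0 : ∀ y, T y = 0 → y = 0 := fun y hy => hdT y (by rw [hy, map_zero])
  have h3 : T (d x) = 0 := hainj (by rw [hdT _ h1, map_zero])
  rw [h1, zero_add] at hx'
  exact hker x (hT0 _ h3) hx'

theorem contractibleSpace_injective_selfAdjoint_of_paths {T : H →L[ℂ] H} (hT : T.IsPositive)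
    {d c : I → H →L[ℂ] H} (hd : Continuous d) (hc : Continuous c)
    (hdsa : ∀ t, IsSelfAdjoint (d t)) (hcsa : ∀ t, IsSelfAdjoint (c t))
    (hd0 : d 0 = 0) (hd1 : d 1 = 1) (hc1 : c 1 = 0) (hdc : ∀ t, d t * c t = 0)
    (hker : ∀ t x, d t x = 0 → c t x = 0 → x = 0)
    (hdT : ∀ t ≠ 0, ∀ x, d t (T x) = 0 → x = 0) :
    ContractibleSpace {a : H →L[ℂ] H // IsSelfAdjoint a ∧ Function.Injective ⇑a} := by
  have hTsa : IsSelfAdjoint T := hT.isSelfAdjoint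
  have hTinj : ∀ x, T x = 0 → x = 0 := fun x hx => hdT 1 one_ne_zero x (by simp [hx])
  have hdT' : ∀ t, d t = 0 ∨ ∀ x, d t (T x) = 0 → x = 0 := fun t => by
    rcases eq_or_ne t 0 with rfl | ht
    · exact Or.inl hd0
    · exact Or.inr (hdT t ht)
  have hSsa : ∀ s : I, IsSelfAdjoint ((1 - (s : ℝ)) • (1 : H →L[ℂ] H) + (s : ℝ) • T) := fun s =>
    ((IsSelfAdjoint.all _).smul (IsSelfAdjoint.one _)).add ((IsSelfAdjoint.all _).smul hTsa)
  let R : C({a : H →L[ℂ] H // IsSelfAdjoint a ∧ Function.Injective ⇑a},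
      {a : H →L[ℂ] H // IsSelfAdjoint a ∧ Function.Injective ⇑a}) :=
    ⟨fun a => ⟨T * a * T, isSelfAdjoint_and_injective_congruence a.2.1 a.2.2 hTsa hTinj⟩,
      by fun_prop⟩
  have hc0 : IsSelfAdjoint (c 0) ∧ Function.Injective ⇑(c 0) :=
    ⟨hcsa 0, (injective_iff_map_eq_zero _).2 fun x hx => hker 0 x (by simp [hd0]) hx⟩
  have F : ContinuousMap.Homotopy (ContinuousMap.id _) R :=
    { toFun := fun p =>
        ⟨((1 - (p.1 : ℝ)) • (1 : H →L[ℂ] H) + (p.1 : ℝ) • T) * p.2 *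
            ((1 - (p.1 : ℝ)) • (1 : H →L[ℂ] H) + (p.1 : ℝ) • T),
          isSelfAdjoint_and_injective_congruence p.2.2.1 p.2.2.2 (hSsa p.1)
            (injective_one_sub_smul_one_add_smul hT hTinj p.1)⟩
      continuous_toFun := by fun_prop
      map_zero_left := fun a => Subtype.ext (by simp)
      map_one_left := fun a => Subtype.ext (by simp [R]) }
  have G : ContinuousMap.Homotopy (ContinuousMap.const _ ⟨c 0, hc0⟩) R :=
    { toFun := fun p =>
        ⟨d p.1 * (T * p.2 * T) * d p.1 + c p.1,
          isSelfAdjoint_and_injective_compression p.2.2.1 p.2.2.2 hTsa (hdsa _) (hcsa _)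
            (hdc _) (hker _) (hdT' _)⟩
      continuous_toFun := by fun_prop
      map_zero_left := fun a => Subtype.ext (by simp [hd0])
      map_one_left := fun a => Subtype.ext (by simp [R, hd1, hc1]) }
  exact (contractible_iff_id_nullhomotopic _).2 ⟨_, ⟨F.trans G.symm⟩⟩

end Abstract

theorem Orthonormal.countable_of_separableSpace {𝕜 E ι : Type*} [RCLike 𝕜] [NormedAddCommGroup E]
    [InnerProductSpace 𝕜 E] [TopologicalSpace.SeparableSpace E] {v : ι → E}
    (hv : Orthonormal 𝕜 v) : Countable ι := by
  have hd : ∀ i j, i ≠ j → 1 ≤ dist (v i) (v j) := fun i j hij => by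
    have h := norm_sub_sq (𝕜 := 𝕜) (v i) (v j)
    rw [hv.2 hij, hv.1, hv.1, map_zero] at h
    rw [dist_eq_norm]
    nlinarith [norm_nonneg (v i - v j)]
  refine Set.countable_univ_iff.1 (Set.PairwiseDisjoint.countable_of_isOpen
    (s := fun i => Metric.ball (v i) (1 / 2))
    (a := Set.univ) (fun i _ j _ hij => Metric.ball_disjoint_ball (by linarith [hd i j hij]))
    (fun i _ => Metric.isOpen_ball)
    (fun i _ => Metric.nonempty_ball.2 (by norm_num)))

theorem nonempty_linearIsometryEquiv_of_hilbertBasis {𝕜 H K ι : Type*} [RCLike 𝕜]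
    [NormedAddCommGroup H] [InnerProductSpace 𝕜 H] [CompleteSpace H]
    [TopologicalSpace.SeparableSpace H] (hinf : ¬ FiniteDimensional 𝕜 H)
    [NormedAddCommGroup K] [InnerProductSpace 𝕜 K]
    [Countable ι] [Infinite ι] (b : HilbertBasis ι 𝕜 K) : Nonempty (H ≃ₗᵢ[𝕜] K) := by
  obtain ⟨w, b', -⟩ := exists_hilbertBasis 𝕜 H
  have : Countable w := b'.orthonormal.countable_of_separableSpace
  have : Infinite w := by
    by_contra hfin
    rw [not_infinite_iff_finite] at hfin
    refine hinf ?_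
    have := Fintype.ofFinite w
    exact b'.toOrthonormalBasis.toBasis.finiteDimensional_of_finite
  obtain ⟨e⟩ := nonempty_equiv_of_countable (α := ι) (β := w)
  let b'' : HilbertBasis ι 𝕜 H := HilbertBasis.mk (b'.orthonormal.comp e e.injective) (by
    rw [e.surjective.range_comp, b'.dense_span])
  exact ⟨b''.repr.trans b.repr.symm⟩

theorem ContinuousLinearMap.IsPositive.of_hasSum {H ι : Type*} [NormedAddCommGroup H]
    [InnerProductSpace ℂ H] [CompleteSpace H] {S : ι → H →L[ℂ] H} {T : H →L[ℂ] H}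
    (hS : ∀ i, (S i).IsPositive) (hT : HasSum S T) : T.IsPositive := by
  have hsa : IsSelfAdjoint T := hT.star.unique (by
    simpa only [(hS _).isSelfAdjoint.star_eq] using hT)
  refine ⟨ContinuousLinearMap.isSelfAdjoint_iff_isSymmetric.1 hsa, fun x => ?_⟩
  have h : HasSum (fun i => (S i).reApplyInnerSelf x) (T.reApplyInnerSelf x) := by
    simp only [ContinuousLinearMap.reApplyInnerSelf_apply, ← inner_re_symm x]
    exact ((hT.mapL (ContinuousLinearMap.apply ℂ H x)).mapL (innerSL ℂ x)).mapL
      (RCLike.reCLM : ℂ →L[ℝ] ℝ)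
  exact h.nonneg fun i => (hS i).2 x

theorem isPositive_smul_rankOne_self {H : Type*} [NormedAddCommGroup H] [InnerProductSpace ℂ H]
    {r : ℝ} (hr : 0 ≤ r) (x : H) : (r • InnerProductSpace.rankOne ℂ x x).IsPositive := by
  rw [← Complex.coe_smul]
  exact (InnerProductSpace.isPositive_rankOne_self x).smul_of_nonneg (by simpa using hr)

section Multiplication

variable {X : Type*} [TopologicalSpace X] [CompactSpace X] [MeasurableSpace X] [BorelSpace X]
  (μ : Measure X) [IsFiniteMeasure μ]

/-- The action of continuous functions on `L²` by multiplication. -/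
noncomputable def mulL2 : C(X, ℂ) →L[ℂ] (Lp ℂ 2 μ →L[ℂ] Lp ℂ 2 μ) :=
  ((ContinuousLinearMap.mul ℂ ℂ).holderL μ ⊤ 2 2).comp (ContinuousMap.toLp ⊤ μ ℂ)

variable {μ}

theorem coeFn_mulL2 (g : C(X, ℂ)) (f : Lp ℂ 2 μ) : mulL2 μ g f =ᵐ[μ] fun x => g x * f x := by
  have h := (ContinuousLinearMap.mul ℂ ℂ).coeFn_holder (r := 2) (ContinuousMap.toLp ⊤ μ ℂ g) f
  filter_upwards [h, ContinuousMap.coeFn_toLp (p := ⊤) (𝕜 := ℂ) μ g] with x hx hx'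
  rw [hx'] at hx
  exact hx

theorem mulL2_one : mulL2 μ 1 = 1 := by
  ext1 f
  apply Lp.ext
  filter_upwards [coeFn_mulL2 1 f] with x hx
  simpa using hx

theorem mulL2_mul (g h : C(X, ℂ)) : mulL2 μ (g * h) = mulL2 μ g * mulL2 μ h := by
  ext1 f
  apply Lp.ext
  filter_upwards [coeFn_mulL2 (g * h) f, coeFn_mulL2 g (mulL2 μ h f), coeFn_mulL2 h f]
    with x h1 h2 h3
  rw [h1, mul_apply_eq_comp, h2, h3, ContinuousMap.mul_apply, mul_assoc]

theorem mulL2_toLp (g h : C(X, ℂ)) :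
    mulL2 μ g (ContinuousMap.toLp 2 μ ℂ h) = ContinuousMap.toLp 2 μ ℂ (g * h) := by
  apply Lp.ext
  filter_upwards [coeFn_mulL2 g (ContinuousMap.toLp 2 μ ℂ h),
    ContinuousMap.coeFn_toLp (p := 2) (𝕜 := ℂ) μ h,
    ContinuousMap.coeFn_toLp (p := 2) (𝕜 := ℂ) μ (g * h)] with x h1 h2 h3
  rw [h1, h2, h3, ContinuousMap.mul_apply]

theorem isSelfAdjoint_mulL2 {g : C(X, ℂ)} (hg : star g = g) : IsSelfAdjoint (mulL2 μ g) := by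
  rw [ContinuousLinearMap.isSelfAdjoint_iff_isSymmetric]
  intro f h
  rw [ContinuousLinearMap.coe_coe, L2.inner_def, L2.inner_def]
  apply integral_congr_ae
  filter_upwards [coeFn_mulL2 g f, coeFn_mulL2 g h] with x h1 h2
  have hx : starRingEnd ℂ (g x) = g x := DFunLike.congr_fun hg x
  rw [h1, h2]
  simp only [RCLike.inner_apply, map_mul, hx]
  ring

theorem eq_zero_of_mulL2_eq_zero {g h : C(X, ℂ)} (hgh : ∀ᵐ x ∂μ, g x ≠ 0 ∨ h x ≠ 0)
    {f : Lp ℂ 2 μ} (hg : mulL2 μ g f = 0) (hh : mulL2 μ h f = 0) : f = 0 := by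
  apply Lp.ext
  have h1 := coeFn_mulL2 g f
  have h2 := coeFn_mulL2 h f
  rw [hg] at h1
  rw [hh] at h2
  filter_upwards [hgh, h1, h2, Lp.coeFn_zero ℂ 2 μ] with x hx h1 h2 h0
  rw [h0, Pi.zero_apply] at h1 h2 ⊢
  rcases hx with hx | hx
  · exact (mul_eq_zero.1 h1.symm).resolve_left hx
  · exact (mul_eq_zero.1 h2.symm).resolve_left hx

end Multiplication

section Smoothing

/-- The coefficients `exp (-2π|n|)` of the smoothing operator. -/
noncomputable def smoothingCoeff (n : ℤ) : ℝ := Real.exp (-(2 * Real.pi * |(n : ℝ)|))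

theorem summable_exp_neg_mul_abs {a : ℝ} (ha : 0 < a) :
    Summable fun n : ℤ => Real.exp (-(a * |(n : ℝ)|)) := by
  have h : Summable fun n : ℕ => Real.exp (-(a * n)) := by
    simpa [mul_comm] using Real.summable_exp_nat_mul_iff.2 (neg_lt_zero.2 ha)
  refine Summable.of_nat_of_neg (by simpa using h) (by simpa using h)

theorem smoothingCoeff_pos (n : ℤ) : 0 < smoothingCoeff n := Real.exp_pos _

theorem summable_smoothingCoeff : Summable smoothingCoeff :=
  summable_exp_neg_mul_abs Real.two_pi_pos

/-- The positive operator on `L²` of the circle whose eigenvectors are the Fourier monomials, with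
eigenvalues `exp (-2π|n|)`. -/
noncomputable def smoothing :
    Lp ℂ 2 (haarAddCircle (T := 1)) →L[ℂ] Lp ℂ 2 (haarAddCircle (T := 1)) :=
  ∑' n : ℤ, smoothingCoeff n • InnerProductSpace.rankOne ℂ (fourierLp 2 n) (fourierLp 2 n)

theorem norm_fourierLp_two (n : ℤ) : ‖fourierLp (T := 1) 2 n‖ = 1 := orthonormal_fourier.1 n

theorem norm_inner_fourierLp_le (f : Lp ℂ 2 (haarAddCircle (T := 1))) (n : ℤ) :
    ‖inner ℂ (fourierLp 2 n) f‖ ≤ ‖f‖ := by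
  simpa [norm_fourierLp_two] using norm_inner_le_norm (𝕜 := ℂ) (fourierLp (T := 1) 2 n) f

theorem hasSum_smoothing :
    HasSum (fun n : ℤ => smoothingCoeff n •
      InnerProductSpace.rankOne ℂ (fourierLp (T := 1) 2 n) (fourierLp 2 n)) smoothing := by
  refine Summable.hasSum (.of_norm ?_)
  simpa [norm_smul, norm_fourierLp_two] using summable_smoothingCoeff.abs

theorem hasSum_smoothing_apply (f : Lp ℂ 2 (haarAddCircle (T := 1))) :
    HasSum (fun n : ℤ => smoothingCoeff n • (inner ℂ (fourierLp 2 n) f • fourierLp 2 n))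
      (smoothing f) :=
  hasSum_smoothing.mapL (ContinuousLinearMap.apply ℂ _ f)

theorem isPositive_smoothing : smoothing.IsPositive := by
  refine .of_hasSum (fun n => ?_) hasSum_smoothing
  exact isPositive_smul_rankOne_self (smoothingCoeff_pos n).le _

theorem inner_fourierLp_smoothing (f : Lp ℂ 2 (haarAddCircle (T := 1))) (n : ℤ) :
    inner ℂ (fourierLp 2 n) (smoothing f) = smoothingCoeff n • inner ℂ (fourierLp 2 n) f := by
  have h := (hasSum_smoothing_apply f).mapL (innerSL ℂ (fourierLp 2 n))
  refine h.unique ?_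
  have h' := hasSum_single (f := fun m => innerSL ℂ (fourierLp (T := 1) 2 n)
      (smoothingCoeff m • (inner ℂ (fourierLp 2 m) f • fourierLp 2 m))) n fun m hm => by
    simp [orthonormal_fourier.2 hm.symm]
  simpa [norm_fourierLp_two, inner_self_eq_norm_sq_to_K] using h'

theorem eq_zero_of_smoothing_eq_zero {f : Lp ℂ 2 (haarAddCircle (T := 1))}
    (hf : smoothing f = 0) : f = 0 := by
  apply fourierBasis.repr.injective
  ext n
  have h := inner_fourierLp_smoothing f n
  rw [hf, inner_zero_right] at h
  have h0 := (smul_eq_zero.1 h.symm).resolve_left (smoothingCoeff_pos n).ne'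
  rw [HilbertBasis.repr_apply_apply, coe_fourierBasis, h0]
  simp

/-- The sum of the Fourier series of `smoothing f`, as a function of a complex variable. -/
noncomputable def smoothingExtension (f : Lp ℂ 2 (haarAddCircle (T := 1))) (z : ℂ) : ℂ :=
  ∑' n : ℤ, (smoothingCoeff n * inner ℂ (fourierLp 2 n) f) *
    Complex.exp (2 * Real.pi * Complex.I * n * z)

theorem differentiableOn_smoothingExtension (f : Lp ℂ 2 (haarAddCircle (T := 1))) :
    DifferentiableOn ℂ (smoothingExtension f) {z | |z.im| < 1 / 2} := by
  refine Complex.differentiableOn_tsum_of_summable_norm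
    (u := fun n : ℤ => ‖f‖ * Real.exp (-(Real.pi * |(n : ℝ)|)))
    ((summable_exp_neg_mul_abs Real.pi_pos).mul_left _) (fun n => by fun_prop)
    (isOpen_lt (by fun_prop) continuous_const) fun n z hz => ?_
  have h2 : smoothingCoeff n * ‖Complex.exp (2 * Real.pi * Complex.I * n * z)‖ ≤
      Real.exp (-(Real.pi * |(n : ℝ)|)) := by
    rw [Complex.norm_exp, smoothingCoeff, ← Real.exp_add, Real.exp_le_exp]
    have h3 : (2 * Real.pi * Complex.I * n * z : ℂ).re = 2 * Real.pi * (-(n * z.im)) := by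
      simp [mul_assoc]
    have h4 : -((n : ℝ) * z.im) ≤ |(n : ℝ)| * (1 / 2) := by
      refine (neg_le_abs _).trans ?_
      rw [abs_mul]
      exact mul_le_mul_of_nonneg_left (le_of_lt hz) (abs_nonneg _)
    rw [h3]
    nlinarith [mul_le_mul_of_nonneg_left h4 Real.two_pi_pos.le]
  rw [norm_mul, norm_mul, Complex.norm_real, Real.norm_of_nonneg (smoothingCoeff_pos n).le]
  calc smoothingCoeff n * ‖inner ℂ (fourierLp (T := 1) 2 n) f‖ *
        ‖Complex.exp (2 * Real.pi * Complex.I * n * z)‖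
      = ‖inner ℂ (fourierLp (T := 1) 2 n) f‖ *
        (smoothingCoeff n * ‖Complex.exp (2 * Real.pi * Complex.I * n * z)‖) := by ring
    _ ≤ _ := mul_le_mul (norm_inner_fourierLp_le f n) h2
      (mul_nonneg (smoothingCoeff_pos n).le (norm_nonneg _)) (norm_nonneg _)

theorem exists_toLp_eq_smoothing (f : Lp ℂ 2 (haarAddCircle (T := 1))) :
    ∃ G : C(AddCircle (1 : ℝ), ℂ), ContinuousMap.toLp 2 haarAddCircle ℂ G = smoothing f ∧
      ∀ x : ℝ, G (x : AddCircle (1 : ℝ)) = smoothingExtension f x := by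
  have hs : Summable fun n : ℤ =>
      smoothingCoeff n • (inner ℂ (fourierLp (T := 1) 2 n) f • fourier (T := 1) n) := by
    refine .of_norm_bounded (summable_smoothingCoeff.mul_right ‖f‖) fun n => ?_
    rw [norm_smul, norm_smul, fourier_norm, mul_one, Real.norm_of_nonneg (smoothingCoeff_pos n).le]
    exact mul_le_mul_of_nonneg_left (norm_inner_fourierLp_le f n) (smoothingCoeff_pos n).le
  refine ⟨_, (hs.hasSum.mapL (ContinuousMap.toLp 2 haarAddCircle ℂ)).unique ?_, fun x => ?_⟩
  · convert! hasSum_smoothing_apply f using 2 with n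
  · refine (hs.hasSum.mapL (ContinuousMap.evalCLM ℂ (x : AddCircle (1 : ℝ)))).tsum_eq.symm.trans ?_
    refine tsum_congr fun n => ?_
    simp [mul_assoc]

theorem eq_zero_of_mulL2_smoothing_eq_zero {g : C(AddCircle (1 : ℝ), ℂ)} {x₀ : ℝ}
    (hg : g (x₀ : AddCircle (1 : ℝ)) ≠ 0) {f : Lp ℂ 2 (haarAddCircle (T := 1))}
    (hf : mulL2 haarAddCircle g (smoothing f) = 0) : f = 0 := by
  obtain ⟨G, hG, hGext⟩ := exists_toLp_eq_smoothing f
  have hgG : g * G = 0 := by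
    rw [← hG, mulL2_toLp] at hf
    exact ContinuousMap.toLp_injective (p := 2) (𝕜 := ℂ) haarAddCircle (by rw [hf, map_zero])
  have hzero : ∀ᶠ x : ℝ in nhds x₀, smoothingExtension f x = 0 := by
    have hcont : Continuous fun x : ℝ => g (x : AddCircle (1 : ℝ)) := by fun_prop
    filter_upwards [hcont.continuousAt.eventually_ne hg] with x hx
    rw [← hGext]
    exact (mul_eq_zero.1 (DFunLike.congr_fun hgG (x : AddCircle (1 : ℝ)))).resolve_left hx
  have hopen : IsOpen {z : ℂ | |z.im| < 1 / 2} := isOpen_lt (by fun_prop) continuous_const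
  have hconv : Convex ℝ {z : ℂ | |z.im| < 1 / 2} := by
    have : {z : ℂ | |z.im| < 1 / 2} = Complex.imLm ⁻¹' Metric.ball 0 (1 / 2) := by
      ext z; simp
    rw [this]
    exact (convex_ball _ _).linear_preimage _
  have hmem : ∀ x : ℝ, (x : ℂ) ∈ {z : ℂ | |z.im| < 1 / 2} := fun x => by simp
  have hfreq : ∃ᶠ z in nhdsWithin (x₀ : ℂ) {(x₀ : ℂ)}ᶜ, smoothingExtension f z = 0 := by
    have htend : Filter.Tendsto (fun x : ℝ => (x : ℂ)) (nhdsWithin x₀ {x₀}ᶜ)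
        (nhdsWithin (x₀ : ℂ) {(x₀ : ℂ)}ᶜ) :=
      Complex.continuous_ofReal.continuousWithinAt.tendsto_nhdsWithin fun x hx => by
        simpa using hx
    exact htend.frequently (hzero.filter_mono nhdsWithin_le_nhds).frequently
  have hall := ((differentiableOn_smoothingExtension f).analyticOnNhd
    hopen).eqOn_zero_of_preconnected_of_frequently_eq_zero hconv.isPreconnected (hmem x₀) hfreq
  have hG0 : G = 0 := by
    ext x
    obtain ⟨x, rfl⟩ := QuotientAddGroup.mk_surjective x
    exact (hGext x).trans (hall (hmem x))
  exact eq_zero_of_smoothing_eq_zero (by rw [← hG, hG0, map_zero])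

end Smoothing

section Cutoffs

/-- The function `min 1 (max 0 (2t - ‖x‖))` on the circle. -/
noncomputable def innerCutoff : C(I, C(AddCircle (1 : ℝ), ℂ)) :=
  ContinuousMap.curry ⟨fun p => ((min 1 (max 0 (2 * (p.1 : ℝ) - ‖p.2‖)) : ℝ) : ℂ), by fun_prop⟩

/-- The function `max 0 (‖x‖ - 2t)` on the circle. -/
noncomputable def outerCutoff : C(I, C(AddCircle (1 : ℝ), ℂ)) :=
  ContinuousMap.curry ⟨fun p => ((max 0 (‖p.2‖ - 2 * (p.1 : ℝ)) : ℝ) : ℂ), by fun_prop⟩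

theorem innerCutoff_apply (t : I) (x : AddCircle (1 : ℝ)) :
    innerCutoff t x = ((min 1 (max 0 (2 * (t : ℝ) - ‖x‖)) : ℝ) : ℂ) := rfl

theorem outerCutoff_apply (t : I) (x : AddCircle (1 : ℝ)) :
    outerCutoff t x = ((max 0 (‖x‖ - 2 * (t : ℝ)) : ℝ) : ℂ) := rfl

theorem norm_le_half (x : AddCircle (1 : ℝ)) : ‖x‖ ≤ 1 / 2 := by
  simpa using AddCircle.norm_le_half_period (p := 1) (x := x) one_ne_zero

theorem ae_innerCutoff_ne_zero_or_outerCutoff_ne_zero (t : I) :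
    ∀ᵐ x ∂haarAddCircle, innerCutoff t x ≠ 0 ∨ outerCutoff t x ≠ 0 := by
  have h : Metric.closedBall (0 : AddCircle (1 : ℝ)) (2 * t) =ᵐ[haarAddCircle]
      Metric.ball 0 (2 * t) := by
    have := AddCircle.closedBall_ae_eq_ball (T := 1) (x := 0) (ε := 2 * t)
    rwa [volume_eq_smul_haarAddCircle, ENNReal.ofReal_one, one_smul] at this
  filter_upwards [h.mem_iff] with x hx
  rw [mem_closedBall_zero_iff, mem_ball_zero_iff] at hx
  simp only [innerCutoff_apply, outerCutoff_apply, ne_eq, Complex.ofReal_eq_zero]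
  rcases le_or_gt ‖x‖ (2 * t) with h1 | h1
  · exact Or.inl (lt_min one_pos (lt_max_of_lt_right (sub_pos.2 (hx.1 h1)))).ne'
  · exact Or.inr (lt_max_of_lt_right (sub_pos.2 h1)).ne'

theorem contractibleSpace_injective_selfAdjoint_L2_addCircle :
    ContractibleSpace {a : Lp ℂ 2 (haarAddCircle (T := 1)) →L[ℂ] Lp ℂ 2 (haarAddCircle (T := 1)) //
      IsSelfAdjoint a ∧ Function.Injective ⇑a} := by
  refine contractibleSpace_injective_selfAdjoint_of_paths isPositive_smoothing
    (d := fun t => mulL2 haarAddCircle (innerCutoff t))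
    (c := fun t => mulL2 haarAddCircle (outerCutoff t)) (by fun_prop) (by fun_prop)
    (fun t => isSelfAdjoint_mulL2 ?_) (fun t => isSelfAdjoint_mulL2 ?_) ?_ ?_ ?_ (fun t => ?_)
    (fun t f => eq_zero_of_mulL2_eq_zero (ae_innerCutoff_ne_zero_or_outerCutoff_ne_zero t))
    fun t ht f => eq_zero_of_mulL2_smoothing_eq_zero (x₀ := 0) ?_
  · ext x
    exact Complex.conj_ofReal _
  · ext x
    exact Complex.conj_ofReal _
  · have h : innerCutoff 0 = 0 := by
      ext x
      simp [innerCutoff_apply]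
    rw [h, map_zero]
  · have h : innerCutoff 1 = 1 := by
      ext x
      have : 1 ≤ max 0 (2 * ((1 : I) : ℝ) - ‖x‖) :=
        le_max_of_le_right (by norm_num; linarith [norm_le_half x])
      rw [innerCutoff_apply, min_eq_left this]
      simp
    rw [h, mulL2_one]
  · have h : outerCutoff 1 = 0 := by
      ext x
      have : ‖x‖ - 2 * ((1 : I) : ℝ) ≤ 0 := by norm_num; linarith [norm_le_half x]
      rw [outerCutoff_apply, max_eq_left this]
      simp
    rw [h, map_zero]
  · have h : innerCutoff t * outerCutoff t = 0 := by
      ext x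
      rw [ContinuousMap.mul_apply, innerCutoff_apply, outerCutoff_apply]
      rcases le_total ‖x‖ (2 * t) with hx | hx
      · rw [max_eq_left (sub_nonpos.2 hx)]
        simp
      · rw [max_eq_left (sub_nonpos.2 hx)]
        simp
    rw [← mulL2_mul, h, map_zero]
  · have h0 : 0 < (t : ℝ) := lt_of_le_of_ne t.2.1 fun h => ht (Subtype.ext h.symm)
    have h : 0 < min 1 (max 0 (2 * (t : ℝ) - ‖((0 : ℝ) : AddCircle (1 : ℝ))‖)) :=
      lt_min one_pos (lt_max_of_lt_right (by simpa using h0))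
    exact Complex.ofReal_ne_zero.2 h.ne'

end Cutoffs

/-- The space `Z = {a ∈ B(H) : a self-adjoint and injective}` with the norm topology is
contractible. -/
theorem stmt_10 (H : Type*) [NormedAddCommGroup H] [InnerProductSpace ℂ H]
    [CompleteSpace H] [TopologicalSpace.SeparableSpace H]
    (hinf : ¬ FiniteDimensional ℂ H) :
    ContractibleSpace {a : H →L[ℂ] H // IsSelfAdjoint a ∧ Function.Injective ⇑a} := by
  obtain ⟨e⟩ := nonempty_linearIsometryEquiv_of_hilbertBasis hinf (fourierBasis (T := 1))
  have := contractibleSpace_injective_selfAdjoint_L2_addCircle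
  exact (injectiveSelfAdjointHomeomorph e).contractibleSpace
end

section
/- The space Z_K = {a ∈ B(H) : a is compact, self-adjoint, and injective}, with the operator-norm topology, is contractible. -/
open InnerProductSpace Filter Topology in
/-- If a power series `∑ aⱼ zʲ⁺¹` with bounded coefficients decays faster than every power of `z`
along `z = 2⁻¹, 2⁻², …`, then all its coefficients vanish. -/
theorem coeff_eq_zero_of_superpolynomial_decay {a : ℕ → ℂ} {C D : ℝ} (ha : ∀ j, ‖a j‖ ≤ C)
    {g : ℕ → ℂ} (hg : ∀ m, HasSum (fun j => a j * ((1 / 2 : ℂ) ^ (m + 1)) ^ (j + 1)) (g m))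
    (hD : ∀ m, ‖g m‖ ≤ D * ((1 / 2 : ℝ) ^ (m + 1)) ^ (m + 1)) (N : ℕ) : a N = 0 := by
  have hC : 0 ≤ C := (norm_nonneg _).trans (ha 0)
  have hD0 : 0 ≤ D := by
    have := (norm_nonneg _).trans (hD 0)
    norm_num at this
    linarith
  induction N using Nat.strong_induction_on with
  | _ N ih =>
    have bound : ∀ m, N + 1 ≤ m → ‖a N‖ ≤ (D + 2 * C) * (1 / 2 : ℝ) ^ (m + 1) := by
      intro m hm
      set z : ℝ := (1 / 2 : ℝ) ^ (m + 1) with hz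
      have hz0 : 0 < z := by positivity
      have hz1 : z ≤ 1 / 2 := by
        rw [hz]
        exact pow_le_of_le_one (by norm_num) (by norm_num) (by omega)
      have hzc : ((1 / 2 : ℂ) ^ (m + 1)) = (z : ℂ) := by rw [hz]; push_cast; rfl
      have h1 := (hasSum_nat_add_iff' (N + 1)).2 (hg m)
      rw [Finset.sum_range_succ, Finset.sum_eq_zero, zero_add, hzc] at h1
      · have hgeo : HasSum (fun j : ℕ => C * z ^ (N + 2) * z ^ j) (C * z ^ (N + 2) * (1 - z)⁻¹) :=
          (hasSum_geometric_of_lt_one hz0.le (by linarith)).mul_left _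
        have h2 : ‖g m - a N * (z : ℂ) ^ (N + 1)‖ ≤ C * z ^ (N + 2) * (1 - z)⁻¹ := by
          rw [← h1.tsum_eq]
          refine tsum_of_norm_bounded hgeo fun j => ?_
          rw [norm_mul, norm_pow, Complex.norm_real, Real.norm_of_nonneg hz0.le]
          calc ‖a (j + (N + 1))‖ * z ^ (j + (N + 1) + 1) ≤ C * z ^ (j + (N + 1) + 1) := by
                gcongr; exact ha _
            _ = C * z ^ (N + 2) * z ^ j := by ring
        have h3 : (1 - z)⁻¹ ≤ 2 := by
          rw [inv_le_comm₀ (by linarith) (by norm_num)]; linarith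
        have h4 : ‖g m‖ ≤ D * z ^ (N + 2) := (hD m).trans <|
          mul_le_mul_of_nonneg_left
            (pow_le_pow_of_le_one hz0.le (by linarith) (by omega)) hD0
        have h5 : ‖a N‖ * z ^ (N + 1) ≤ ((D + 2 * C) * z) * z ^ (N + 1) := by
          calc ‖a N‖ * z ^ (N + 1) = ‖a N * (z : ℂ) ^ (N + 1)‖ := by
                rw [norm_mul, norm_pow, Complex.norm_real, Real.norm_of_nonneg hz0.le]
            _ = ‖g m - (g m - a N * (z : ℂ) ^ (N + 1))‖ := by rw [sub_sub_cancel]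
            _ ≤ ‖g m‖ + ‖g m - a N * (z : ℂ) ^ (N + 1)‖ := norm_sub_le _ _
            _ ≤ D * z ^ (N + 2) + C * z ^ (N + 2) * 2 := by
                refine add_le_add h4 (h2.trans ?_)
                gcongr
            _ = _ := by ring
        exact le_of_mul_le_mul_right h5 (by positivity)
      · intro j hj
        rw [ih j (Finset.mem_range.1 hj), zero_mul]
    have hlim : Tendsto (fun m : ℕ => (D + 2 * C) * (1 / 2 : ℝ) ^ (m + 1)) atTop (𝓝 0) := by
      simpa using ((tendsto_pow_atTop_nhds_zero_of_lt_one (r := (1 / 2 : ℝ)) (by norm_num)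
        (by norm_num)).comp (tendsto_add_atTop_nat 1)).const_mul (D + 2 * C)
    have := ge_of_tendsto hlim (eventually_atTop.2 ⟨N + 1, bound⟩)
    simpa using this

section

variable {H : Type*} [NormedAddCommGroup H] [InnerProductSpace ℂ H]

/-- The path of operators `max 0 (1 - 2t) + t k` from the identity to `k`. -/
noncomputable def compressionPath (k : H →L[ℂ] H) (t : ℝ) : H →L[ℂ] H :=
  max 0 (1 - 2 * t) • (1 : H →L[ℂ] H) + t • k

/-- The homotopy which first compresses `a` to `k a k`, up to a positive factor, and then moves it
to `c` along a segment. -/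
noncomputable def compressionHomotopy (k c : H →L[ℂ] H) (t : ℝ) (a : H →L[ℂ] H) : H →L[ℂ] H :=
  (1 - t) • (compressionPath k t * a * compressionPath k t) + max 0 (2 * t - 1) • c

theorem compressionPath_apply (k : H →L[ℂ] H) (t : ℝ) (u : H) :
    compressionPath k t u = max 0 (1 - 2 * t) • u + t • k u := rfl

theorem compressionHomotopy_apply (k c a : H →L[ℂ] H) (t : ℝ) (u : H) :
    compressionHomotopy k c t a u =
      (1 - t) • compressionPath k t (a (compressionPath k t u)) + max 0 (2 * t - 1) • c u := rfl

theorem compressionHomotopy_zero (k c a : H →L[ℂ] H) : compressionHomotopy k c 0 a = a := by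
  simp [compressionHomotopy, compressionPath]

theorem compressionHomotopy_one (k c a : H →L[ℂ] H) : compressionHomotopy k c 1 a = c := by
  norm_num [compressionHomotopy, compressionPath]

theorem continuous_compressionHomotopy (k c : H →L[ℂ] H) :
    Continuous fun p : ℝ × (H →L[ℂ] H) => compressionHomotopy k c p.1 p.2 := by
  unfold compressionHomotopy compressionPath
  fun_prop

theorem isCompactOperator_compressionHomotopy (k : H →L[ℂ] H) {c a : H →L[ℂ] H}
    (hc : IsCompactOperator ⇑c) (ha : IsCompactOperator ⇑a) (t : ℝ) :
    IsCompactOperator ⇑(compressionHomotopy k c t a) :=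
  (((ha.clm_comp (compressionPath k t)).comp_clm (compressionPath k t)).smul (1 - t)).add
    (hc.smul (max 0 (2 * t - 1)))

theorem injective_compressionHomotopy {k c a : H →L[ℂ] H}
    (hk : ∀ s t : ℝ, 0 ≤ s → 0 ≤ t → 0 < s + t → ∀ u, s • u + t • k u = 0 → u = 0)
    (hdisj : ∀ u y, c u = k y → u = 0) (ha : Function.Injective ⇑a) {t : ℝ}
    (ht0 : 0 ≤ t) (ht1 : t ≤ 1) : Function.Injective ⇑(compressionHomotopy k c t a) := by
  rw [injective_iff_map_eq_zero] at ha ⊢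
  intro u hu
  rcases ht1.eq_or_lt with rfl | ht1
  · rw [compressionHomotopy_one] at hu
    exact hdisj u 0 (by rw [hu, map_zero])
  rw [compressionHomotopy_apply] at hu
  have hinj : ∀ u, compressionPath k t u = 0 → u = 0 := by
    refine hk _ _ (le_max_left _ _) ht0 ?_
    rcases ht0.eq_or_lt with rfl | ht
    · norm_num
    · positivity
  rcases le_or_gt t (1 / 2) with ht | ht
  · rw [max_eq_left (by linarith), zero_smul, add_zero] at hu
    exact hinj _ (ha _ (hinj _ ((smul_eq_zero.1 hu).resolve_left (by linarith))))
  · have hp : 0 < 2 * t - 1 := by linarith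
    rw [max_eq_right hp.le, compressionPath_apply k t (a _), max_eq_left (by linarith),
      zero_smul, zero_add] at hu
    have hc0 := eq_neg_of_add_eq_zero_right hu
    refine hdisj u (-(((2 * t - 1)⁻¹ * ((1 - t) * t)) • a (compressionPath k t u))) ?_
    rw [map_neg, ContinuousLinearMap.map_smul_of_tower, mul_smul, mul_smul, ← smul_neg, ← hc0, smul_smul,
      inv_mul_cancel₀ hp.ne', one_smul]

variable [CompleteSpace H]

open InnerProductSpace in
/-- A square-summable sequence of vectors gives a compact self-adjoint operator
`∑ |vⱼ⟩⟨vⱼ|`. -/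
theorem exists_hasSum_inner_smul {v : ℕ → H} (hv : Summable fun j => ‖v j‖ ^ 2) :
    ∃ T : H →L[ℂ] H, IsCompactOperator ⇑T ∧ IsSelfAdjoint T ∧
      ∀ u, HasSum (fun j => inner ℂ (v j) u • v j) (T u) := by
  have hs : Summable fun j => rankOne ℂ (v j) (v j) := by
    refine Summable.of_norm ?_
    simpa [← sq] using hv
  refine ⟨∑' j, rankOne ℂ (v j) (v j), ?_, ?_, fun u => ?_⟩
  · refine isCompactOperator_of_tendsto hs.hasSum (Filter.Eventually.of_forall fun s => ?_)
    induction s using Finset.cons_induction with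
    | empty => exact isCompactOperator_zero
    | cons j s _ ih =>
      rw [Finset.sum_cons]
      refine IsCompactOperator.add ?_ ih
      have : IsCompactOperator (ContinuousLinearMap.toSpanSingleton ℂ (v j)) :=
        isCompactOperator_of_locallyCompactSpace_rng _
      exact this.comp_clm (innerSL ℂ (v j))
  · rw [IsSelfAdjoint, tsum_star]
    congr 1
    ext1 j
    rw [ContinuousLinearMap.star_eq_adjoint, adjoint_rankOne]
  · exact hs.hasSum.mapL (ContinuousLinearMap.apply ℂ H u)

/-- A separable infinite-dimensional Hilbert space has a total orthonormal sequence. -/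
theorem exists_orthonormal_nat_total [TopologicalSpace.SeparableSpace H]
    (hinf : ¬ FiniteDimensional ℂ H) :
    ∃ e : ℕ → H, Orthonormal ℂ e ∧ ∀ u, (∀ n, inner ℂ (e n) u = 0) → u = 0 := by
  obtain ⟨w, b, hb⟩ := exists_hilbertBasis ℂ H
  have hcount : Countable w := by
    have hdisj : Pairwise fun i j : w => Disjoint (Metric.ball (i : H) (1 / 2))
        (Metric.ball (j : H) (1 / 2)) := by
      intro i j hij
      apply Metric.ball_disjoint_ball
      have ho := b.orthonormal
      rw [hb] at ho
      have h0 : inner ℂ (i : H) (j : H) = 0 := ho.2 hij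
      have hi : ‖(i : H)‖ = 1 := ho.1 i
      have hj : ‖(j : H)‖ = 1 := ho.1 j
      have := norm_sub_sq (𝕜 := ℂ) (i : H) (j : H)
      rw [h0, hi, hj] at this
      rw [dist_eq_norm]
      norm_num at this
      nlinarith [norm_nonneg ((i : H) - j)]
    exact Set.countable_univ_iff.1 <| Set.PairwiseDisjoint.countable_of_isOpen
      (a := Set.univ) (s := fun i : w => Metric.ball (i : H) (1 / 2))
      (fun i _ j _ hij => hdisj hij) (fun i _ => Metric.isOpen_ball)
      (fun i _ => ⟨i, Metric.mem_ball_self (by norm_num)⟩)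
  have hinfw : Infinite w := by
    by_contra hfin
    rw [not_infinite_iff_finite] at hfin
    apply hinf
    have hfd : FiniteDimensional ℂ (Submodule.span ℂ (Set.range b)) :=
      FiniteDimensional.span_of_finite ℂ (Set.finite_range b)
    have h := b.dense_span
    rw [(Submodule.closed_of_finiteDimensional _).submodule_topologicalClosure_eq] at h
    rw [h] at hfd
    exact (Submodule.topEquiv (R := ℂ) (M := H)).finiteDimensional
  obtain ⟨f⟩ := nonempty_equiv_of_countable (α := ℕ) (β := w)
  refine ⟨b ∘ f, b.orthonormal.comp _ f.injective, fun u hu => ?_⟩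
  apply b.repr.injective
  ext i
  rw [map_zero, b.repr_apply_apply]
  simpa using hu (f.symm i)

/-- There are a positive injective operator `k` and a compact self-adjoint operator `c`, injective
and with range meeting the range of `k` trivially. The injectivity of `k` and its positivity are
expressed by injectivity of the nonnegative combinations of `1` and `k`. -/
theorem exists_compact_disjoint_range [TopologicalSpace.SeparableSpace H]
    (hinf : ¬ FiniteDimensional ℂ H) :
    ∃ k c : H →L[ℂ] H, IsSelfAdjoint k ∧ IsCompactOperator ⇑c ∧ IsSelfAdjoint c ∧
      (∀ s t : ℝ, 0 ≤ s → 0 ≤ t → 0 < s + t → ∀ u, s • u + t • k u = 0 → u = 0) ∧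
      ∀ u y, c u = k y → u = 0 := by
  obtain ⟨e, he, htot⟩ := exists_orthonormal_nat_total (H := H) hinf
  have hnorm : ∀ n, ‖e n‖ = 1 := he.1
  have hpair : ∀ (i j : ℕ), inner ℂ (e i) (e j) = if i = j then (1 : ℂ) else 0 :=
    orthonormal_iff_ite.1 he
  have hgeo : Summable fun n : ℕ => (1 / 2 : ℝ) ^ (n + 1) :=
    (summable_nat_add_iff 1).2 (summable_geometric_of_lt_one (by norm_num) (by norm_num))
  have hle : ∀ p q : ℕ, q ≤ p → (1 / 2 : ℝ) ^ p ≤ (1 / 2 : ℝ) ^ q := fun p q h =>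
    pow_le_pow_of_le_one (by norm_num) (by norm_num) h
  -- the diagonal operator
  obtain ⟨k, -, hksa, hk⟩ := exists_hasSum_inner_smul
    (v := fun n => ((1 / 2 : ℂ) ^ ((n + 1) * (n + 1))) • e n) <| by
      refine hgeo.of_nonneg_of_le (fun n => by positivity) fun n => ?_
      rw [norm_smul, hnorm, mul_one, norm_pow, ← pow_mul]
      norm_num only [norm_div, norm_one, Complex.norm_ofNat]
      exact hle _ _ (by nlinarith)
  have hkc : ∀ m u, inner ℂ (e m) (k u)
      = (((1 / 2 : ℝ) ^ ((m + 1) * (m + 1))) ^ 2 : ℝ) * inner ℂ (e m) u := by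
    intro m u
    have h := (hk u).mapL (innerSL ℂ (e m))
    refine h.unique ?_
    convert hasSum_single m ?_ using 1
    · simp [hnorm]
      ring
    · intro j hj
      simp [hpair, hj.symm]
  -- the vectors with geometric coordinates
  have hw : ∀ j : ℕ, Summable fun m : ℕ => ((1 / 2 : ℂ) ^ (m + 1)) ^ (j + 1) • e m := by
    intro j
    refine Summable.of_norm_bounded hgeo fun m => ?_
    rw [norm_smul, hnorm, mul_one, ← pow_mul, norm_pow]
    norm_num only [norm_div, norm_one, Complex.norm_ofNat]
    exact hle _ _ (by nlinarith)
  choose w hw using hw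
  have hwc : ∀ j m, inner ℂ (e m) (w j) = ((1 / 2 : ℂ) ^ (m + 1)) ^ (j + 1) := by
    intro j m
    have h := (hw j).mapL (innerSL ℂ (e m))
    refine h.unique ?_
    convert hasSum_single m ?_ using 1
    · simp [hnorm]
    · intro i hi
      simp [hpair, hi.symm]
  have hwn : ∀ j, ‖w j‖ ≤ (1 / 2 : ℝ) ^ j := by
    intro j
    have hg2 : HasSum (fun m : ℕ => (1 / 2 : ℝ) ^ (j + 1) * (1 / 2 : ℝ) ^ m) ((1 / 2 : ℝ) ^ j) := by
      have h2 : (1 / 2 : ℝ) ^ j = (1 / 2 : ℝ) ^ (j + 1) * 2 := by ring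
      rw [h2]
      exact hasSum_geometric_two.mul_left _
    rw [← (hw j).tsum_eq]
    refine tsum_of_norm_bounded hg2 fun m => ?_
    rw [norm_smul, hnorm, mul_one, ← pow_mul, norm_pow, ← pow_add]
    norm_num only [norm_div, norm_one, Complex.norm_ofNat]
    exact hle _ _ (by nlinarith)
  obtain ⟨c, hcc, hcsa, hc⟩ := exists_hasSum_inner_smul (v := w) <| by
    refine (summable_geometric_of_lt_one (r := (1 / 2 : ℝ)) (by norm_num)
      (by norm_num)).of_nonneg_of_le (fun n => by positivity) fun n => ?_
    calc ‖w n‖ ^ 2 ≤ ((1 / 2 : ℝ) ^ n) ^ 2 := by gcongr; exact hwn n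
      _ = (1 / 2 : ℝ) ^ (n * 2) := (pow_mul _ _ _).symm
      _ ≤ _ := hle _ _ (by omega)
  refine ⟨k, c, hksa, hcc, hcsa, fun s t hs ht hst u hu => htot u fun m => ?_, fun u y huy => ?_⟩
  · have h : inner ℂ (e m) (s • u + t • k u) = 0 := by rw [hu, inner_zero_right]
    rw [inner_add_right, inner_smul_right_eq_smul, inner_smul_right_eq_smul, hkc,
      Complex.real_smul, Complex.real_smul, ← mul_assoc, ← add_mul] at h
    refine (mul_eq_zero.1 h).resolve_left ?_
    norm_cast
    rcases hs.eq_or_lt with rfl | hs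
    · have : 0 < t := by linarith
      positivity
    · positivity
  · have hwu : ∀ j, inner ℂ (w j) u = 0 := by
      refine coeff_eq_zero_of_superpolynomial_decay (C := ‖u‖) (D := ‖y‖)
        (g := fun m => inner ℂ (e m) (c u)) (fun j => ?_) (fun m => ?_) (fun m => ?_)
      · refine (norm_inner_le_norm _ _).trans ?_
        exact mul_le_of_le_one_left (norm_nonneg _)
          ((hwn j).trans (pow_le_one₀ (by norm_num) (by norm_num)))
      · have h := (hc u).mapL (innerSL ℂ (e m))
        simpa [inner_smul_right, hwc] using h
      · simp only [huy, hkc, norm_mul, Complex.norm_real]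
        rw [Real.norm_of_nonneg (by positivity), mul_comm, ← pow_mul, ← pow_mul]
        refine mul_le_mul ?_ (hle _ _ (by omega)) (by positivity) (norm_nonneg _)
        refine (norm_inner_le_norm _ _).trans ?_
        rw [hnorm, one_mul]
    refine htot u ?_
    have hconj : ∀ m, inner ℂ u (e m) = 0 := by
      refine coeff_eq_zero_of_superpolynomial_decay (C := ‖u‖) (D := 0) (g := fun _ => 0)
        (fun j => ?_) (fun j => ?_) (fun j => by simp)
      · refine (norm_inner_le_norm _ _).trans ?_
        rw [hnorm, mul_one]
      · have h := (hw j).mapL (innerSL ℂ u)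
        have h0 : inner ℂ u (w j) = 0 := inner_eq_zero_symm.1 (hwu j)
        simp only [innerSL_apply_apply, inner_smul_right, h0] at h
        have hfun : (fun m => inner ℂ u (e m) * ((1 / 2 : ℂ) ^ (j + 1)) ^ (m + 1))
            = fun m => ((1 / 2 : ℂ) ^ (m + 1)) ^ (j + 1) * inner ℂ u (e m) := by
          ext m
          rw [← pow_mul, ← pow_mul, mul_comm (j + 1), mul_comm]
        rw [hfun]
        exact h
    exact fun m => inner_eq_zero_symm.1 (hconj m)

theorem isSelfAdjoint_compressionPath {k : H →L[ℂ] H} (hk : IsSelfAdjoint k) (t : ℝ) :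
    IsSelfAdjoint (compressionPath k t) :=
  ((IsSelfAdjoint.all (max 0 (1 - 2 * t))).smul (IsSelfAdjoint.one _)).add
    ((IsSelfAdjoint.all t).smul hk)

theorem isSelfAdjoint_compressionHomotopy {k c a : H →L[ℂ] H} (hk : IsSelfAdjoint k)
    (hc : IsSelfAdjoint c) (ha : IsSelfAdjoint a) (t : ℝ) :
    IsSelfAdjoint (compressionHomotopy k c t a) := by
  refine IsSelfAdjoint.add (.smul (.all _) ?_) (.smul (.all _) hc)
  rw [IsSelfAdjoint, star_mul, star_mul, (isSelfAdjoint_compressionPath hk t).star_eq,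
    ha.star_eq, mul_assoc]

end

/-- The space `Z_K = {a ∈ B(H) : a compact, self-adjoint and injective}` with the norm
topology is contractible. -/
theorem stmt_11 (H : Type*) [NormedAddCommGroup H] [InnerProductSpace ℂ H]
    [CompleteSpace H] [TopologicalSpace.SeparableSpace H]
    (hinf : ¬ FiniteDimensional ℂ H) :
    ContractibleSpace
      {a : H →L[ℂ] H // IsCompactOperator ⇑a ∧ IsSelfAdjoint a ∧ Function.Injective ⇑a} := by
  obtain ⟨k, c, hk, hcc, hc, hinj, hdisj⟩ := exists_compact_disjoint_range (H := H) hinf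
  have hcinj : Function.Injective c := by
    rw [injective_iff_map_eq_zero]
    exact fun u hu => hdisj u 0 (by rw [hu, map_zero])
  rw [contractible_iff_id_nullhomotopic]
  refine ⟨⟨c, hcc, hc, hcinj⟩, ⟨⟨⟨fun p => ⟨compressionHomotopy k c p.1 p.2,
    isCompactOperator_compressionHomotopy k hcc p.2.2.1 _,
    isSelfAdjoint_compressionHomotopy hk hc p.2.2.2.1 _,
    injective_compressionHomotopy hinj hdisj p.2.2.2.2 p.1.2.1 p.1.2.2⟩, ?_⟩, ?_, ?_⟩⟩⟩
  · exact Continuous.subtype_mk ((continuous_compressionHomotopy k c).comp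
      ((continuous_subtype_val.comp continuous_fst).prodMk
        (continuous_subtype_val.comp continuous_snd))) _
  · exact fun a => Subtype.ext (compressionHomotopy_zero k c a)
  · exact fun a => Subtype.ext (compressionHomotopy_one k c a)
end

section
/- For every real λ ≥ 0, the sets {a ∈ B(H) : a self-adjoint, injective, and λ·‖a‖ < 1} and {a ∈ B(H) : a compact, self-adjoint, injective, and λ·‖a‖ < 1}, with the operator-norm topology, are contractible. -/
open InnerProductSpace Filter unitInterval

/-- An infinite-dimensional separable Hilbert space has an orthonormal sequence
that detects the zero vector. -/
theorem exists_orthonormal_seq_total (H : Type*) [NormedAddCommGroup H] [InnerProductSpace ℂ H]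
    [CompleteSpace H] [TopologicalSpace.SeparableSpace H] (hinf : ¬ FiniteDimensional ℂ H) :
    ∃ f : ℕ → H, Orthonormal ℂ f ∧ ∀ h : H, (∀ n, inner ℂ (f n) h = 0) → h = 0 := by
  obtain ⟨w, b, hb⟩ := exists_hilbertBasis ℂ H
  have hon : Orthonormal ℂ (fun x : w ↦ (x : H)) := hb ▸ b.orthonormal
  have hw : w.Countable := by
    refine Set.PairwiseDisjoint.countable_of_isOpen (s := fun x : H ↦ Metric.ball x (1 / 2)) ?_
      (fun _ _ ↦ Metric.isOpen_ball) fun x _ ↦ ⟨x, by simp⟩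
    intro x hx y hy hxy
    refine Metric.ball_disjoint_ball ?_
    have h0 : inner ℂ x y = 0 := hon.2 (i := ⟨x, hx⟩) (j := ⟨y, hy⟩) (by simpa using hxy)
    have h1 := norm_sub_sq (𝕜 := ℂ) x y
    have hx1 : ‖x‖ = 1 := hon.1 ⟨x, hx⟩
    have hy1 : ‖y‖ = 1 := hon.1 ⟨y, hy⟩
    rw [h0, hx1, hy1] at h1
    rw [dist_eq_norm]
    norm_num at h1 ⊢
    nlinarith [norm_nonneg (x - y)]
  have hwi : Infinite w := by
    by_contra hfin
    rw [not_infinite_iff_finite] at hfin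
    have := Fintype.ofFinite w
    exact hinf (b.toOrthonormalBasis.toBasis.finiteDimensional_of_finite)
  have := hw.to_subtype
  obtain ⟨φ⟩ := nonempty_equiv_of_countable (α := ℕ) (β := w)
  refine ⟨fun n ↦ b (φ n), b.orthonormal.comp _ φ.injective, fun h hh ↦ ?_⟩
  apply b.repr.injective
  ext i
  have := hh (φ.symm i)
  simpa [b.repr_apply_apply] using this

section

variable {H : Type*} [NormedAddCommGroup H] [InnerProductSpace ℂ H]

/-- The operator `∑ κ n |f n⟩⟨g n|`. -/
noncomputable def weightedRankOneSum (κ : ℕ → ℝ) (f g : ℕ → H) : H →L[ℂ] H :=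
  ∑' n, κ n • rankOne ℂ (f n) (g n)

variable {κ : ℕ → ℝ} {f g : ℕ → H}

theorem norm_smul_rankOne_le (h0 : ∀ n, 0 < κ n) (hf : ∀ n, ‖f n‖ = 1) (hg : ∀ n, ‖g n‖ = 1)
    (n : ℕ) : ‖κ n • rankOne ℂ (f n) (g n)‖ ≤ κ n := by
  simp [norm_smul, hf, hg, abs_of_pos (h0 n)]

theorem norm_weightedRankOneSum_le {c : ℝ} (h0 : ∀ n, 0 < κ n) (hκ : HasSum κ c)
    (hf : ∀ n, ‖f n‖ = 1) (hg : ∀ n, ‖g n‖ = 1) : ‖weightedRankOneSum κ f g‖ ≤ c :=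
  tsum_of_norm_bounded hκ (norm_smul_rankOne_le h0 hf hg)

variable [CompleteSpace H]

theorem hasSum_weightedRankOneSum (h0 : ∀ n, 0 < κ n) (hκ : Summable κ)
    (hf : ∀ n, ‖f n‖ = 1) (hg : ∀ n, ‖g n‖ = 1) :
    HasSum (fun n ↦ κ n • rankOne ℂ (f n) (g n)) (weightedRankOneSum κ f g) :=
  (Summable.of_norm_bounded hκ (norm_smul_rankOne_le h0 hf hg)).hasSum

theorem isCompactOperator_weightedRankOneSum (h0 : ∀ n, 0 < κ n) (hκ : Summable κ)
    (hf : ∀ n, ‖f n‖ = 1) (hg : ∀ n, ‖g n‖ = 1) :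
    IsCompactOperator (weightedRankOneSum κ f g) := by
  refine isCompactOperator_of_tendsto (hasSum_weightedRankOneSum h0 hκ hf hg)
    (Eventually.of_forall fun s ↦ ?_)
  refine Submodule.sum_mem (compactOperator (RingHom.id ℂ) H H) (t := s)
    (f := fun n ↦ κ n • (rankOne ℂ (f n) (g n))) fun n _ ↦ ?_
  have : IsCompactOperator (rankOne ℂ (f n) (g n)) := by
    rw [rankOne_def']
    exact (isCompactOperator_of_locallyCompactSpace_rng
      (ContinuousLinearMap.toSpanSingleton ℂ (f n))).comp_clm (innerSL ℂ (g n))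
  exact this.smul (κ n)

theorem isSelfAdjoint_weightedRankOneSum (h0 : ∀ n, 0 < κ n) (hκ : Summable κ)
    (hf : ∀ n, ‖f n‖ = 1) : IsSelfAdjoint (weightedRankOneSum κ f f) := by
  have h := hasSum_weightedRankOneSum h0 hκ hf hf
  refine h.star.unique ?_
  convert h using 2 with n
  simp [star_smul, ContinuousLinearMap.star_eq_adjoint]

theorem inner_weightedRankOneSum (h0 : ∀ n, 0 < κ n) (hκ : Summable κ)
    (hf : Orthonormal ℂ f) (hg : ∀ n, ‖g n‖ = 1) (n : ℕ) (h : H) :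
    inner ℂ (f n) (weightedRankOneSum κ f g h) = κ n * inner ℂ (g n) h := by
  have hs := (hasSum_weightedRankOneSum h0 hκ hf.1 hg).mapL
    ((innerSL ℂ (f n)).comp (ContinuousLinearMap.apply ℂ H h))
  refine hs.unique ?_
  convert hasSum_single n fun m hm ↦ ?_ using 1
  · simp [hf.1 n]
  · simp [hf.2 hm.symm]

end

/-- There are a small self-adjoint compact operator `k`, with `s + t k` injective for nonnegative
`s` and `t` not both zero, and a small injective operator `b` such that the ranges of `k` and `b`
meet only in zero. -/
theorem exists_compact_disjoint_ranges (H : Type*) [NormedAddCommGroup H] [InnerProductSpace ℂ H]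
    [CompleteSpace H] [TopologicalSpace.SeparableSpace H] (hinf : ¬ FiniteDimensional ℂ H)
    {ε : ℝ} (hε : 0 < ε) :
    ∃ k b : H →L[ℂ] H, IsCompactOperator k ∧ ‖k‖ ≤ ε ∧ ‖b‖ ≤ ε ∧ IsSelfAdjoint k ∧
      (∀ s t : ℝ, 0 ≤ s → 0 ≤ t → 0 < s + t → ∀ h, s • h + t • k h = 0 → h = 0) ∧
      ∀ u v, k u = b v → v = 0 := by
  obtain ⟨f, hf, hf0⟩ := exists_orthonormal_seq_total H hinf
  obtain ⟨κ, h0, c, hκ, hc⟩ := posSumOfEncodable hε ℕ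
  have hg : ∀ n : ℕ, ‖f n.unpair.2‖ = 1 := fun n ↦ hf.1 _
  refine ⟨weightedRankOneSum κ f f, weightedRankOneSum κ f fun n ↦ f n.unpair.2,
    isCompactOperator_weightedRankOneSum h0 hκ.summable hf.1 hf.1,
    (norm_weightedRankOneSum_le h0 hκ hf.1 hf.1).trans hc,
    (norm_weightedRankOneSum_le h0 hκ hf.1 hg).trans hc,
    isSelfAdjoint_weightedRankOneSum h0 hκ.summable hf.1, ?_, ?_⟩
  · intro s t hs ht hst h hh
    refine hf0 h fun n ↦ ?_
    have h1 := congrArg (inner ℂ (f n)) hh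
    rw [inner_add_right, inner_smul_right_eq_smul, inner_smul_right_eq_smul,
      inner_weightedRankOneSum h0 hκ.summable hf hf.1, inner_zero_right, Complex.real_smul,
      Complex.real_smul, ← mul_assoc, ← add_mul, mul_eq_zero] at h1
    refine h1.resolve_left ?_
    have : 0 < s + t * κ n := by
      rcases hs.eq_or_lt with rfl | hs
      · have : 0 < t := by linarith
        have := mul_pos this (h0 n)
        linarith
      · have := mul_nonneg ht (h0 n).le
        linarith
    exact_mod_cast this.ne'
  · intro u v huv
    refine hf0 v fun j ↦ ?_
    have key : ∀ n : ℕ, inner ℂ (f n) u = inner ℂ (f n.unpair.2) v := fun n ↦ by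
      have h1 := congrArg (inner ℂ (f n)) huv
      rw [inner_weightedRankOneSum h0 hκ.summable hf hf.1,
        inner_weightedRankOneSum h0 hκ.summable hf hg] at h1
      exact mul_left_cancel₀ (by exact_mod_cast (h0 n).ne') h1
    have hsum := (hf.inner_products_summable (x := u)).comp_injective
      (i := fun i : ℕ ↦ Nat.pair i j) fun a b hab ↦ (Nat.pair_eq_pair.1 hab).1
    have hconst : ((fun n ↦ ‖inner ℂ (f n) u‖ ^ 2) ∘ fun i : ℕ ↦ Nat.pair i j) =
        fun _ ↦ ‖inner ℂ (f j) v‖ ^ 2 := by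
      ext i
      simp [key]
    rw [hconst, summable_const_iff] at hsum
    simpa using hsum

/-- For a property `P` of operators that is closed under sums and two-sided multiplication and
holds for compact operators, the injective self-adjoint operators `a` with `P a` and
`l * ‖a‖ < 1` form a contractible space: first deform `a` to `k * a * k`, and then linearly to
`k * star b + b * k` (up to scaling), where the ranges of `k` and `b` meet only in zero. -/
theorem contractibleSpace_injective_selfAdjoint {H : Type*} [NormedAddCommGroup H]
    [InnerProductSpace ℂ H] [CompleteSpace H] [TopologicalSpace.SeparableSpace H]
    (hinf : ¬ FiniteDimensional ℂ H) {l : ℝ} (hl : 0 ≤ l) (P : (H →L[ℂ] H) → Prop)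
    (hcompact : ∀ a : H →L[ℂ] H, IsCompactOperator a → P a)
    (hadd : ∀ a b, P a → P b → P (a + b)) (hmul : ∀ a r s, P a → P (r * a * s)) :
    ContractibleSpace
      {a : H →L[ℂ] H // P a ∧ IsSelfAdjoint a ∧ Function.Injective ⇑a ∧ l * ‖a‖ < 1} := by
  have hε : 0 < 1 / (l + 1) := by positivity
  obtain ⟨k, b, hk, hk1, hb1, hks, hkinj, hkb⟩ := exists_compact_disjoint_ranges H hinf hε
  have hε1 : 1 / (l + 1) ≤ 1 := by
    rw [div_le_one (by positivity)]
    linarith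
  have hlε : l * (1 / (l + 1)) < 1 := by
    rw [mul_one_div, div_lt_one (by positivity)]
    linarith
  have hP_smul : ∀ (t : ℝ) a, P a → P (t • a) := fun t a ha ↦ by
    simpa using hmul a (t • 1) 1 ha
  set d : H →L[ℂ] H := (1 / 2 : ℝ) • (k * star b + b * k) with hd
  have hdP : P d := by
    refine hcompact _ (IsCompactOperator.smul (S := ℝ) ?_ _)
    exact (hk.comp_clm (star b)).add (hk.clm_comp b)
  have hds : IsSelfAdjoint d := by
    refine IsSelfAdjoint.smul (IsSelfAdjoint.all _) ?_
    rw [isSelfAdjoint_iff, star_add, star_mul, star_mul, star_star, hks.star_eq, add_comm]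
  have hdn : l * ‖d‖ < 1 := by
    have h1 : ‖k * star b‖ ≤ 1 / (l + 1) := calc
      _ ≤ ‖k‖ * ‖star b‖ := norm_mul_le _ _
      _ ≤ 1 / (l + 1) * 1 := by rw [norm_star]; gcongr; exact hb1.trans hε1
      _ = _ := mul_one _
    have h2 : ‖b * k‖ ≤ 1 / (l + 1) := calc
      _ ≤ ‖b‖ * ‖k‖ := norm_mul_le _ _
      _ ≤ 1 / (l + 1) * 1 := by gcongr; exact hk1.trans hε1
      _ = _ := mul_one _
    have h3 : ‖d‖ ≤ 1 / (l + 1) := by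
      rw [hd, norm_smul]
      have := norm_add_le (k * star b) (b * k)
      norm_num at *
      linarith
    exact (mul_le_mul_of_nonneg_left h3 hl).trans_lt hlε
  have hk_one : ‖k‖ ≤ 1 := hk1.trans hε1
  have hsymm : (k : H →ₗ[ℂ] H).IsSymmetric :=
    ContinuousLinearMap.isSelfAdjoint_iff_isSymmetric.1 hks
  -- The compression path `r t = (1 - t) + t k`.
  let r : ℝ → H →L[ℂ] H := fun t ↦ (1 - t) • 1 + t • k
  have hrs : ∀ t, IsSelfAdjoint (r t) := fun t ↦
    ((IsSelfAdjoint.all (1 - t)).smul (.one _)).add ((IsSelfAdjoint.all t).smul hks)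
  have hrn : ∀ t ∈ I, ‖r t‖ ≤ 1 := fun t ht ↦ by
    have h1 : ‖(1 : H →L[ℂ] H)‖ ≤ 1 := ContinuousLinearMap.norm_id_le
    calc ‖r t‖ ≤ ‖(1 - t) • (1 : H →L[ℂ] H)‖ + ‖t • k‖ := norm_add_le _ _
      _ = (1 - t) * ‖(1 : H →L[ℂ] H)‖ + t * ‖k‖ := by
        rw [norm_smul, norm_smul, Real.norm_of_nonneg ht.1, Real.norm_of_nonneg (by linarith [ht.2])]
      _ ≤ (1 - t) * 1 + t * 1 := by
        have := ht.1
        have : 0 ≤ 1 - t := by linarith [ht.2]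
        gcongr
      _ = 1 := by ring
  have hrinj : ∀ t ∈ I, Function.Injective (r t) := fun t ht ↦ by
    rw [injective_iff_map_eq_zero]
    intro h hh
    exact hkinj (1 - t) t (by linarith [ht.2]) ht.1 (by linarith) h (by simpa [r] using hh)
  have hrcont : Continuous r := by fun_prop
  have hr0 : r 0 = 1 := by simp [r]
  have hr1 : r 1 = k := by simp [r]
  have hcomp : ∀ a : H →L[ℂ] H, P a ∧ IsSelfAdjoint a ∧ Function.Injective ⇑a ∧ l * ‖a‖ < 1 →
      ∀ t ∈ I, P (r t * a * r t) ∧ IsSelfAdjoint (r t * a * r t) ∧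
        Function.Injective ⇑(r t * a * r t) ∧ l * ‖r t * a * r t‖ < 1 := by
    rintro a ⟨hP, hs, hi, hn⟩ t ht
    refine ⟨hmul _ _ _ hP, ?_, ?_, ?_⟩
    · rw [isSelfAdjoint_iff, star_mul, star_mul, (hrs t).star_eq, hs.star_eq, mul_assoc]
    · exact ((hrinj t ht).comp hi).comp (hrinj t ht)
    · refine lt_of_le_of_lt ?_ hn
      gcongr
      calc ‖r t * a * r t‖ ≤ ‖r t‖ * ‖a‖ * ‖r t‖ := norm_mul₃_le
        _ ≤ 1 * ‖a‖ * 1 := by gcongr <;> exact hrn t ht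
        _ = ‖a‖ := by ring
  have hlin : ∀ a : H →L[ℂ] H, P a ∧ IsSelfAdjoint a ∧ Function.Injective ⇑a ∧ l * ‖a‖ < 1 →
      ∀ t ∈ I, P ((1 - t) • (k * a * k) + t • d) ∧ IsSelfAdjoint ((1 - t) • (k * a * k) + t • d) ∧
        Function.Injective ⇑((1 - t) • (k * a * k) + t • d) ∧
        l * ‖(1 - t) • (k * a * k) + t • d‖ < 1 := by
    intro a ha t ht
    obtain ⟨hP, hs, hi, hn⟩ := hr1 ▸ hcomp a ha 1 (by simp)
    have ht1 : 0 ≤ 1 - t := by linarith [ht.2]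
    have ht0 := ht.1
    refine ⟨hadd _ _ (hP_smul _ _ hP) (hP_smul _ _ hdP),
      ((IsSelfAdjoint.all (1 - t)).smul hs).add ((IsSelfAdjoint.all t).smul hds), ?_, ?_⟩
    · rcases ht0.eq_or_lt with rfl | htpos
      · simpa using hi
      rw [injective_iff_map_eq_zero]
      intro h hh
      have h1 : k (-((1 - t) • a (k h) + (t / 2) • star b h)) = b ((t / 2) • k h) := by
        rw [map_neg, neg_eq_iff_add_eq_zero, ← hh]
        simp only [hd, add_apply, smul_apply, mul_apply_eq_comp, map_add,
          ContinuousLinearMap.map_smul_of_tower, smul_add, smul_smul]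
        rw [mul_one_div, add_assoc]
      have h2 := hkb _ _ h1
      refine hkinj 0 (t / 2) le_rfl (by positivity) (by positivity) h ?_
      rw [zero_smul, zero_add, h2]
    · calc l * ‖(1 - t) • (k * a * k) + t • d‖
          ≤ l * (‖(1 - t) • (k * a * k)‖ + ‖t • d‖) := by gcongr; exact norm_add_le _ _
        _ = (1 - t) * (l * ‖k * a * k‖) + t * (l * ‖d‖) := by
          rw [norm_smul, norm_smul, Real.norm_of_nonneg ht0, Real.norm_of_nonneg ht1]
          ring
        _ < 1 := by
          rcases ht0.eq_or_lt with rfl | htpos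
          · simpa using hn
          · nlinarith
  have hkinj' : Function.Injective k := hr1 ▸ hrinj 1 (by simp)
  have hkn : l * ‖k‖ < 1 := (mul_le_mul_of_nonneg_left hk1 hl).trans_lt hlε
  have hdX := hlin k ⟨hcompact k hk, hks, hkinj', hkn⟩ 1 (by simp)
  rw [sub_self, zero_smul, one_smul, zero_add] at hdX
  rw [contractible_iff_id_nullhomotopic]
  let Φ : C({a : H →L[ℂ] H // P a ∧ IsSelfAdjoint a ∧ Function.Injective ⇑a ∧ l * ‖a‖ < 1},
      {a : H →L[ℂ] H // P a ∧ IsSelfAdjoint a ∧ Function.Injective ⇑a ∧ l * ‖a‖ < 1}) :=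
    ⟨fun a ↦ ⟨r 1 * a * r 1, hcomp a a.2 1 (by simp)⟩, by fun_prop⟩
  refine ⟨⟨d, hdX⟩, ContinuousMap.Homotopic.trans (g := Φ) ⟨?_⟩ ⟨?_⟩⟩
  · exact
      { toFun := fun p ↦ ⟨r p.1 * p.2 * r p.1, hcomp p.2 p.2.2 p.1 p.1.2⟩
        continuous_toFun := by fun_prop
        map_zero_left := fun a ↦ by simp [hr0]
        map_one_left := fun a ↦ by simp [Φ] }
  · exact
      { toFun := fun p ↦ ⟨(1 - (p.1 : ℝ)) • (k * p.2 * k) + (p.1 : ℝ) • d,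
          hlin p.2 p.2.2 p.1 p.1.2⟩
        continuous_toFun := by fun_prop
        map_zero_left := fun a ↦ by simp [Φ, hr1]
        map_one_left := fun a ↦ by simp }

/-- For every `λ ≥ 0`, the spaces of (resp. compact) injective self-adjoint bounded operators
`a` with `λ·‖a‖ < 1` are contractible. -/
theorem stmt_13 (H : Type*) [NormedAddCommGroup H] [InnerProductSpace ℂ H]
    [CompleteSpace H] [TopologicalSpace.SeparableSpace H]
    (hinf : ¬ FiniteDimensional ℂ H) (l : ℝ) (hl : 0 ≤ l) :
    ContractibleSpace
      {a : H →L[ℂ] H // IsSelfAdjoint a ∧ Function.Injective ⇑a ∧ l * ‖a‖ < 1} ∧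
    ContractibleSpace
      {a : H →L[ℂ] H // IsCompactOperator ⇑a ∧ IsSelfAdjoint a ∧ Function.Injective ⇑a ∧
        l * ‖a‖ < 1} := by
  refine ⟨?_, contractibleSpace_injective_selfAdjoint hinf hl (fun a ↦ IsCompactOperator a)
    (fun _ h ↦ h) (fun _ _ ha hb ↦ ha.add hb)
    fun _ r s ha ↦ (ha.clm_comp r).comp_clm s⟩
  have := contractibleSpace_injective_selfAdjoint hinf hl (fun _ : H →L[ℂ] H ↦ True) (fun _ _ ↦ trivial)
    (fun _ _ _ _ ↦ trivial) (fun _ _ _ _ ↦ trivial)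
  have hset : (fun a : H →L[ℂ] H ↦
      True ∧ IsSelfAdjoint a ∧ Function.Injective ⇑a ∧ l * ‖a‖ < 1) =
      fun a : H →L[ℂ] H ↦ IsSelfAdjoint a ∧ Function.Injective ⇑a ∧ l * ‖a‖ < 1 := by
    simp only [true_and]
  exact hset ▸ this
end

section
/- For every real λ ≥ 0, the sets U⟨λ⟩ = {u ∈ U(H) : spectrum(u) ∩ {(t − i)/(t + i) : t ∈ [−λ, λ]} = ∅} and U_K⟨λ⟩ = {u ∈ U⟨λ⟩ : u − 1 is compact}, with the operator-norm topology, are contractible. -/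
/-- The Möbius map `z ↦ (z + a) / (1 + a z)` applied to an element of a complex algebra. -/
noncomputable def mobiusShift {A : Type*} [Ring A] [Algebra ℂ A] (a : ℂ) (u : A) : A :=
  (u + a • 1) * Ring.inverse (1 + a • u)

/-- A set containing `1` and stable under the Möbius maps with parameter in `[0, 1]` contracts
to `1`. -/
theorem contractibleSpace_of_mobiusShift_mem {A : Type*} [NormedRing A] [NormedAlgebra ℂ A]
    [CompleteSpace A] (p : A → Prop) (h1 : p 1)
    (hunit : ∀ u, p u → ∀ a : ℝ, a ∈ Set.Icc (0 : ℝ) 1 → IsUnit (1 + (a : ℂ) • u))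
    (hp : ∀ u, p u → ∀ a : ℝ, a ∈ Set.Icc (0 : ℝ) 1 → p (mobiusShift (a : ℂ) u)) :
    ContractibleSpace {u : A // p u} := by
  rw [contractible_iff_id_nullhomotopic]
  refine ⟨⟨1, h1⟩, ⟨⟨⟨fun q => ⟨mobiusShift ((q.1 : ℝ) : ℂ) q.2.1, hp _ q.2.2 _ q.1.2⟩, ?_⟩,
    ?_, ?_⟩⟩⟩
  · refine Continuous.subtype_mk ?_ _
    unfold mobiusShift
    refine Continuous.mul (by fun_prop) ?_
    rw [continuous_iff_continuousAt]
    intro q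
    have hcont : ContinuousAt (fun q : unitInterval × {u : A // p u} =>
        1 + ((q.1 : ℝ) : ℂ) • q.2.1) q := by fun_prop
    obtain ⟨x, hx⟩ := hunit _ q.2.2 _ q.1.2
    refine ContinuousAt.comp (g := Ring.inverse) ?_ hcont
    rw [← hx]
    exact NormedRing.inverse_continuousAt x
  · intro u
    ext
    simp [mobiusShift]
  · intro u
    ext
    have := hunit _ u.2 1 (by simp)
    simp only [Complex.ofReal_one, one_smul] at this
    simp [mobiusShift, add_comm u.1 1, Ring.mul_inverse_cancel _ this]

theorem isUnit_one_add_smul_of_mem_unitary {A : Type*} [NormedRing A] [StarRing A] [CStarRing A]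
    [NormedAlgebra ℂ A] [CompleteSpace A] {u : A}
    (hu : u ∈ unitary A) (hs : (-1 : ℂ) ∉ spectrum ℂ u) {a : ℝ} (ha : a ∈ Set.Icc (0 : ℝ) 1) :
    IsUnit (1 + (a : ℂ) • u) := by
  rcases eq_or_ne a 0 with rfl | h0
  · simp
  have h0' : (a : ℂ) ≠ 0 := by exact_mod_cast h0
  have hmem : -(a : ℂ)⁻¹ ∉ spectrum ℂ u := by
    intro h
    have hc := spectrum.subset_circle_of_unitary hu h
    simp only [mem_sphere_iff_norm, sub_zero, norm_neg, norm_inv, Complex.norm_real,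
      Real.norm_eq_abs, abs_of_nonneg ha.1, inv_eq_one] at hc
    subst hc
    exact hs (by simpa using h)
  rw [spectrum.notMem_iff] at hmem
  have := hmem.smul (Units.mk0 (-(a : ℂ)) (neg_ne_zero.mpr h0'))
  convert this using 1
  simp [Units.smul_def, Algebra.algebraMap_eq_smul_one, smul_sub, smul_smul, h0']

theorem mobiusShift_mem_unitary {A : Type*} [Ring A] [StarRing A] [Algebra ℂ A] [StarModule ℂ A]
    {u : A} (hu : u ∈ unitary A) {a : ℝ} (h : IsUnit (1 + (a : ℂ) • u)) :
    mobiusShift (a : ℂ) u ∈ unitary A := by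
  obtain ⟨x, hx⟩ := h
  have hstar : u + (a : ℂ) • 1 = u * star (x : A) := by
    rw [hx]
    simp [mul_add, Unitary.mul_star_self_of_mem hu]
  have hcomm : Commute (x : A) (star (x : A)) := by
    have hus : Commute u (star u) := by
      rw [commute_iff_eq, Unitary.mul_star_self_of_mem hu, Unitary.star_mul_self_of_mem hu]
    rw [hx]
    simp only [star_add, star_one, star_smul]
    exact (Commute.one_left _).add_left
      ((Commute.one_right _).add_right ((hus.smul_left _).smul_right _))
  have hmem : star (x : A) * ((x⁻¹ : Aˣ) : A) ∈ unitary A := by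
    have hcs : Commute ((x⁻¹ : Aˣ) : A) (star (x : A)) := hcomm.units_inv_left
    have hss : star ((x⁻¹ : Aˣ) : A) * star (x : A) = 1 := by simp [← star_mul]
    have hss' : star (x : A) * star ((x⁻¹ : Aˣ) : A) = 1 := by simp [← star_mul]
    rw [Unitary.mem_iff, star_mul, star_star]
    constructor
    · calc star ((x⁻¹ : Aˣ) : A) * x * (star (x : A) * ((x⁻¹ : Aˣ) : A))
          = star ((x⁻¹ : Aˣ) : A) * (x * star (x : A)) * ((x⁻¹ : Aˣ) : A) := by
            simp only [mul_assoc]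
        _ = (star ((x⁻¹ : Aˣ) : A) * star (x : A)) * (x * ((x⁻¹ : Aˣ) : A)) := by
            rw [hcomm.eq]; simp only [mul_assoc]
        _ = 1 := by rw [hss]; simp
    · calc star (x : A) * ((x⁻¹ : Aˣ) : A) * (star ((x⁻¹ : Aˣ) : A) * x)
          = ((x⁻¹ : Aˣ) : A) * (star (x : A) * star ((x⁻¹ : Aˣ) : A)) * x := by
            rw [← hcs.eq]; simp only [mul_assoc]
        _ = 1 := by rw [hss']; simp
  rw [mobiusShift, hstar, ← hx, Ring.inverse_unit, mul_assoc]
  exact mul_mem hu hmem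

/-- The Möbius map with parameter `a` pulls the Cayley transform of `t` back to that of
`(1 - a) / (1 + a) * t`. -/
theorem cayley_mem_spectrum_of_mobiusShift {A : Type*} [Ring A] [Algebra ℂ A] {u : A} {a t : ℝ}
    (ha : a ∈ Set.Icc (0 : ℝ) 1) (h : IsUnit (1 + (a : ℂ) • u))
    (ht : ((t : ℂ) - Complex.I) / ((t : ℂ) + Complex.I) ∈ spectrum ℂ (mobiusShift (a : ℂ) u)) :
    ((((1 - a) / (1 + a) * t : ℝ) : ℂ) - Complex.I) /
      ((((1 - a) / (1 + a) * t : ℝ) : ℂ) + Complex.I) ∈ spectrum ℂ u := by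
  have hne : ∀ s : ℝ, (s : ℂ) + Complex.I ≠ 0 := fun s hs => by
    simpa using congrArg Complex.im hs
  have ha1 : (1 + a : ℂ) ≠ 0 := by
    have : (1 + a : ℝ) ≠ 0 := by linarith [ha.1]
    exact_mod_cast this
  set s : ℝ := (1 - a) / (1 + a) * t with hs
  have hs' : (s : ℂ) * (1 + a) = (1 - a) * t := by
    rw [hs]; push_cast; field_simp
  by_contra hmem
  apply ht
  rw [spectrum.notMem_iff] at hmem
  obtain ⟨x, hx⟩ := h
  have hc : (s + Complex.I) * (1 + a) / (t + Complex.I) ≠ 0 :=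
    div_ne_zero (mul_ne_zero (hne s) ha1) (hne t)
  have key := (hmem.smul (Units.mk0 _ hc)).mul (x⁻¹).isUnit
  have e1 : (s + Complex.I) * (1 + a) / (t + Complex.I) *
      ((s - Complex.I) / (s + Complex.I)) = (t - Complex.I) / (t + Complex.I) - a := by
    have := hne s
    have := hne t
    field_simp
    linear_combination hs'
  have e2 : (s + Complex.I) * (1 + a) / (t + Complex.I) =
      1 - (t - Complex.I) / (t + Complex.I) * a := by
    have := hne t
    field_simp
    linear_combination hs'
  rw [spectrum.mem_resolventSet_iff]
  convert key using 1
  rw [Units.eq_mul_inv_iff_mul_eq, mobiusShift, ← hx, Ring.inverse_unit, sub_mul, mul_assoc,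
    Units.inv_mul, mul_one, hx, Units.smul_def, Units.val_mk0, smul_sub,
    Algebra.algebraMap_eq_smul_one, Algebra.algebraMap_eq_smul_one, smul_smul, e1, e2]
  simp only [smul_mul_assoc, one_mul, smul_add, sub_smul, smul_smul, one_smul]
  abel

theorem mobiusShift_sub_one {A : Type*} [Ring A] [Algebra ℂ A] {u : A} {a : ℂ}
    (h : IsUnit (1 + a • u)) :
    mobiusShift a u - 1 = (u - 1) * ((1 - a) • Ring.inverse (1 + a • u)) := by
  have hnum : (u + a • 1) - (1 + a • u) = (1 - a) • (u - 1) := by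
    simp only [sub_smul, smul_sub, one_smul]
    abel
  rw [mul_smul_comm, ← smul_mul_assoc, ← hnum, sub_mul, Ring.mul_inverse_cancel _ h, mobiusShift]

/-- For every `λ ≥ 0`, the spaces `U⟨λ⟩` of unitaries whose spectrum avoids the Cayley image
`{(t − i)/(t + i) : t ∈ [−λ, λ]}`, and `U_K⟨λ⟩` of such unitaries with `u − 1` compact, are
contractible. -/
theorem stmt_18 (H : Type*) [NormedAddCommGroup H] [InnerProductSpace ℂ H]
    [CompleteSpace H] [TopologicalSpace.SeparableSpace H]
    (hinf : ¬ FiniteDimensional ℂ H) (l : ℝ) (hl : 0 ≤ l) :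
    ContractibleSpace
      {u : H →L[ℂ] H // u ∈ unitary (H →L[ℂ] H) ∧
        spectrum ℂ u ∩
          ((fun t : ℝ => ((t : ℂ) - Complex.I) / ((t : ℂ) + Complex.I)) ''
            Set.Icc (-l) l) = ∅} ∧
    ContractibleSpace
      {u : H →L[ℂ] H // u ∈ unitary (H →L[ℂ] H) ∧
        spectrum ℂ u ∩
          ((fun t : ℝ => ((t : ℂ) - Complex.I) / ((t : ℂ) + Complex.I)) ''
            Set.Icc (-l) l) = ∅ ∧
        IsCompactOperator ⇑(u - 1)} := by
  have hneg : ((0 : ℝ) - Complex.I) / ((0 : ℝ) + Complex.I) = -1 := by simp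
  have hunit : ∀ u : H →L[ℂ] H, u ∈ unitary (H →L[ℂ] H) → spectrum ℂ u ∩
      ((fun t : ℝ => ((t : ℂ) - Complex.I) / ((t : ℂ) + Complex.I)) '' Set.Icc (-l) l) = ∅ →
      ∀ a : ℝ, a ∈ Set.Icc (0 : ℝ) 1 → IsUnit (1 + (a : ℂ) • u) := fun u hu hs a ha =>
    isUnit_one_add_smul_of_mem_unitary hu
      (fun h => Set.eq_empty_iff_forall_notMem.mp hs _ ⟨h, 0, ⟨by linarith, hl⟩, hneg⟩) ha
  have hspec : ∀ u : H →L[ℂ] H, u ∈ unitary (H →L[ℂ] H) → spectrum ℂ u ∩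
      ((fun t : ℝ => ((t : ℂ) - Complex.I) / ((t : ℂ) + Complex.I)) '' Set.Icc (-l) l) = ∅ →
      ∀ a : ℝ, a ∈ Set.Icc (0 : ℝ) 1 → spectrum ℂ (mobiusShift (a : ℂ) u) ∩
      ((fun t : ℝ => ((t : ℂ) - Complex.I) / ((t : ℂ) + Complex.I)) '' Set.Icc (-l) l) = ∅ := by
    rintro u hu hs a ha
    rw [Set.eq_empty_iff_forall_notMem]
    rintro _ ⟨hw, t, ht, rfl⟩
    refine Set.eq_empty_iff_forall_notMem.mp hs _
      ⟨cayley_mem_spectrum_of_mobiusShift ha (hunit u hu hs a ha) hw, _, ?_, rfl⟩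
    have hr0 : 0 ≤ (1 - a) / (1 + a) := div_nonneg (by linarith [ha.2]) (by linarith [ha.1])
    have hr1 : (1 - a) / (1 + a) ≤ 1 := (div_le_one (by linarith [ha.1])).mpr (by linarith [ha.1])
    rw [Set.mem_Icc, ← abs_le] at ht
    rw [Set.mem_Icc, ← abs_le, abs_mul, abs_of_nonneg hr0]
    exact (mul_le_of_le_one_left (abs_nonneg t) hr1).trans ht
  have hone : spectrum ℂ (1 : H →L[ℂ] H) ∩
      ((fun t : ℝ => ((t : ℂ) - Complex.I) / ((t : ℂ) + Complex.I)) '' Set.Icc (-l) l) = ∅ := by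
    rw [Set.eq_empty_iff_forall_notMem]
    rintro _ ⟨hw, t, -, rfl⟩
    have : Nontrivial H := by
      by_contra h
      rw [not_nontrivial_iff_subsingleton] at h
      exact hinf inferInstance
    rw [spectrum.one_eq, Set.mem_singleton_iff] at hw
    have hne : (t : ℂ) + Complex.I ≠ 0 := fun h => by simpa using congrArg Complex.im h
    rw [div_eq_one_iff_eq hne] at hw
    have him := congrArg Complex.im hw
    norm_num at him
  constructor
  · refine contractibleSpace_of_mobiusShift_mem _ ⟨one_mem _, hone⟩
      (fun u hu => hunit u hu.1 hu.2) fun u hu a ha => ?_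
    exact ⟨mobiusShift_mem_unitary hu.1 (hunit u hu.1 hu.2 a ha), hspec u hu.1 hu.2 a ha⟩
  · refine contractibleSpace_of_mobiusShift_mem _ ⟨one_mem _, hone, ?_⟩
      (fun u hu => hunit u hu.1 hu.2.1) fun u hu a ha => ?_
    · rw [sub_self]
      exact isCompactOperator_zero
    · have h := hunit u hu.1 hu.2.1 a ha
      refine ⟨mobiusShift_mem_unitary hu.1 h, hspec u hu.1 hu.2.1 a ha, ?_⟩
      rw [mobiusShift_sub_one h]
      exact hu.2.2.comp_clm _
end
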